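/- Assume the Riemann Hypothesis and the quantitative Twin Prime Conjecture. For any integer M > 2, F(x,T) = (T/(2π)) log x + O(x) + O_M(T/(log T)^{M−2}) uniformly for T/(log T)^M ≤ x ≤ T. -/

import Mathlib

open Real MeasureTheory

/-- The singular series of the twin prime / Goldbach type problems. -/
noncomputable def singularSeries (d : ℕ) : ℝ :=
  if Even d then
    2 * (∏' p : Nat.Primes, if 2 < (p : ℕ) then (1 - 1 / ((p : ℝ) - 1) ^ 2) else 1) *
      ∏ p ∈ d.primeFactors.filter (fun p => 2 < p), ((p : ℝ) - 1) / ((p : ℝ) - 2)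
  else 0

/-- The quantitative twin prime conjecture. -/
def TwinPrimeConjecture : Prop :=
  ∀ ε : ℝ, 0 < ε → ∃ C : ℝ, 0 < C ∧ ∀ N d : ℕ, 1 ≤ d → d ≤ N →
    |(∑ n ∈ Finset.Icc 1 N,
        ArithmeticFunction.vonMangoldt n * ArithmeticFunction.vonMangoldt (n + d)) -
      singularSeries d * N| ≤ C * (N : ℝ) ^ ((1 : ℝ) / 2 + ε)

/-- A nontrivial zero of the Riemann zeta function. -/
def IsNontrivialZero (ρ : ℂ) : Prop := riemannZeta ρ = 0 ∧ 0 < ρ.re ∧ ρ.re < 1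

/-- The multiplicity (order of vanishing) of `riemannZeta` at a point. -/
noncomputable def zetaZeroOrder (ρ : ℂ) : ℕ := sInf {n | iteratedDeriv n riemannZeta ρ ≠ 0}

/-- Montgomery's pair correlation function `F(x,T)`, with zeros counted with multiplicity. -/
noncomputable def Fpair (x T : ℝ) : ℂ :=
  ∑' ρ : {ρ : ℂ // IsNontrivialZero ρ ∧ 0 ≤ ρ.im ∧ ρ.im ≤ T},
    ∑' ρ' : {ρ : ℂ // IsNontrivialZero ρ ∧ 0 ≤ ρ.im ∧ ρ.im ≤ T},
      ((zetaZeroOrder ρ * zetaZeroOrder ρ' : ℕ) : ℂ) *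
        (x : ℂ) ^ (Complex.I * (((ρ : ℂ).im - (ρ' : ℂ).im : ℝ) : ℂ)) *
        (4 / (4 + (((ρ : ℂ).im - (ρ' : ℂ).im : ℝ) : ℂ) ^ 2))

/-- The constant `B = -C₀ - log 2π`. -/
noncomputable def Bconst : ℝ := -Real.eulerMascheroniConstant - Real.log (2 * Real.pi)

/-- `ε(y) = Σ_{h ≤ y} 𝔖(h) - y + (1/2) log y`. -/
noncomputable def epsErr (y : ℝ) : ℝ :=
  (∑ h ∈ Finset.Icc 1 ⌊y⌋₊, singularSeries h) - y + Real.log y / 2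

/-- `f(y) = ∫_1^y (ε(u) - B/2) du`. -/
noncomputable def fErr (y : ℝ) : ℝ := ∫ u in (1 : ℝ)..y, (epsErr u - Bconst / 2)

/-! ### Partial fractions for entire functions of order less than two -/

lemma exists_entire_div_pow {f : ℂ → ℂ} (hf : Differentiable ℂ f) {ρ : ℂ} (hρ : ρ ≠ 0)
    (hord : analyticOrderAt f ρ ≠ ⊤) :
    ∃ g : ℂ → ℂ, Differentiable ℂ g ∧ g ρ ≠ 0 ∧
      ∀ z, f z = (1 - z / ρ) ^ analyticOrderNatAt f ρ * g z := by
  have hfa : AnalyticAt ℂ f ρ := hf.analyticAt ρ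
  obtain ⟨h, hh, hh0, hfh⟩ := hfa.analyticOrderAt_ne_top.1 hord
  set n := analyticOrderNatAt f ρ with hn
  have key : ∀ z, 1 - z / ρ = (-1 / ρ) * (z - ρ) := fun z => by field_simp; ring
  have hne : ∀ z, z ≠ ρ → (1 - z / ρ) ≠ 0 := fun z hz => by
    rw [key]; exact mul_ne_zero (div_ne_zero (by simp) hρ) (sub_ne_zero.2 hz)
  have hc : (-1 / ρ) ≠ 0 := div_ne_zero (by simp) hρ
  let g : ℂ → ℂ := fun z => if z = ρ then h ρ / (-1 / ρ) ^ n else f z / (1 - z / ρ) ^ n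
  have hgh : g =ᶠ[nhds ρ] fun z => h z / (-1 / ρ) ^ n := by
    filter_upwards [hfh] with z hz
    by_cases hzρ : z = ρ
    · simp [g, hzρ]
    · simp only [g, hzρ, if_false]
      rw [hz, key, mul_pow, smul_eq_mul]
      have := pow_ne_zero n (sub_ne_zero.2 hzρ)
      have := pow_ne_zero n hc
      field_simp
  refine ⟨g, fun z => ?_, ?_, fun z => ?_⟩
  · by_cases hzρ : z = ρ
    · subst hzρ
      exact (hgh.differentiableAt_iff).2 (hh.differentiableAt.div_const _)
    · have : g =ᶠ[nhds z] fun w => f w / (1 - w / ρ) ^ n := by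
        filter_upwards [isOpen_ne.mem_nhds hzρ] with w hw
        simp [g, show w ≠ ρ from hw]
      refine (this.differentiableAt_iff).2 ?_
      refine (hf z).div (by fun_prop) (pow_ne_zero _ (hne z hzρ))
  · simp only [g, if_true]
    exact div_ne_zero hh0 (pow_ne_zero _ hc)
  · by_cases hzρ : z = ρ
    · subst hzρ
      have h1 := hfh.self_of_nhds
      by_cases hn0 : n = 0
      · simp [g, hn0] at h1 ⊢
        exact h1
      · rw [h1]; simp [div_self hρ, hn0]
    · simp only [g, hzρ, if_false]
      have := pow_ne_zero n (hne z hzρ)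
      field_simp

lemma exists_entire_factor {f : ℂ → ℂ} (hf : Differentiable ℂ f) (h0 : f 0 ≠ 0) (S : Finset ℂ)
    (hS : ∀ ρ ∈ S, ρ ≠ 0) :
    ∃ g : ℂ → ℂ, Differentiable ℂ g ∧ (∀ ρ ∈ S, g ρ ≠ 0) ∧
      ∀ z, f z = (∏ ρ ∈ S, (1 - z / ρ) ^ analyticOrderNatAt f ρ) * g z := by
  classical
  induction S using Finset.induction_on with
  | empty => exact ⟨f, hf, by simp, by simp⟩
  | insert ρ S hρS ih =>
    obtain ⟨g, hg, hgS, hfg⟩ := ih fun ρ' h => hS ρ' (Finset.mem_insert_of_mem h)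
    have hρ : ρ ≠ 0 := hS ρ (Finset.mem_insert_self _ _)
    have hg0 : g 0 ≠ 0 := fun h => h0 (by rw [hfg, h, mul_zero])
    have htop : ∀ {k : ℂ → ℂ}, Differentiable ℂ k → k 0 ≠ 0 → ∀ w, analyticOrderAt k w ≠ ⊤ := by
      intro k hk hk0 w hw
      have := (AnalyticOnNhd.analyticOrderAt_eq_top_iff_eq_zero (f := k) w
        (fun x => hk.analyticAt x)).1 hw
      exact hk0 (by simp [this])
    obtain ⟨k, hk, hkρ, hgk⟩ := exists_entire_div_pow hg hρ (htop hg hg0 ρ)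
    have hP : Differentiable ℂ (fun z : ℂ => ∏ ρ ∈ S, (1 - z / ρ) ^ analyticOrderNatAt f ρ) := by
      fun_prop
    have hPρ : (∏ ρ' ∈ S, (1 - ρ / ρ') ^ analyticOrderNatAt f ρ') ≠ 0 := by
      refine Finset.prod_ne_zero_iff.2 fun ρ' h => pow_ne_zero _ ?_
      have h1 := hS ρ' (Finset.mem_insert_of_mem h)
      intro h2
      have : ρ = ρ' := by field_simp at h2; linear_combination -h2
      exact hρS (this ▸ h)
    have hord : analyticOrderNatAt f ρ = analyticOrderNatAt g ρ := by
      have h1 : f = (fun z : ℂ => ∏ ρ ∈ S, (1 - z / ρ) ^ analyticOrderNatAt f ρ) * g := by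
        ext z; exact hfg z
      have h2 := analyticOrderAt_mul (hP.analyticAt ρ) (hg.analyticAt ρ)
      rw [← h1, (hP.analyticAt ρ).analyticOrderAt_eq_zero.2 hPρ, zero_add] at h2
      simp [analyticOrderNatAt, h2]
    refine ⟨k, hk, ?_, fun z => ?_⟩
    · intro ρ' h
      rcases Finset.mem_insert.1 h with rfl | h
      · exact hkρ
      · intro hk0
        exact hgS ρ' h (by rw [hgk, hk0, mul_zero])
    · rw [Finset.prod_insert hρS, hfg, hgk, hord]; ring

/-- The set of zeros of a function in a closed disc around the origin. -/
def zerosIn (f : ℂ → ℂ) (r : ℝ) : Set ℂ := {ρ | f ρ = 0 ∧ ‖ρ‖ ≤ r}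

lemma finite_zerosIn {f : ℂ → ℂ} (hf : Differentiable ℂ f) (h0 : f 0 ≠ 0) (r : ℝ) :
    (zerosIn f r).Finite := by
  have hcod := AnalyticOnNhd.preimage_zero_mem_codiscrete (f := f) (x := 0)
    (fun x _ => hf.analyticAt x) h0
  have h1 := mem_codiscrete'.mp hcod
  have hc : IsCompact (Metric.closedBall (0 : ℂ) r) := isCompact_closedBall 0 r
  have h2 : IsCompact (Metric.closedBall (0 : ℂ) r ∩ (f ⁻¹' {0}ᶜ)ᶜ) := hc.inter_right
    (by simpa using h1.1)
  have h3 := h2.finite (h1.2.mono Set.inter_subset_right)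
  refine h3.subset fun ρ hρ => ⟨by simpa using hρ.2, ?_⟩
  simpa using hρ.1

/-- Growth of order at most `3/2`. -/
def OrderBound (f : ℂ → ℂ) (C : ℝ) : Prop := ∀ z, ‖f z‖ ≤ Real.exp (C * (1 + ‖z‖) ^ (3 / 2 : ℝ))

lemma entire_quotient_bound {f g : ℂ → ℂ} {C r R b : ℝ} (hf : OrderBound f C)
    (hg : Differentiable ℂ g) (S : Finset ℂ) (m : ℂ → ℕ) (hS : ∀ ρ ∈ S, ρ ≠ 0 ∧ ‖ρ‖ ≤ r)
    (hr : 0 < r) (hb : 1 ≤ b) (hR : (b + 1) * r ≤ R)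
    (hfg : ∀ z, f z = (∏ ρ ∈ S, (1 - z / ρ) ^ m ρ) * g z) (z : ℂ) (hz : ‖z‖ ≤ R) :
    b ^ (∑ ρ ∈ S, m ρ) * ‖g z‖ ≤ Real.exp (C * (1 + R) ^ (3 / 2 : ℝ)) := by
  have hRpos : 0 < R := by nlinarith
  have hbp : 0 < b ^ (∑ ρ ∈ S, m ρ) := by positivity
  rw [← le_div_iff₀' hbp]
  refine Complex.norm_le_of_forall_mem_frontier_norm_le (U := Metric.ball 0 R)
    Metric.isBounded_ball hg.diffContOnCl (fun w hw => ?_) ?_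
  · rw [frontier_ball _ hRpos.ne', mem_sphere_zero_iff_norm] at hw
    rw [le_div_iff₀' hbp]
    refine le_trans ?_ ((hf w).trans (by rw [hw]))
    rw [hfg w, norm_mul, norm_prod, ← Finset.prod_pow_eq_pow_sum]
    refine mul_le_mul_of_nonneg_right ?_ (norm_nonneg _)
    refine Finset.prod_le_prod (fun _ _ => by positivity) fun ρ hρ => ?_
    rw [norm_pow]
    refine pow_le_pow_left₀ (by positivity) ?_ _
    have h1 : b + 1 ≤ ‖w / ρ‖ := by
      rw [norm_div, le_div_iff₀ (norm_pos_iff.2 (hS ρ hρ).1), hw]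
      refine le_trans ?_ hR
      have := (hS ρ hρ).2
      gcongr
    have h2 := norm_sub_norm_le (w / ρ) 1
    rw [norm_one] at h2
    rw [norm_sub_rev]
    linarith
  · rw [closure_ball _ hRpos.ne']; simpa using hz

lemma exists_count_bound {f : ℂ → ℂ} (hf : Differentiable ℂ f) (h0 : f 0 ≠ 0) {C : ℝ} (hC : 0 ≤ C)
    (hfC : OrderBound f C) : ∃ A : ℝ, 0 ≤ A ∧ ∀ r : ℝ, 1 ≤ r → ∀ S : Finset ℂ,
      (∀ ρ ∈ S, f ρ = 0 ∧ ‖ρ‖ ≤ r) →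
      ((∑ ρ ∈ S, analyticOrderNatAt f ρ : ℕ) : ℝ) ≤ A * r ^ (3 / 2 : ℝ) := by
  refine ⟨C * 5 ^ (3 / 2 : ℝ) + |Real.log ‖f 0‖|, by positivity, fun r hr S hS => ?_⟩
  have hS0 : ∀ ρ ∈ S, ρ ≠ 0 := fun ρ hρ h => h0 (h ▸ (hS ρ hρ).1)
  obtain ⟨g, hg, -, hfg⟩ := exists_entire_factor hf h0 S hS0
  have h1 := entire_quotient_bound (b := 3) (R := 4 * r) hfC hg S _
    (fun ρ hρ => ⟨hS0 ρ hρ, (hS ρ hρ).2⟩) (by linarith) (by norm_num) (by linarith) hfg 0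
    (by simp; linarith)
  have hg0 : g 0 = f 0 := by rw [hfg 0]; simp
  set N := ∑ ρ ∈ S, analyticOrderNatAt f ρ
  have hpos : 0 < ‖f 0‖ := norm_pos_iff.2 h0
  rw [hg0] at h1
  have h2 := Real.log_le_log (by positivity) h1
  rw [Real.log_exp, Real.log_mul (by positivity) hpos.ne', Real.log_pow] at h2
  have hlog3 : 1 ≤ Real.log 3 := by
    rw [Real.le_log_iff_exp_le (by norm_num)]; exact Real.exp_one_lt_three.le
  have h3 : (1 + 4 * r) ^ (3 / 2 : ℝ) ≤ 5 ^ (3 / 2 : ℝ) * r ^ (3 / 2 : ℝ) := by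
    rw [← Real.mul_rpow (by norm_num) (by linarith)]
    exact Real.rpow_le_rpow (by linarith) (by linarith) (by norm_num)
  have h4 : (1 : ℝ) ≤ r ^ (3 / 2 : ℝ) := Real.one_le_rpow hr (by norm_num)
  have h5 : (N : ℝ) ≤ N * Real.log 3 := le_mul_of_one_le_right (by positivity) hlog3
  have h6 : |Real.log ‖f 0‖| ≤ |Real.log ‖f 0‖| * r ^ (3 / 2 : ℝ) :=
    le_mul_of_one_le_right (by positivity) h4
  have h7 := neg_abs_le (Real.log ‖f 0‖)
  have h8 := mul_le_mul_of_nonneg_left h3 hC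
  nlinarith

/-- A nonvanishing quotient has an almost constant logarithmic derivative. -/
lemma logDeriv_sub_small {g : ℂ → ℂ} (hg : Differentiable ℂ g) {r B : ℝ} (hr : 0 < r)
    (hne : ∀ z ∈ Metric.ball (0 : ℂ) r, g z ≠ 0) (hB : 0 < B)
    (hgB : ∀ z ∈ Metric.ball (0 : ℂ) r, ‖g z‖ ≤ Real.exp B * ‖g 0‖) {z w : ℂ}
    (hz : ‖z‖ < r / 8) (hw : ‖w‖ < r / 8) :
    ‖logDeriv g z - logDeriv g w‖ ≤ 64 * B / r ^ 2 * ‖z - w‖ := by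
  have h0r : (0 : ℂ) ∈ Metric.ball (0 : ℂ) r := Metric.mem_ball_self hr
  have hld : DifferentiableOn ℂ (logDeriv g) (Metric.ball 0 r) := by
    intro x hx
    exact (((hg.analyticAt x).deriv.differentiableAt).div (hg x) (hne x hx)).differentiableWithinAt
  obtain ⟨h', hh'⟩ := hld.isExactOn_ball
  have hd : ∀ x ∈ Metric.ball (0 : ℂ) r, HasDerivAt (fun z => h' z - h' 0) (logDeriv g x) x :=
    fun x hx => (hh' x hx).sub_const _
  set h : ℂ → ℂ := fun z => h' z - h' 0 with hh
  have hdo : DifferentiableOn ℂ h (Metric.ball 0 r) :=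
    fun x hx => (hd x hx).differentiableAt.differentiableWithinAt
  have hgh : ∀ x ∈ Metric.ball (0 : ℂ) r, g x = g 0 * Complex.exp (h x) := by
    intro x hx
    have hc : ∀ y ∈ Metric.ball (0 : ℂ) r, HasDerivAt (fun z => g z * Complex.exp (-h z)) 0 y := by
      intro y hy
      have := (hg y).hasDerivAt.mul ((hd y hy).neg.cexp)
      refine this.congr_deriv ?_
      have := hne y hy
      rw [logDeriv_apply]; field_simp; ring
    have := (convex_ball (0 : ℂ) r).is_const_of_fderivWithin_eq_zero (𝕜 := ℂ)
      (f := fun z => g z * Complex.exp (-h z))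
      (fun y hy => (hc y hy).differentiableAt.differentiableWithinAt)
      (fun y hy => by
        rw [fderivWithin_of_isOpen Metric.isOpen_ball hy]
        simpa using (hc y hy).hasFDerivAt.fderiv) hx h0r
    simp only [hh, sub_self, neg_zero, Complex.exp_zero, mul_one] at this
    rw [← this, mul_assoc, ← Complex.exp_add]
    simp [hh]
  have hre : ∀ x ∈ Metric.ball (0 : ℂ) r, (h x).re ≤ B := by
    intro x hx
    have h1 := hgB x hx
    rw [hgh x hx, norm_mul, Complex.norm_exp, mul_comm] at h1
    have := le_of_mul_le_mul_right h1 (norm_pos_iff.2 (hne 0 h0r))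
    exact Real.exp_le_exp.1 this
  have hbound : ∀ x, ‖x‖ ≤ r / 2 → ‖h x‖ ≤ 2 * B := by
    intro x hx
    have h1 := Complex.borelCaratheodory_zero hB hdo (fun y hy => hre y hy) hr
      (z := x) (by simp; linarith) (by simp [hh])
    refine h1.trans ?_
    rw [div_le_iff₀ (by linarith)]
    nlinarith
  have hder : ∀ x, ‖x‖ ≤ r / 4 → ‖logDeriv g x‖ ≤ 8 * B / r := by
    intro x hx
    have hsub : Metric.closedBall x (r / 4) ⊆ Metric.ball 0 r := fun y hy => by
      have h1 : ‖y - x‖ ≤ r / 4 := by simpa [dist_eq_norm] using hy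
      have := norm_add_le (y - x) x
      simp at this ⊢; linarith
    have h1 := Complex.norm_deriv_le_of_forall_mem_sphere_norm_le (c := x) (R := r / 4) (f := h)
      (C := 2 * B) (by positivity) ((hdo.mono ?_).diffContOnCl) (fun y hy => hbound y ?_)
    · rw [(hd x (hsub (Metric.mem_closedBall_self (by positivity)))).deriv] at h1
      refine h1.trans (le_of_eq ?_)
      field_simp; ring
    · rw [closure_ball _ (by positivity)]; exact hsub
    · have h1 : ‖y - x‖ = r / 4 := by simpa [dist_eq_norm] using hy
      have := norm_add_le (y - x) x
      simp at this ⊢; linarith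
  have hder2 : ∀ x ∈ Metric.ball (0 : ℂ) (r / 8), ‖deriv (logDeriv g) x‖ ≤ 64 * B / r ^ 2 := by
    intro x hx
    have hx : ‖x‖ < r / 8 := by simpa using hx
    have hsub : ∀ y ∈ Metric.closedBall x (r / 8), ‖y‖ ≤ r / 4 := fun y hy => by
      have h1 : ‖y - x‖ ≤ r / 8 := by simpa [dist_eq_norm] using hy
      have := norm_add_le (y - x) x
      simp at this ⊢; linarith
    have h1 := Complex.norm_deriv_le_of_forall_mem_sphere_norm_le (c := x) (R := r / 8)
      (f := logDeriv g)
      (C := 8 * B / r) (by positivity) ((hld.mono ?_).diffContOnCl) (fun y hy => hder y ?_)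
    · refine h1.trans (le_of_eq ?_)
      field_simp; ring
    · rw [closure_ball _ (by positivity)]
      intro y hy
      have := hsub y hy
      simp; linarith
    · exact hsub y (Metric.sphere_subset_closedBall hy)
  refine (convex_ball (0 : ℂ) (r / 8)).norm_image_sub_le_of_norm_deriv_le (𝕜 := ℂ)
    (fun x hx => ?_) hder2 (by simpa using hw) (by simpa using hz)
  have : x ∈ Metric.ball (0 : ℂ) r := by simp at hx ⊢; linarith
  exact (hld x this).differentiableAt (Metric.isOpen_ball.mem_nhds this)

lemma norm_logDeriv_sub_sum_le {f : ℂ → ℂ} (hf : Differentiable ℂ f) (h0 : f 0 ≠ 0) {C : ℝ}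
    (hC : 0 ≤ C) (hfC : OrderBound f C) {r : ℝ} (hr : 0 < r) {z w : ℂ} (hz : ‖z‖ < r / 8)
    (hw : ‖w‖ < r / 8) (hfz : f z ≠ 0) (hfw : f w ≠ 0) :
    ‖logDeriv f z - logDeriv f w - ∑ ρ ∈ (finite_zerosIn hf h0 r).toFinset,
      (analyticOrderNatAt f ρ : ℂ) * (1 / (z - ρ) - 1 / (w - ρ))‖ ≤
      64 * (C * (1 + 2 * r) ^ (3 / 2 : ℝ) + |Real.log ‖f 0‖| + 1) / r ^ 2 * ‖z - w‖ := by
  set S := (finite_zerosIn hf h0 r).toFinset with hSdef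
  have hSm : ∀ ρ, ρ ∈ S ↔ f ρ = 0 ∧ ‖ρ‖ ≤ r := fun ρ => by simp [hSdef, zerosIn]
  have hS0 : ∀ ρ ∈ S, ρ ≠ 0 := fun ρ hρ h => h0 (h ▸ ((hSm ρ).1 hρ).1)
  obtain ⟨g, hg, hgS, hfg⟩ := exists_entire_factor hf h0 S hS0
  have hg0 : g 0 = f 0 := by rw [hfg 0]; simp
  have hpos : 0 < ‖f 0‖ := norm_pos_iff.2 h0
  set B := C * (1 + 2 * r) ^ (3 / 2 : ℝ) + |Real.log ‖f 0‖| + 1 with hB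
  have hBpos : 0 < B := by positivity
  have hne : ∀ x ∈ Metric.ball (0 : ℂ) r, g x ≠ 0 := fun x hx hgx => by
    have hx' : ‖x‖ < r := by simpa using hx
    exact hgS x ((hSm x).2 ⟨by rw [hfg, hgx, mul_zero], hx'.le⟩) hgx
  have hgB : ∀ x ∈ Metric.ball (0 : ℂ) r, ‖g x‖ ≤ Real.exp B * ‖g 0‖ := fun x hx => by
    have hx' : ‖x‖ < r := by simpa using hx
    have h1 := entire_quotient_bound (b := 1) (R := 2 * r) hfC hg S _
      (fun ρ hρ => ⟨hS0 ρ hρ, ((hSm ρ).1 hρ).2⟩) hr le_rfl (by linarith) hfg x (by linarith)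
    rw [one_pow, one_mul] at h1
    refine h1.trans ?_
    rw [hg0, ← Real.exp_log hpos, ← Real.exp_add, Real.exp_le_exp]
    have := neg_abs_le (Real.log ‖f 0‖)
    linarith
  have hlog : ∀ x, ‖x‖ < r → f x ≠ 0 → logDeriv f x =
      ∑ ρ ∈ S, (analyticOrderNatAt f ρ : ℂ) * (1 / (x - ρ)) + logDeriv g x := by
    intro x hx hfx
    have hxne : ∀ ρ ∈ S, 1 - x / ρ ≠ 0 := fun ρ hρ h => by
      have := hS0 ρ hρ
      have : x = ρ := by field_simp at h; linear_combination -h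
      exact hfx (this ▸ ((hSm ρ).1 hρ).1)
    have e : f = fun z => (∏ ρ ∈ S, (1 - z / ρ) ^ analyticOrderNatAt f ρ) * g z := funext hfg
    have hgx : g x ≠ 0 := hne x (by simpa using hx)
    conv_lhs => rw [e]
    rw [logDeriv_mul x (Finset.prod_ne_zero_iff.2 fun ρ hρ => pow_ne_zero _ (hxne ρ hρ)) hgx
      (by fun_prop) (hg x), logDeriv_prod (f := fun ρ z => (1 - z / ρ) ^ analyticOrderNatAt f ρ)
        (fun ρ hρ => pow_ne_zero _ (hxne ρ hρ)) (fun ρ hρ => by fun_prop)]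
    congr 1
    refine Finset.sum_congr rfl fun ρ hρ => ?_
    have h1 : HasDerivAt (fun z : ℂ => 1 - z / ρ) (-(1 / ρ)) x := by
      simpa using ((hasDerivAt_id x).div_const ρ).const_sub 1
    rw [logDeriv_fun_pow h1.differentiableAt, logDeriv_apply, h1.deriv]
    have := hS0 ρ hρ
    have h2 := hxne ρ hρ
    have h3 : x - ρ ≠ 0 := fun h => h2 (by rw [sub_eq_zero.1 h, div_self this, sub_self])
    congr 1
    rw [div_eq_div_iff h2 h3]
    field_simp; ring
  have := logDeriv_sub_small hg hr hne hBpos hgB hz hw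
  convert this using 2
  rw [hlog z (by linarith) hfz, hlog w (by linarith) hfw]
  simp only [mul_sub, Finset.sum_sub_distrib]
  ring

lemma summable_zeros {f : ℂ → ℂ} (hf : Differentiable ℂ f) (h0 : f 0 ≠ 0) {C : ℝ}
    (hC : 0 ≤ C) (hfC : OrderBound f C) :
    Summable fun ρ : {ρ : ℂ // f ρ = 0} => (analyticOrderNatAt f ρ : ℝ) / (1 + ‖(ρ : ℂ)‖ ^ 2) := by
  obtain ⟨A, hA, hcount⟩ := exists_count_bound hf h0 hC hfC
  set q : ℝ := 2 ^ (-(1 / 2) : ℝ) with hq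
  have hq0 : 0 ≤ q := by positivity
  have hq1 : q < 1 := Real.rpow_lt_one_of_one_lt_of_neg (by norm_num) (by norm_num)
  refine summable_of_sum_le (c := 4 * A * (1 - q)⁻¹) (fun ρ => by positivity) fun u => ?_
  obtain ⟨J, hJ⟩ : ∃ J : ℕ, ∀ ρ ∈ u, ‖(ρ : ℂ)‖ ≤ 2 ^ J := by
    obtain ⟨M, hM⟩ := (u.image fun ρ : {ρ : ℂ // f ρ = 0} => ‖(ρ : ℂ)‖).bddAbove
    obtain ⟨J, hJ⟩ := pow_unbounded_of_one_lt M (by norm_num : (1 : ℝ) < 2)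
    exact ⟨J, fun ρ hρ => (hM (Finset.mem_coe.2 (Finset.mem_image_of_mem _ hρ))).trans hJ.le⟩
  have h1 : ∀ ρ ∈ u, (analyticOrderNatAt f ρ : ℝ) / (1 + ‖(ρ : ℂ)‖ ^ 2) ≤
      ∑ j ∈ Finset.range (J + 1), if ‖(ρ : ℂ)‖ ≤ 2 ^ j then
        (analyticOrderNatAt f ρ : ℝ) * (4 / 4 ^ j) else 0 := by
    intro ρ hρ
    have hex : ∃ j : ℕ, ‖(ρ : ℂ)‖ ≤ 2 ^ j := ⟨J, hJ ρ hρ⟩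
    classical
    set j := Nat.find hex with hj
    have hjs : ‖(ρ : ℂ)‖ ≤ 2 ^ j := Nat.find_spec hex
    have hjJ : j ∈ Finset.range (J + 1) := by
      rw [Finset.mem_range, Nat.lt_succ_iff]; exact Nat.find_min' hex (hJ ρ hρ)
    refine le_trans ?_ (Finset.single_le_sum (f := fun j => if ‖(ρ : ℂ)‖ ≤ 2 ^ j then
        (analyticOrderNatAt f ρ : ℝ) * (4 / 4 ^ j) else 0) (fun i _ => by positivity) hjJ)
    simp only [hjs, if_true]
    rw [div_eq_mul_inv]
    refine mul_le_mul_of_nonneg_left ?_ (by positivity)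
    rw [inv_eq_one_div, div_le_div_iff₀ (by positivity) (by positivity), one_mul]
    rcases Nat.eq_zero_or_pos j with h | h
    · rw [h]; nlinarith [sq_nonneg ‖(ρ : ℂ)‖]
    · have hmin := Nat.find_min hex (m := j - 1) (by omega)
      push Not at hmin
      have h2 : (2 : ℝ) ^ j = 2 * 2 ^ (j - 1) := by
        rw [← pow_succ']; congr 1; omega
      have h4 : (4 : ℝ) ^ j = (2 ^ j) ^ 2 := by rw [← pow_mul, mul_comm, pow_mul]; norm_num
      have h5 : (0 : ℝ) < 2 ^ (j - 1) := by positivity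
      rw [h4, h2]; nlinarith
  refine (Finset.sum_le_sum h1).trans ?_
  rw [Finset.sum_comm]
  have h2 : ∀ j ∈ Finset.range (J + 1), (∑ ρ ∈ u, if ‖(ρ : ℂ)‖ ≤ 2 ^ j then
        (analyticOrderNatAt f ρ : ℝ) * (4 / 4 ^ j) else 0) ≤ 4 * A * q ^ j := by
    intro j _
    rw [← Finset.sum_filter, ← Finset.sum_mul]
    have := hcount (2 ^ j) (one_le_pow₀ (by norm_num)) ((u.filter fun ρ : {ρ : ℂ // f ρ = 0} => ‖(ρ : ℂ)‖ ≤ 2 ^ j).map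
      (Function.Embedding.subtype fun ρ => f ρ = 0)) (fun ρ hρ => by
        simp only [Finset.mem_map, Finset.mem_filter] at hρ
        obtain ⟨a, ha, rfl⟩ := hρ
        exact ⟨a.2, ha.2⟩)
    rw [Finset.sum_map] at this
    push_cast at this
    refine (mul_le_mul_of_nonneg_right this (by positivity)).trans (le_of_eq ?_)
    have e : q ^ j * 4 ^ j = ((2 : ℝ) ^ j) ^ (3 / 2 : ℝ) := by
      rw [hq, ← Real.rpow_natCast, ← Real.rpow_natCast, ← Real.rpow_natCast, ← Real.rpow_mul (by norm_num), ← Real.rpow_mul (by norm_num),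
        show (4 : ℝ) = 2 ^ (2 : ℝ) by norm_num, ← Real.rpow_mul (by norm_num),
        ← Real.rpow_add (by norm_num)]
      congr 1; ring
    rw [← e]; field_simp
  refine (Finset.sum_le_sum h2).trans ?_
  rw [← Finset.mul_sum, ← tsum_geometric_of_lt_one hq0 hq1]
  exact mul_le_mul_of_nonneg_left ((summable_geometric_of_lt_one hq0 hq1).sum_le_tsum _
    fun _ _ => by positivity) (by positivity)

lemma hasSum_logDeriv_sub {f : ℂ → ℂ} (hf : Differentiable ℂ f) (h0 : f 0 ≠ 0) {C : ℝ}
    (hC : 0 ≤ C) (hfC : OrderBound f C) {z w : ℂ} (hfz : f z ≠ 0) (hfw : f w ≠ 0) :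
    HasSum (fun ρ : {ρ : ℂ // f ρ = 0} => (analyticOrderNatAt f ρ : ℂ) *
      (1 / (z - ρ) - 1 / (w - ρ))) (logDeriv f z - logDeriv f w) := by
  have hsum : Summable (fun ρ : {ρ : ℂ // f ρ = 0} => (analyticOrderNatAt f ρ : ℂ) *
      (1 / (z - ρ) - 1 / (w - ρ))) := by
    refine ((summable_zeros hf h0 hC hfC).mul_left (8 * ‖w - z‖)).of_norm_bounded_eventually ?_
    have hfin : {ρ : {ρ : ℂ // f ρ = 0} | ‖(ρ : ℂ)‖ < 2 * ‖z‖ + 2 * ‖w‖ + 1}.Finite := by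
      refine Set.Finite.of_finite_image (f := Subtype.val) ?_ Subtype.val_injective.injOn
      refine (finite_zerosIn hf h0 (2 * ‖z‖ + 2 * ‖w‖ + 1)).subset ?_
      rintro _ ⟨ρ, hρ, rfl⟩
      exact ⟨ρ.2, le_of_lt hρ⟩
    filter_upwards [hfin.compl_mem_cofinite] with ρ hρ
    have hρ' : 2 * ‖z‖ + 2 * ‖w‖ + 1 ≤ ‖(ρ : ℂ)‖ := by simpa using hρ
    have hz := norm_nonneg z
    have hw := norm_nonneg w
    have hz1 : ‖(ρ : ℂ)‖ / 2 ≤ ‖z - ρ‖ := by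
      have := norm_sub_norm_le (ρ : ℂ) z
      rw [norm_sub_rev] at this; linarith
    have hw1 : ‖(ρ : ℂ)‖ / 2 ≤ ‖w - ρ‖ := by
      have := norm_sub_norm_le (ρ : ℂ) w
      rw [norm_sub_rev] at this; linarith
    have hz2 : z - ρ ≠ 0 := fun h => by rw [h, norm_zero] at hz1; linarith
    have hw2 : w - ρ ≠ 0 := fun h => by rw [h, norm_zero] at hw1; linarith
    have e : (1 / (z - ρ) - 1 / (w - ρ)) = (w - z) / ((z - ρ) * (w - ρ)) := by
      field_simp; ring
    rw [e, norm_mul, norm_div, norm_mul, Complex.norm_natCast]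
    have hp : 0 < ‖z - ρ‖ * ‖w - ρ‖ := by positivity
    rw [mul_div_assoc', mul_div_assoc', div_le_div_iff₀ hp (by positivity)]
    have h3 : ‖(ρ : ℂ)‖ / 2 * (‖(ρ : ℂ)‖ / 2) ≤ ‖z - ρ‖ * ‖w - ρ‖ := by gcongr
    have h4 : 1 + ‖(ρ : ℂ)‖ ^ 2 ≤ 8 * (‖z - ρ‖ * ‖w - ρ‖) := by nlinarith
    have h5 := mul_le_mul_of_nonneg_left h4
      (by positivity : 0 ≤ (analyticOrderNatAt f ρ : ℝ) * ‖w - z‖)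
    linarith
  have hmono : Monotone fun n : ℕ =>
      ((finite_zerosIn hf h0 (n : ℝ)).toFinset.subtype fun ρ => f ρ = 0) := by
    intro a b hab ρ hρ
    simp only [Finset.mem_subtype, Set.Finite.mem_toFinset] at hρ ⊢
    exact ⟨hρ.1, hρ.2.trans (by exact_mod_cast hab)⟩
  have hT := Filter.tendsto_atTop_finset_of_monotone hmono (fun ρ => by
    obtain ⟨n, hn⟩ := exists_nat_ge ‖(ρ : ℂ)‖
    exact ⟨n, by simpa [zerosIn] using ⟨ρ.2, hn⟩⟩)
  have h1 := hsum.hasSum.comp hT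
  suffices h : Filter.Tendsto ((fun s : Finset {ρ : ℂ // f ρ = 0} => ∑ ρ ∈ s,
      (analyticOrderNatAt f ρ : ℂ) * (1 / (z - ρ) - 1 / (w - ρ))) ∘ fun n : ℕ =>
      ((finite_zerosIn hf h0 (n : ℝ)).toFinset.subtype fun ρ => f ρ = 0)) Filter.atTop
      (nhds (logDeriv f z - logDeriv f w)) by
    have := tendsto_nhds_unique h1 h
    rw [← this]; exact hsum.hasSum
  have hsmall : Filter.Tendsto (fun r : ℝ =>
      64 * (C * (1 + 2 * r) ^ (3 / 2 : ℝ) + |Real.log ‖f 0‖| + 1) / r ^ 2 * ‖z - w‖)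
      Filter.atTop (nhds 0) := by
    have hb : Filter.Tendsto (fun r : ℝ => 64 * (C * 3 ^ (3 / 2 : ℝ) + |Real.log ‖f 0‖| + 1) *
        ‖z - w‖ * r ^ (-(1 / 2) : ℝ)) Filter.atTop (nhds 0) := by
      simpa using (tendsto_rpow_neg_atTop (by norm_num : (0 : ℝ) < 1 / 2)).const_mul _
    refine squeeze_zero' ?_ ?_ hb
    · filter_upwards [Filter.eventually_ge_atTop 1] with r hr
      positivity
    · filter_upwards [Filter.eventually_ge_atTop 1] with r hr
      have h3 : (1 + 2 * r) ^ (3 / 2 : ℝ) ≤ 3 ^ (3 / 2 : ℝ) * r ^ (3 / 2 : ℝ) := by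
        rw [← Real.mul_rpow (by norm_num) (by linarith)]
        exact Real.rpow_le_rpow (by linarith) (by linarith) (by norm_num)
      have h4 : (1 : ℝ) ≤ r ^ (3 / 2 : ℝ) := Real.one_le_rpow hr (by norm_num)
      have h6 : |Real.log ‖f 0‖| ≤ |Real.log ‖f 0‖| * r ^ (3 / 2 : ℝ) :=
        le_mul_of_one_le_right (by positivity) h4
      have e : r ^ (-(1 / 2) : ℝ) = r ^ (3 / 2 : ℝ) / r ^ 2 := by
        rw [← Real.rpow_natCast r 2, ← Real.rpow_sub (by linarith)]; norm_num
      have h8 := mul_le_mul_of_nonneg_left h3 hC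
      rw [e]
      have : 64 * (C * (1 + 2 * r) ^ (3 / 2 : ℝ) + |Real.log ‖f 0‖| + 1) ≤
        64 * (C * 3 ^ (3 / 2 : ℝ) + |Real.log ‖f 0‖| + 1) * r ^ (3 / 2 : ℝ) := by nlinarith
      calc _ ≤ 64 * (C * 3 ^ (3 / 2 : ℝ) + |Real.log ‖f 0‖| + 1) * r ^ (3 / 2 : ℝ) / r ^ 2 *
            ‖z - w‖ := by gcongr
        _ = _ := by ring
  rw [tendsto_iff_norm_sub_tendsto_zero]
  refine squeeze_zero' (Filter.Eventually.of_forall fun _ => norm_nonneg _) ?_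
    (hsmall.comp tendsto_natCast_atTop_atTop)
  obtain ⟨n0, hn0⟩ := exists_nat_gt (8 * ‖z‖ + 8 * ‖w‖)
  filter_upwards [Filter.eventually_ge_atTop n0] with n hn
  have hn' : (n0 : ℝ) ≤ n := by exact_mod_cast hn
  have hz := norm_nonneg z
  have hw := norm_nonneg w
  have := norm_logDeriv_sub_sum_le hf h0 hC hfC (r := n) (by linarith) (z := z) (w := w)
    (by linarith) (by linarith) hfz hfw
  rw [norm_sub_rev]
  simp only [Function.comp]
  rw [Finset.sum_subtype_of_mem (fun ρ => (analyticOrderNatAt f ρ : ℂ) *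
    (1 / (z - ρ) - 1 / (w - ρ)))]
  · exact this
  · intro ρ hρ
    simpa using ((finite_zerosIn hf h0 (n : ℝ)).mem_toFinset.1 hρ).1

/-! ### Growth of the zeta function -/

/-- The function `t ↦ {t}` on `(1, ∞)`, extended by zero. -/
noncomputable def fractTail (t : ℝ) : ℂ := Set.indicator (Set.Ioi 1) (fun t : ℝ => ((Int.fract t : ℝ) : ℂ)) t

lemma measurable_fractTail : Measurable fractTail :=
  (Complex.measurable_ofReal.comp measurable_fract).indicator measurableSet_Ioi

lemma norm_fractTail_le (t : ℝ) : ‖fractTail t‖ ≤ 1 := by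
  unfold fractTail
  by_cases h : t ∈ Set.Ioi (1 : ℝ)
  · rw [Set.indicator_of_mem h, Complex.norm_real, Real.norm_of_nonneg (Int.fract_nonneg t)]
    exact (Int.fract_lt_one t).le
  · rw [Set.indicator_of_notMem h]; simp

lemma mellin_fractTail (s : ℂ) : mellin fractTail (-s) =
    ∫ t in Set.Ioi (1 : ℝ), (t : ℂ) ^ (-s - 1) * ((Int.fract t : ℝ) : ℂ) := by
  unfold mellin fractTail
  have : ∀ t : ℝ, (t : ℂ) ^ (-s - 1) • (Set.Ioi (1 : ℝ)).indicator (fun t : ℝ => ((Int.fract t : ℝ) : ℂ)) t =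
      (Set.Ioi (1 : ℝ)).indicator (fun t : ℝ => (t : ℂ) ^ (-s - 1) * ((Int.fract t : ℝ) : ℂ)) t := by
    intro t
    by_cases h : t ∈ Set.Ioi (1 : ℝ)
    · simp [Set.indicator_of_mem h]
    · simp [Set.indicator_of_notMem h]
  simp only [this]
  rw [setIntegral_indicator measurableSet_Ioi, Set.Ioi_inter_Ioi]
  norm_num

lemma differentiableAt_mellin_fractTail {s : ℂ} (hs : 0 < s.re) :
    DifferentiableAt ℂ (fun s => mellin fractTail (-s)) s := by
  have h : DifferentiableAt ℂ (mellin fractTail) (-s) := by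
    refine mellin_differentiableAt_of_isBigO_rpow (a := 0) (b := (-s).re - 1) ?_ ?_ (by simpa) ?_
      (by linarith)
    · refine LocallyIntegrable.locallyIntegrableOn ?_ _
      refine (locallyIntegrable_const (1 : ℂ)).mono
        measurable_fractTail.aestronglyMeasurable ?_
      exact Filter.Eventually.of_forall fun t => by simpa using norm_fractTail_le t
    · refine Asymptotics.IsBigO.of_bound 1 (Filter.Eventually.of_forall fun t => ?_)
      simpa using norm_fractTail_le t
    · refine Asymptotics.IsBigO.of_bound 1 ?_
      filter_upwards [mem_nhdsWithin_of_mem_nhds (Iio_mem_nhds (by norm_num : (0 : ℝ) < 1))]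
        with t ht
      have : t ∉ Set.Ioi (1 : ℝ) := fun h => lt_asymm h (Set.mem_Iio.1 ht)
      simp only [fractTail, Set.indicator_of_notMem this, norm_zero]
      positivity
  exact h.comp s differentiable_neg.differentiableAt

lemma norm_mellin_fractTail_le {s : ℂ} (hs : 0 < s.re) : ‖mellin fractTail (-s)‖ ≤ 1 / s.re := by
  rw [mellin_fractTail]
  have h1 : ∫ t in Set.Ioi (1 : ℝ), t ^ (-s.re - 1) = 1 / s.re := by
    rw [integral_Ioi_rpow_of_lt (by linarith) (by norm_num)]
    simp
  rw [← h1]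
  refine norm_integral_le_of_norm_le (integrableOn_Ioi_rpow_of_lt (by linarith) (by norm_num)) ?_
  filter_upwards [ae_restrict_mem measurableSet_Ioi] with t ht
  have ht0 : 0 < t := lt_trans one_pos ht
  rw [norm_mul, Complex.norm_cpow_eq_rpow_re_of_pos ht0, Complex.norm_real,
    Real.norm_of_nonneg (Int.fract_nonneg t)]
  have : (-s - 1).re = -s.re - 1 := by simp
  rw [this]
  exact mul_le_of_le_one_right (by positivity) (Int.fract_lt_one t).le

lemma riemannZeta₁_eq_of_one_lt_re {s : ℂ} (hs : 1 < s.re) :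
    riemannZeta₁ s = s - s * (s - 1) * mellin fractTail (-s) := by
  have hs1 : s ≠ 1 := by rintro rfl; simp at hs
  have hs1' : s - 1 ≠ 0 := sub_ne_zero.2 hs1
  have hL := LSeries_eq_mul_integral' (fun _ => (1 : ℂ)) (r := 1) (by norm_num) hs (by
    refine Asymptotics.IsBigO.of_bound 1 (Filter.Eventually.of_forall fun n => ?_)
    simp)
  have hz : LSeries (fun _ => (1 : ℂ)) s = riemannZeta s := (LSeriesHasSum_one hs).LSeries_eq
  rw [hz] at hL
  have hInt1 : ∫ t in Set.Ioi (1 : ℝ), (t : ℂ) ^ (-s) = 1 / (s - 1) := by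
    rw [integral_Ioi_cpow_of_lt (by simpa using hs) (by norm_num)]
    simp only [Complex.ofReal_one, Complex.one_cpow]
    rw [neg_div, ← div_neg]; congr 1; ring
  have hi1 : IntegrableOn (fun t : ℝ => (t : ℂ) ^ (-s)) (Set.Ioi 1) :=
    integrableOn_Ioi_cpow_of_lt (by simpa using hs) (by norm_num)
  have hi2 : IntegrableOn (fun t : ℝ => (t : ℂ) ^ (-s - 1) * ((Int.fract t : ℝ) : ℂ)) (Set.Ioi 1) := by
    have h3 : IntegrableOn (fun t : ℝ => (t : ℂ) ^ (-s - 1)) (Set.Ioi 1) :=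
      integrableOn_Ioi_cpow_of_lt (by simp; linarith) (by norm_num)
    refine Integrable.mul_bdd (c := 1) h3 ?_ ?_
    · exact (Complex.measurable_ofReal.comp measurable_fract).aestronglyMeasurable
    · refine Filter.Eventually.of_forall fun t => ?_
      rw [Complex.norm_real, Real.norm_of_nonneg (Int.fract_nonneg t)]
      exact (Int.fract_lt_one t).le
  have hsplit : ∫ t in Set.Ioi (1 : ℝ), (∑ k ∈ Finset.Icc 1 ⌊t⌋₊, (1 : ℂ)) * t ^ (-(s + 1)) =
      1 / (s - 1) - mellin fractTail (-s) := by
    rw [mellin_fractTail, ← hInt1, ← integral_sub hi1 hi2]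
    refine setIntegral_congr_fun measurableSet_Ioi fun t ht => ?_
    have ht0 : 0 < t := lt_trans one_pos ht
    have h4 : ((⌊t⌋₊ : ℝ) : ℂ) = (t : ℂ) - (Int.fract t : ℝ) := by
      rw [← Complex.ofReal_sub, Int.self_sub_fract, natCast_floor_eq_intCast_floor ht0.le]
    have h5 : (t : ℂ) ^ (-s) = t ^ (-s - 1) * t := by
      rw [Complex.cpow_sub _ _ (by exact_mod_cast ht0.ne'), Complex.cpow_one]
      have : (t : ℂ) ≠ 0 := by exact_mod_cast ht0.ne'
      field_simp
    have h4' : ((⌊t⌋₊ : ℕ) : ℂ) = (t : ℂ) - (Int.fract t : ℝ) := by exact_mod_cast h4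
    simp only [Finset.sum_const, Nat.card_Icc, Nat.add_sub_cancel, nsmul_eq_mul, mul_one]
    rw [h4', h5, show -(s + 1) = -s - 1 by ring]
    ring
  rw [hsplit] at hL
  have h6 := riemannZeta_eq_inv_sub_mul hs1
  rw [hL] at h6
  field_simp at h6
  linear_combination -h6

lemma riemannZeta₁_eq {s : ℂ} (hs : 0 < s.re) :
    riemannZeta₁ s = s - s * (s - 1) * mellin fractTail (-s) := by
  have hU : IsOpen {s : ℂ | 0 < s.re} := isOpen_lt continuous_const Complex.continuous_re
  have h1 : AnalyticOnNhd ℂ riemannZeta₁ {s : ℂ | 0 < s.re} :=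
    fun z _ => differentiable_riemannZeta₁.analyticAt z
  have h2 : AnalyticOnNhd ℂ (fun s => s - s * (s - 1) * mellin fractTail (-s)) {s : ℂ | 0 < s.re} := by
    refine DifferentiableOn.analyticOnNhd (fun z hz => ?_) hU
    have := differentiableAt_mellin_fractTail hz
    exact (by fun_prop : DifferentiableAt ℂ (fun s => s - s * (s - 1) * mellin fractTail (-s)) z).differentiableWithinAt
  refine h1.eqOn_of_preconnected_of_eventuallyEq h2
    (convex_halfSpace_re_gt 0).isPreconnected (z₀ := 2) (by simp) ?_ hs
  have : {s : ℂ | 1 < s.re} ∈ nhds (2 : ℂ) :=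
    (isOpen_lt continuous_const Complex.continuous_re).mem_nhds (by simp)
  filter_upwards [this] with z hz using riemannZeta₁_eq_of_one_lt_re hz

lemma norm_riemannZeta₁_le {s : ℂ} (hs : 1 / 2 ≤ s.re) : ‖riemannZeta₁ s‖ ≤ 3 * (1 + ‖s‖) ^ 2 := by
  rw [riemannZeta₁_eq (by linarith)]
  have h1 := norm_mellin_fractTail_le (s := s) (by linarith)
  have h2 : 1 / s.re ≤ 2 := by rw [div_le_iff₀ (by linarith)]; linarith
  have h3 : ‖s - 1‖ ≤ ‖s‖ + 1 := by simpa using norm_sub_le s 1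
  calc _ ≤ ‖s‖ + ‖s‖ * ‖s - 1‖ * ‖mellin fractTail (-s)‖ := by
        refine (norm_sub_le _ _).trans ?_; simp
    _ ≤ ‖s‖ + ‖s‖ * (‖s‖ + 1) * 2 := by gcongr; exact h1.trans h2
    _ ≤ _ := by nlinarith [norm_nonneg s]

lemma norm_Gamma_le {z : ℂ} (hz : 1 / 2 ≤ z.re) (n : ℕ) (hn : z.re ≤ n) :
    ‖Complex.Gamma z‖ ≤ Real.Gamma (1 / 2) + n.factorial := by
  rw [Complex.Gamma_eq_integral (by linarith), Complex.GammaIntegral,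
    ← Real.Gamma_nat_eq_factorial, Real.Gamma_eq_integral (by norm_num),
    Real.Gamma_eq_integral (by positivity)]
  have hi1 := Real.GammaIntegral_convergent (s := 1 / 2) (by norm_num)
  have hi2 := Real.GammaIntegral_convergent (s := (n : ℝ) + 1) (by positivity)
  rw [← integral_add hi1 hi2]
  refine norm_integral_le_of_norm_le (hi1.add hi2) ?_
  filter_upwards [ae_restrict_mem measurableSet_Ioi] with t ht
  have ht0 : 0 < t := ht
  rw [norm_mul, Complex.norm_cpow_eq_rpow_re_of_pos ht0, Complex.norm_real,
    Real.norm_of_nonneg (Real.exp_pos _).le, ← mul_add]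
  refine mul_le_mul_of_nonneg_left ?_ (Real.exp_pos _).le
  rw [Complex.sub_re, Complex.one_re]
  rcases le_total t 1 with h | h
  · have := Real.rpow_le_rpow_of_exponent_ge ht0 h (by linarith : (1 / 2 : ℝ) - 1 ≤ z.re - 1)
    have : 0 ≤ t ^ ((n : ℝ) + 1 - 1) := by positivity
    linarith
  · have := Real.rpow_le_rpow_of_exponent_le h (by linarith : z.re - 1 ≤ (n : ℝ) + 1 - 1)
    have : 0 ≤ t ^ ((1 / 2 : ℝ) - 1) := by positivity
    linarith

lemma factorial_le_exp (n : ℕ) (x : ℝ) (hx : 1 ≤ x) (hn : (n : ℝ) ≤ x) :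
    (n.factorial : ℝ) ≤ Real.exp (2 * x ^ (3 / 2 : ℝ)) := by
  have h1 : (n.factorial : ℝ) ≤ (n : ℝ) ^ n := by exact_mod_cast Nat.factorial_le_pow n
  have h2 : (n : ℝ) ^ n ≤ x ^ x := by
    calc (n : ℝ) ^ n ≤ x ^ n := by gcongr
      _ = x ^ (n : ℝ) := (Real.rpow_natCast _ _).symm
      _ ≤ x ^ x := Real.rpow_le_rpow_of_exponent_le hx hn
  refine h1.trans (h2.trans ?_)
  rw [Real.rpow_def_of_pos (by linarith), Real.exp_le_exp]
  have h3 := Real.log_le_rpow_div (by linarith : 0 ≤ x) (by norm_num : (0 : ℝ) < 1 / 2)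
  have h4 : x ^ (3 / 2 : ℝ) = x ^ (1 / 2 : ℝ) * x := by
    rw [← Real.rpow_add_one (by linarith)]; norm_num
  rw [h4]; nlinarith

lemma norm_cos_le (z : ℂ) : ‖Complex.cos z‖ ≤ Real.exp ‖z‖ := by
  rw [Complex.cos, norm_div]
  have h1 : ‖Complex.exp (z * Complex.I)‖ ≤ Real.exp ‖z‖ := by
    refine (Complex.norm_exp_le_exp_norm _).trans (by simp)
  have h2 : ‖Complex.exp (-z * Complex.I)‖ ≤ Real.exp ‖z‖ := by
    refine (Complex.norm_exp_le_exp_norm _).trans (by simp)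
  have := (norm_add_le (Complex.exp (z * Complex.I)) (Complex.exp (-z * Complex.I)))
  rw [div_le_iff₀ (by simp)]
  simp only [Complex.norm_ofNat]; linarith

lemma riemannZeta₁_one_sub {z : ℂ} (hz0 : ∀ n : ℕ, z ≠ -n) (hz1 : z ≠ 1) :
    riemannZeta₁ (1 - z) = -z * (2 * (2 * π) ^ (-z) * Complex.Gamma z *
      Complex.cos (π * z / 2) * ((z - 1)⁻¹ * riemannZeta₁ z)) := by
  have hzne : z ≠ 0 := by simpa using hz0 0
  rw [← riemannZeta_eq_inv_sub_mul hz1, ← riemannZeta_one_sub hz0 hz1,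
    riemannZeta_eq_inv_sub_mul (by simpa using hzne)]
  have : (1 - z - 1) ≠ 0 := by simpa using hzne
  field_simp
  ring

lemma exists_orderBound_riemannZeta₁ : ∃ C : ℝ, 0 ≤ C ∧ OrderBound riemannZeta₁ C := by
  obtain ⟨K, hK⟩ := (isCompact_closedBall (0 : ℂ) 1).exists_bound_of_continuousOn
    differentiable_riemannZeta₁.continuous.continuousOn
  have hexp : ∀ y : ℝ, y ≤ Real.exp y := fun y => by linarith [Real.add_one_le_exp y]
  set G := Real.Gamma (1 / 2)
  have hG : 0 < G := Real.Gamma_pos_of_pos (by norm_num)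
  refine ⟨100 + |K| + G, by positivity, fun s => ?_⟩
  set X := 1 + ‖s‖ with hX
  have hX1 : 1 ≤ X := by linarith [norm_nonneg s]
  have hXX : X ≤ X ^ (3 / 2 : ℝ) := by
    conv_lhs => rw [← Real.rpow_one X]
    exact Real.rpow_le_rpow_of_exponent_le hX1 (by norm_num)
  have hKG : 0 ≤ (|K| + G) * X ^ (3 / 2 : ℝ) := by positivity
  by_cases hs : 1 / 2 ≤ s.re
  · refine (norm_riemannZeta₁_le hs).trans ?_
    have h1 : 3 * X ^ 2 ≤ Real.exp (3 + X + X) := by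
      rw [Real.exp_add, Real.exp_add, mul_assoc, pow_two]
      have h3 := hexp 3
      have h4 := hexp X
      gcongr
    refine h1.trans (Real.exp_le_exp.2 ?_)
    nlinarith
  by_cases hs1 : ‖s‖ ≤ 1
  · have := hK s (by simpa using hs1)
    have h2 : K ≤ |K| := le_abs_self K
    have h3 : |K| ≤ |K| * X ^ (3 / 2 : ℝ) := le_mul_of_one_le_right (abs_nonneg K) (by linarith)
    refine this.trans ((h2.trans (hexp _)).trans (Real.exp_le_exp.2 ?_))
    nlinarith
  push Not at hs hs1
  obtain ⟨z, rfl⟩ : ∃ z, s = 1 - z := ⟨1 - s, by ring⟩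
  have hzre : 1 / 2 ≤ z.re := by simp at hs; linarith
  have hz0 : ∀ n : ℕ, z ≠ -n := fun n h => by
    rw [h] at hzre; simp at hzre; linarith [(Nat.cast_nonneg n : (0:ℝ) ≤ n)]
  have hz1 : z ≠ 1 := by
    rintro rfl; norm_num at hs1
  have hn1 : 1 < ‖z - 1‖ := by rwa [norm_sub_rev]
  have hzX : ‖z‖ ≤ X := by
    have := norm_sub_le 1 (1 - z); simp at this; linarith
  rw [riemannZeta₁_one_sub hz0 hz1]
  simp only [norm_mul, norm_neg, norm_inv, Complex.norm_ofNat]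
  have b1 : ‖((2 : ℂ) * π) ^ (-z)‖ ≤ 1 := by
    have : ((2 : ℂ) * π) = ((2 * π : ℝ) : ℂ) := by push_cast; rfl
    rw [this, Complex.norm_cpow_eq_rpow_re_of_pos (by positivity)]
    refine Real.rpow_le_one_of_one_le_of_nonpos ?_ (by simp; linarith)
    linarith [Real.pi_gt_three]
  have hzre2 : z.re ≤ ‖z‖ := Complex.re_le_norm z
  obtain ⟨b2, hb2⟩ : ∃ n : ℕ, z.re ≤ n ∧ (n : ℝ) ≤ 2 * X := by
    refine ⟨⌈z.re⌉₊, Nat.le_ceil _, ?_⟩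
    have := Nat.ceil_lt_add_one (show 0 ≤ z.re by linarith)
    linarith
  have b2' := (norm_Gamma_le hzre b2 hb2.1).trans
    (add_le_add_right (factorial_le_exp b2 (2 * X) (by linarith) hb2.2) _)
  have b3 : ‖Complex.cos (π * z / 2)‖ ≤ Real.exp (2 * X) := by
    refine (norm_cos_le _).trans (Real.exp_le_exp.2 ?_)
    simp only [norm_div, norm_mul, Complex.norm_real, Complex.norm_ofNat, Real.norm_of_nonneg Real.pi_pos.le]
    nlinarith [Real.pi_lt_four, norm_nonneg z]
  have b4 := norm_riemannZeta₁_le hzre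
  have b5 : ‖z - 1‖⁻¹ ≤ 1 := inv_le_one_of_one_le₀ hn1.le
  have b6 : (2 * X) ^ (3 / 2 : ℝ) ≤ 4 * X ^ (3 / 2 : ℝ) := by
    rw [Real.mul_rpow (by norm_num) (by linarith)]
    gcongr
    calc (2 : ℝ) ^ (3 / 2 : ℝ) ≤ 2 ^ (2 : ℝ) :=
          Real.rpow_le_rpow_of_exponent_le (by norm_num) (by norm_num)
      _ = 4 := by norm_num
  have b7 : G + Real.exp (2 * (2 * X) ^ (3 / 2 : ℝ)) ≤
      Real.exp (G * X ^ (3 / 2 : ℝ) + 9 * X ^ (3 / 2 : ℝ)) := by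
    have h1 : Real.exp (2 * (2 * X) ^ (3 / 2 : ℝ)) ≤ Real.exp (9 * X ^ (3 / 2 : ℝ)) :=
      Real.exp_le_exp.2 (by linarith)
    have h2 : G + 1 ≤ Real.exp (G * X ^ (3 / 2 : ℝ)) := by
      refine (Real.add_one_le_exp G).trans (Real.exp_le_exp.2 ?_)
      exact le_mul_of_one_le_right hG.le (by linarith)
    have h3 : 1 ≤ Real.exp (9 * X ^ (3 / 2 : ℝ)) := Real.one_le_exp (by positivity)
    rw [Real.exp_add]
    nlinarith
  have b8 : 3 * (1 + ‖z‖) ^ 2 ≤ Real.exp (3 + 4 * X) := by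
    rw [Real.exp_add, show 4 * X = 2 * X + 2 * X by ring, Real.exp_add, pow_two]
    have h3 := hexp 3
    have h4 := hexp (2 * X)
    have : 1 + ‖z‖ ≤ Real.exp (2 * X) := by linarith
    gcongr
  have b9 : 2 * X ≤ Real.exp (2 * X) := hexp _
  calc _ ≤ X * (2 * 1 * Real.exp (G * X ^ (3 / 2 : ℝ) + 9 * X ^ (3 / 2 : ℝ)) * Real.exp (2 * X) *
        (1 * Real.exp (3 + 4 * X))) := by
        gcongr
        · exact b2'.trans b7
        · exact b4.trans b8
    _ = (2 * X) * (Real.exp (G * X ^ (3 / 2 : ℝ) + 9 * X ^ (3 / 2 : ℝ)) * Real.exp (2 * X) *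
        Real.exp (3 + 4 * X)) := by ring
    _ ≤ Real.exp (2 * X) * (Real.exp (G * X ^ (3 / 2 : ℝ) + 9 * X ^ (3 / 2 : ℝ)) *
        Real.exp (2 * X) * Real.exp (3 + 4 * X)) := by gcongr
    _ = Real.exp (2 * X + (G * X ^ (3 / 2 : ℝ) + 9 * X ^ (3 / 2 : ℝ) + 2 * X + (3 + 4 * X))) := by
        simp only [Real.exp_add]
    _ ≤ _ := by
        refine Real.exp_le_exp.2 ?_
        have : 0 ≤ |K| * X ^ (3 / 2 : ℝ) := by positivity
        nlinarith

/-! ### Zeros of the zeta function under the Riemann hypothesis -/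

lemma riemannZeta₁_eq_mul {s : ℂ} (hs : s ≠ 1) : riemannZeta₁ s = (s - 1) * riemannZeta s := by
  rw [riemannZeta_eq_inv_sub_mul hs, mul_inv_cancel_left₀ (sub_ne_zero.2 hs)]

lemma riemannZeta₁_eq_zero_iff {s : ℂ} : riemannZeta₁ s = 0 ↔ s ≠ 1 ∧ riemannZeta s = 0 := by
  by_cases hs : s = 1
  · simp [hs]
  · simp [riemannZeta₁_eq_mul hs, sub_eq_zero, hs]

lemma riemannZeta₁_zero_ne : riemannZeta₁ 0 ≠ 0 := by
  rw [Ne, riemannZeta₁_eq_zero_iff, riemannZeta_zero]; norm_num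

lemma riemannZeta₁_ne_zero_of_one_le_re {s : ℂ} (hs : 1 ≤ s.re) : riemannZeta₁ s ≠ 0 := fun h =>
  riemannZeta_ne_zero_of_one_le_re hs (riemannZeta₁_eq_zero_iff.1 h).2

/-- The trivial zeros. -/
noncomputable def trivialZero (k : ℕ) : ℂ := -2 * (k + 1)

lemma riemannZeta₁_trivialZero (k : ℕ) : riemannZeta₁ (trivialZero k) = 0 := by
  rw [riemannZeta₁_eq_zero_iff]
  refine ⟨fun h => ?_, riemannZeta_neg_two_mul_nat_add_one k⟩
  have := congrArg Complex.re h
  simp [trivialZero] at this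
  have hk : (0 : ℝ) ≤ k := Nat.cast_nonneg k
  linarith

lemma IsNontrivialZero.ne_one {ρ : ℂ} (h : IsNontrivialZero ρ) : ρ ≠ 1 := by
  rintro rfl; simpa using h.2.2

lemma IsNontrivialZero.riemannZeta₁ {ρ : ℂ} (h : IsNontrivialZero ρ) : riemannZeta₁ ρ = 0 :=
  riemannZeta₁_eq_zero_iff.2 ⟨h.ne_one, h.1⟩

lemma riemannZeta₁_zero_cases (hRH : RiemannHypothesis) {ρ : ℂ} (h : riemannZeta₁ ρ = 0) :
    (∃ k : ℕ, ρ = trivialZero k) ∨ ρ.re = 1 / 2 := by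
  rw [riemannZeta₁_eq_zero_iff] at h
  by_cases hk : ∃ k : ℕ, ρ = trivialZero k
  · exact Or.inl hk
  · exact Or.inr (hRH ρ h.2 hk h.1)

lemma IsNontrivialZero.re_eq (hRH : RiemannHypothesis) {ρ : ℂ} (h : IsNontrivialZero ρ) :
    ρ.re = 1 / 2 := by
  rcases riemannZeta₁_zero_cases hRH h.riemannZeta₁ with ⟨k, rfl⟩ | h'
  · have := h.2.1
    simp [trivialZero] at this
    have hk : (0 : ℝ) ≤ k := Nat.cast_nonneg k
    linarith
  · exact h'

lemma isNontrivialZero_of_re {ρ : ℂ} (h : riemannZeta₁ ρ = 0) (hre : ρ.re = 1 / 2) :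
    IsNontrivialZero ρ :=
  ⟨(riemannZeta₁_eq_zero_iff.1 h).2, by rw [hre]; norm_num, by rw [hre]; norm_num⟩

lemma riemannZeta₁_ne_zero (hRH : RiemannHypothesis) {s : ℂ} (h1 : -2 < s.re) (h2 : s.re ≠ 1 / 2) :
    riemannZeta₁ s ≠ 0 := fun h => by
  rcases riemannZeta₁_zero_cases hRH h with ⟨k, rfl⟩ | h'
  · simp [trivialZero] at h1
    have hk : (0 : ℝ) ≤ k := Nat.cast_nonneg k
    linarith
  · exact h2 h'

lemma analyticOrderAt_riemannZeta₁_ne_top (s : ℂ) : analyticOrderAt riemannZeta₁ s ≠ ⊤ := by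
  intro h
  have := (AnalyticOnNhd.analyticOrderAt_eq_top_iff_eq_zero (f := riemannZeta₁) s
    (fun x => differentiable_riemannZeta₁.analyticAt x)).1 h
  exact riemannZeta₁_zero_ne (by simp [this])

lemma zetaZeroOrder_eq {ρ : ℂ} (h : ρ ≠ 1) :
    zetaZeroOrder ρ = analyticOrderNatAt riemannZeta₁ ρ := by
  have hd : DifferentiableOn ℂ riemannZeta {1}ᶜ :=
    fun z hz => (differentiableAt_riemannZeta hz).differentiableWithinAt
  have hz : AnalyticAt ℂ riemannZeta ρ :=
    hd.analyticAt (isOpen_compl_singleton.mem_nhds h)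
  have hl : AnalyticAt ℂ (fun s : ℂ => s - 1) ρ := by fun_prop
  have e : riemannZeta₁ =ᶠ[nhds ρ] (fun s => s - 1) * riemannZeta := by
    filter_upwards [isOpen_ne.mem_nhds h] with s hs using riemannZeta₁_eq_mul hs
  have ho : analyticOrderAt riemannZeta₁ ρ = analyticOrderAt riemannZeta ρ := by
    rw [analyticOrderAt_congr e, analyticOrderAt_mul hl hz,
      hl.analyticOrderAt_eq_zero.2 (sub_ne_zero.2 h), zero_add]
  have htop := analyticOrderAt_riemannZeta₁_ne_top ρ
  rw [ho] at htop
  have hcast : analyticOrderAt riemannZeta ρ = (analyticOrderNatAt riemannZeta ρ : ℕ) :=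
    (Nat.cast_analyticOrderNatAt htop).symm
  have key := (analyticOrderAt_eq_nat_iff_iteratedDeriv_eq_zero hz).1 hcast
  have hn : analyticOrderNatAt riemannZeta₁ ρ = analyticOrderNatAt riemannZeta ρ := by
    simp [analyticOrderNatAt, ho]
  rw [hn, zetaZeroOrder]
  refine le_antisymm (Nat.sInf_le key.2) (le_csInf ⟨_, key.2⟩ fun k hk => ?_)
  by_contra hlt
  exact hk (key.1 k (not_le.1 hlt))

lemma analyticOrderNatAt_trivialZero (k : ℕ) :
    analyticOrderNatAt riemannZeta₁ (trivialZero k) = 1 := by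
  have h : analyticOrderAt riemannZeta₁ (trivialZero k) = 1 := by
    refine (differentiable_riemannZeta₁.analyticAt _).analyticOrderAt_eq_one_of_zero_deriv_ne_zero
      (riemannZeta₁_trivialZero k) ?_
    set z₀ : ℂ := 2 * k + 3 with hz₀
    have hk : (0 : ℝ) ≤ k := Nat.cast_nonneg k
    have hre : z₀.re = 2 * k + 3 := by simp [hz₀]
    have hU : ∀ z : ℂ, 1 < z.re → (∀ n : ℕ, z ≠ -n) ∧ z ≠ 1 := by
      refine fun z hz => ⟨fun n h => ?_, fun h => ?_⟩
      · rw [h] at hz; simp at hz; linarith [(Nat.cast_nonneg n : (0 : ℝ) ≤ n)]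
      · rw [h] at hz; simp at hz
    let A : ℂ → ℂ := fun z => -z * (2 * (2 * π) ^ (-z) * Complex.Gamma z) *
      ((z - 1)⁻¹ * riemannZeta₁ z)
    have hz₀U : 1 < z₀.re := by rw [hre]; linarith
    have h2pi : (2 * π : ℂ) ≠ 0 := by simp [Real.pi_ne_zero]
    have hA : DifferentiableAt ℂ A z₀ := by
      have h1 := Complex.differentiableAt_Gamma z₀ (hU z₀ hz₀U).1
      have h2 := differentiable_riemannZeta₁ z₀
      have h3 : DifferentiableAt ℂ (fun z : ℂ => (2 * π : ℂ) ^ (-z)) z₀ :=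
        differentiableAt_id.neg.const_cpow (Or.inl h2pi)
      have h4 : DifferentiableAt ℂ (fun z : ℂ => (z - 1)⁻¹) z₀ :=
        (by fun_prop : DifferentiableAt ℂ (fun z : ℂ => z - 1) z₀).inv
          (sub_ne_zero.2 (hU z₀ hz₀U).2)
      exact (differentiableAt_id.neg.mul ((h3.const_mul 2).mul h1)).mul (h4.mul h2)
    have hA0 : A z₀ ≠ 0 := by
      have h1 : z₀ ≠ 0 := fun h => by rw [h] at hz₀U; simp at hz₀U; linarith
      have h2 := Complex.Gamma_ne_zero (hU z₀ hz₀U).1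
      have h3 : (2 * π : ℂ) ^ (-z₀) ≠ 0 := by simp [Complex.cpow_eq_zero_iff, Real.pi_ne_zero]
      have h4 := sub_ne_zero.2 (hU z₀ hz₀U).2
      have h5 := riemannZeta₁_ne_zero_of_one_le_re hz₀U.le
      simp only [A]
      exact mul_ne_zero (mul_ne_zero (neg_ne_zero.2 h1)
        (mul_ne_zero (mul_ne_zero two_ne_zero h3) h2)) (mul_ne_zero (inv_ne_zero h4) h5)
    have hcos : Complex.cos (π * z₀ / 2) = 0 := by
      rw [Complex.cos_eq_zero_iff]
      exact ⟨k + 1, by rw [hz₀]; push_cast; ring⟩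
    have hsin : Complex.sin (π * z₀ / 2) ≠ 0 := fun h => by
      have := Complex.sin_sq_add_cos_sq (π * z₀ / 2)
      rw [h, hcos] at this; norm_num at this
    have hc : HasDerivAt (fun z : ℂ => Complex.cos (π * z / 2))
        (-Complex.sin (π * z₀ / 2) * (π / 2)) z₀ := by
      have h1 : HasDerivAt (fun z : ℂ => π * z / 2) (π / 2 : ℂ) z₀ := by
        simpa using ((hasDerivAt_id z₀).const_mul (π : ℂ)).div_const 2
      exact (Complex.hasDerivAt_cos _).comp z₀ h1
    have hprod := hA.hasDerivAt.mul hc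
    rw [hcos, mul_zero, zero_add] at hprod
    have e : (fun z => riemannZeta₁ (1 - z)) =ᶠ[nhds z₀]
        (A * fun z : ℂ => Complex.cos (π * z / 2)) := by
      have : {z : ℂ | 1 < z.re} ∈ nhds z₀ :=
        (isOpen_lt continuous_const Complex.continuous_re).mem_nhds hz₀U
      filter_upwards [this] with z hz
      rw [riemannZeta₁_one_sub (hU z hz).1 (hU z hz).2, Pi.mul_apply]
      simp only [A]; ring
    have h6 := hprod.congr_of_eventuallyEq e
    have h7 : trivialZero k = 1 - z₀ := by rw [trivialZero, hz₀]; ring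
    intro h0
    have h8 : HasDerivAt riemannZeta₁ 0 (1 - z₀) := by
      rw [← h7, ← h0]; exact (differentiable_riemannZeta₁ _).hasDerivAt
    have h9 := h8.comp z₀ ((hasDerivAt_id z₀).const_sub 1)
    have h10 := h6.unique h9
    rw [zero_mul] at h10
    exact mul_ne_zero hA0 (mul_ne_zero (neg_ne_zero.2 hsin) (by simp [Real.pi_ne_zero])) h10
  simp [analyticOrderNatAt, h]

/-- The zeros of `(s - 1) ζ(s)`, split into nontrivial and trivial ones. -/
noncomputable def zerosEquiv (hRH : RiemannHypothesis) :
    {ρ : ℂ // IsNontrivialZero ρ} ⊕ ℕ ≃ {ρ : ℂ // riemannZeta₁ ρ = 0} :=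
  Equiv.ofBijective (Sum.elim (fun ρ => ⟨ρ, ρ.2.riemannZeta₁⟩)
      fun k => ⟨trivialZero k, riemannZeta₁_trivialZero k⟩) <| by
    have htriv : ∀ k, ¬ IsNontrivialZero (trivialZero k) := fun k h => by
      have := h.2.1
      simp [trivialZero] at this
      have hk : (0 : ℝ) ≤ k := Nat.cast_nonneg k
      linarith
    constructor
    · rintro (a | a) (b | b) h <;> simp only [Sum.elim_inl, Sum.elim_inr, Subtype.mk.injEq] at h
      · rw [Subtype.ext h]
      · exact absurd (h ▸ a.2) (htriv b)
      · exact absurd (h ▸ b.2) (htriv a)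
      · simp only [trivialZero, mul_eq_mul_left_iff, add_left_inj, Nat.cast_inj] at h
        simpa using h
    · rintro ⟨ρ, hρ⟩
      rcases riemannZeta₁_zero_cases hRH hρ with ⟨k, rfl⟩ | h
      · exact ⟨Sum.inr k, rfl⟩
      · exact ⟨Sum.inl ⟨ρ, isNontrivialZero_of_re hρ h⟩, rfl⟩

lemma summable_split (hRH : RiemannHypothesis) {E : Type*} [NormedAddCommGroup E] [CompleteSpace E]
    {φ : ℂ → E} (h : Summable fun ρ : {ρ : ℂ // riemannZeta₁ ρ = 0} => φ ρ) :
    Summable (fun ρ : {ρ : ℂ // IsNontrivialZero ρ} => φ ρ) ∧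
    Summable (fun k => φ (trivialZero k)) ∧
    ∑' ρ : {ρ : ℂ // riemannZeta₁ ρ = 0}, φ ρ =
      ∑' ρ : {ρ : ℂ // IsNontrivialZero ρ}, φ ρ + ∑' k, φ (trivialZero k) := by
  have h1 := (zerosEquiv hRH).summable_iff.2 h
  have h2 : Summable (fun ρ : {ρ : ℂ // IsNontrivialZero ρ} => φ ρ) :=
    h1.comp_injective (i := Sum.inl) Sum.inl_injective
  have h3 : Summable (fun k => φ (trivialZero k)) :=
    h1.comp_injective (i := Sum.inr) Sum.inr_injective
  refine ⟨h2, h3, ?_⟩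
  rw [← (zerosEquiv hRH).tsum_eq]
  exact Summable.tsum_sum (f := fun x => φ (zerosEquiv hRH x)) h2 h3

lemma summable_nontrivial (hRH : RiemannHypothesis) :
    Summable fun ρ : {ρ : ℂ // IsNontrivialZero ρ} =>
      (zetaZeroOrder ρ : ℝ) / (1 + (ρ : ℂ).im ^ 2) := by
  obtain ⟨C, hC, hb⟩ := exists_orderBound_riemannZeta₁
  have h := (summable_split hRH (φ := fun ρ => (analyticOrderNatAt riemannZeta₁ ρ : ℝ) /
    (1 + ‖ρ‖ ^ 2)) (summable_zeros differentiable_riemannZeta₁ riemannZeta₁_zero_ne hC hb)).1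
  refine (h.mul_left 2).of_nonneg_of_le (fun ρ => by positivity) fun ρ => ?_
  rw [zetaZeroOrder_eq ρ.2.ne_one, mul_div_assoc', div_le_div_iff₀ (by positivity) (by positivity)]
  have h1 : ‖(ρ : ℂ)‖ ^ 2 = 1 / 4 + (ρ : ℂ).im ^ 2 := by
    rw [Complex.sq_norm, Complex.normSq_apply, ρ.2.re_eq hRH]; ring
  rw [h1]
  have : (0 : ℝ) ≤ analyticOrderNatAt riemannZeta₁ (ρ : ℂ) := by positivity
  nlinarith [mul_nonneg this (sq_nonneg (ρ : ℂ).im)]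

lemma summable_nontrivial_poisson (hRH : RiemannHypothesis) {V : ℝ} (hV : 0 < V) (t : ℝ) :
    Summable fun ρ : {ρ : ℂ // IsNontrivialZero ρ} =>
      (zetaZeroOrder ρ : ℝ) / (V ^ 2 + (t - (ρ : ℂ).im) ^ 2) := by
  refine ((summable_nontrivial hRH).mul_left ((1 + 2 * t ^ 2) / V ^ 2 + 2)).of_nonneg_of_le
    (fun ρ => by positivity) fun ρ => ?_
  rw [mul_div_assoc', div_le_div_iff₀ (by positivity) (by positivity)]
  set γ := (ρ : ℂ).im
  have h1 : 1 + γ ^ 2 ≤ ((1 + 2 * t ^ 2) / V ^ 2 + 2) * (V ^ 2 + (t - γ) ^ 2) := by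
    have e : ((1 + 2 * t ^ 2) / V ^ 2 + 2) * (V ^ 2 + (t - γ) ^ 2) =
      (1 + 2 * t ^ 2) + (1 + 2 * t ^ 2) / V ^ 2 * (t - γ) ^ 2 + 2 * V ^ 2 + 2 * (t - γ) ^ 2 := by
      field_simp; ring
    rw [e]
    have : 0 ≤ (1 + 2 * t ^ 2) / V ^ 2 * (t - γ) ^ 2 := by positivity
    nlinarith [sq_nonneg (γ - 2 * t), sq_nonneg V]
  have : (0 : ℝ) ≤ zetaZeroOrder (ρ : ℂ) := by positivity
  nlinarith [mul_le_mul_of_nonneg_left h1 this]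

lemma hasSum_logDeriv_riemannZeta₁ {z w : ℂ} (hz : riemannZeta₁ z ≠ 0) (hw : riemannZeta₁ w ≠ 0) :
    HasSum (fun ρ : {ρ : ℂ // riemannZeta₁ ρ = 0} => (analyticOrderNatAt riemannZeta₁ ρ : ℂ) *
      (1 / (z - ρ) - 1 / (w - ρ))) (logDeriv riemannZeta₁ z - logDeriv riemannZeta₁ w) := by
  obtain ⟨C, hC, hb⟩ := exists_orderBound_riemannZeta₁
  exact hasSum_logDeriv_sub differentiable_riemannZeta₁ riemannZeta₁_zero_ne hC hb hz hw

lemma logDeriv_riemannZeta₁_eq {z : ℂ} (hz : 1 < z.re) : logDeriv riemannZeta₁ z =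
    1 / (z - 1) - LSeries (fun n => (ArithmeticFunction.vonMangoldt n : ℂ)) z := by
  have hz1 : z ≠ 1 := by rintro rfl; simp at hz
  have h0 := riemannZeta_ne_zero_of_one_le_re hz.le
  rw [ArithmeticFunction.LSeries_vonMangoldt_eq_deriv_riemannZeta_div hz]
  have e : riemannZeta₁ =ᶠ[nhds z] fun s => (s - 1) * riemannZeta s := by
    filter_upwards [isOpen_ne.mem_nhds hz1] with s hs using riemannZeta₁_eq_mul hs
  rw [logDeriv_apply, e.deriv_eq, e.self_of_nhds, ← logDeriv_apply,
    logDeriv_mul (f := fun s : ℂ => s - 1) (g := riemannZeta) z (sub_ne_zero.2 hz1) h0 (by fun_prop)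
      (differentiableAt_riemannZeta hz1),
    logDeriv_apply, logDeriv_apply]
  simp
  ring

lemma exists_norm_LSeries_vonMangoldt_le : ∃ K : ℝ, 0 ≤ K ∧ ∀ z : ℂ, 3 / 2 ≤ z.re →
    ‖LSeries (fun n => (ArithmeticFunction.vonMangoldt n : ℂ)) z‖ ≤ K := by
  have hs : LSeriesSummable (fun n => (ArithmeticFunction.vonMangoldt n : ℂ)) (3 / 2 : ℂ) :=
    ArithmeticFunction.LSeriesSummable_vonMangoldt (by norm_num)
  refine ⟨∑' n, ‖LSeries.term (fun n => (ArithmeticFunction.vonMangoldt n : ℂ)) (3 / 2) n‖,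
    tsum_nonneg fun n => norm_nonneg _, fun z hz => ?_⟩
  · exact tsum_of_norm_bounded hs.norm.hasSum fun n => LSeries.norm_term_le_of_re_le_re _ (by norm_num; linarith) n

lemma exists_norm_logDeriv_riemannZeta₁_le : ∃ K : ℝ, 0 ≤ K ∧ ∀ z : ℂ, 3 / 2 ≤ z.re →
    ‖logDeriv riemannZeta₁ z‖ ≤ K := by
  obtain ⟨K, hK, h⟩ := exists_norm_LSeries_vonMangoldt_le
  refine ⟨2 + K, by positivity, fun z hz => ?_⟩
  rw [logDeriv_riemannZeta₁_eq (by linarith)]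
  refine (norm_sub_le _ _).trans (add_le_add ?_ (h z hz))
  rw [norm_div, norm_one, div_le_iff₀ (by
    have := (Complex.re_le_norm (z - 1)); simp at this; linarith)]
  have := (Complex.re_le_norm (z - 1)); simp at this; linarith

/-- The Poisson sum over nontrivial zeros. -/
noncomputable def poissonSum (V t : ℝ) : ℝ :=
  ∑' ρ : {ρ : ℂ // IsNontrivialZero ρ}, (zetaZeroOrder ρ : ℝ) / (V ^ 2 + (t - (ρ : ℂ).im) ^ 2)

lemma trivial_term_le {V t : ℝ} (hV : 1 ≤ V) (k : ℕ) :
    1 / (2 * (k : ℝ) + 4) - (V + 2 * k + 5 / 2) / ((V + 2 * k + 5 / 2) ^ 2 + t ^ 2) ≤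
      (1 + |t| + V) ^ (1 / 10 : ℝ) * (1 / ((k : ℝ) + 1) ^ (11 / 10 : ℝ)) := by
  set q := 1 + |t| + V with hq
  have hq0 : 0 < q := by positivity
  set a : ℝ := (k : ℝ) + 1 with ha
  have ha0 : 1 ≤ a := by simp [ha]
  have hk : (k : ℝ) = a - 1 := by simp [ha]
  have e : q ^ (1 / 10 : ℝ) * (1 / a ^ (11 / 10 : ℝ)) = (q / a) ^ (1 / 10 : ℝ) * (1 / a) := by
    rw [Real.div_rpow hq0.le (by positivity), show (11 / 10 : ℝ) = 1 / 10 + 1 by norm_num,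
      Real.rpow_add (by positivity), Real.rpow_one]
    field_simp
  rw [e, hk]
  have hx : 0 < V + 2 * (a - 1) + 5 / 2 := by linarith
  rcases le_total a q with h | h
  · have h1 : 1 ≤ (q / a) ^ (1 / 10 : ℝ) :=
      Real.one_le_rpow ((one_le_div (by positivity)).2 h) (by norm_num)
    have h2 : 1 / (2 * (a - 1) + 4) ≤ 1 / a :=
      one_div_le_one_div_of_le (by positivity) (by linarith)
    have h3 : 0 ≤ (V + 2 * (a - 1) + 5 / 2) / ((V + 2 * (a - 1) + 5 / 2) ^ 2 + t ^ 2) := by positivity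
    have h4 : 0 ≤ 1 / a := by positivity
    nlinarith
  · have h1 : q / a ≤ (q / a) ^ (1 / 10 : ℝ) := by
      have h5 : q / a ≤ 1 := (div_le_one (by positivity)).2 h
      have := Real.rpow_le_rpow_of_exponent_ge (by positivity) h5 (show (1 / 10 : ℝ) ≤ 1 by norm_num)
      rwa [Real.rpow_one] at this
    refine le_trans ?_ (mul_le_mul_of_nonneg_right h1 (by positivity))
    set x := V + 2 * (a - 1) + 5 / 2 with hxdef
    have hx2 : 2 * a ≤ x := by rw [hxdef]; linarith
    have h2 : 1 / x - t ^ 2 / x ^ 3 ≤ x / (x ^ 2 + t ^ 2) := by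
      have e2 : 1 / x - t ^ 2 / x ^ 3 = (x ^ 2 - t ^ 2) / x ^ 3 := by field_simp
      rw [e2, div_le_div_iff₀ (by positivity) (by positivity)]
      nlinarith [sq_nonneg (t ^ 2)]
    have h3 : 1 / (2 * (a - 1) + 4) - 1 / x ≤ V / (4 * a ^ 2) := by
      have e3 : 1 / (2 * (a - 1) + 4) - 1 / x = (V - 3 / 2) / ((2 * (a - 1) + 4) * x) := by
        rw [div_sub_div _ _ (by linarith) hx.ne']
        congr 1; rw [hxdef]; ring
      rw [e3, div_le_div_iff₀ (mul_pos (by linarith) hx) (by positivity)]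
      have : 4 * a ^ 2 ≤ (2 * (a - 1) + 4) * x := by nlinarith
      nlinarith [sq_nonneg a]
    have ht : |t| ≤ a := by linarith
    have h4 : t ^ 2 / x ^ 3 ≤ |t| / (8 * a ^ 2) := by
      rw [div_le_div_iff₀ (by positivity) (by positivity), ← sq_abs]
      have h6 : (2 * a) ^ 3 ≤ x ^ 3 := by gcongr
      have h7 : |t| ^ 2 * (8 * a ^ 2) ≤ |t| * (2 * a) ^ 3 := by
        have : |t| * |t| ≤ |t| * a := mul_le_mul_of_nonneg_left ht (abs_nonneg _)
        nlinarith [sq_nonneg a]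
      nlinarith [abs_nonneg t]
    have h5 : q / a * (1 / a) = (1 + |t| + V) / a ^ 2 := by rw [hq]; field_simp
    rw [h5]
    have h6 : V / (4 * a ^ 2) + |t| / (8 * a ^ 2) ≤ (1 + |t| + V) / a ^ 2 := by
      have : V / (4 * a ^ 2) + |t| / (8 * a ^ 2) = (V / 4 + |t| / 8) / a ^ 2 := by field_simp
      rw [this]
      refine div_le_div_of_nonneg_right ?_ (by positivity)
      linarith [abs_nonneg t]
    linarith

lemma one_div_re (x y : ℝ) : (1 / ((x : ℂ) + y * Complex.I)).re = x / (x ^ 2 + y ^ 2) := by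
  rw [one_div, Complex.inv_re]
  congr 1
  · simp
  · simp [Complex.normSq_apply]; ring

lemma exists_poissonSum_le (hRH : RiemannHypothesis) : ∃ C : ℝ, 0 < C ∧ ∀ V t : ℝ, 1 ≤ V →
    V * poissonSum V t ≤ C * (1 + |t| + V) ^ (1 / 10 : ℝ) := by
  obtain ⟨K, hK, hY⟩ := exists_norm_logDeriv_riemannZeta₁_le
  have hsk : Summable fun k : ℕ => 1 / ((k : ℝ) + 1) ^ (11 / 10 : ℝ) := by
    have := (summable_nat_add_iff 1).2 (Real.summable_one_div_nat_rpow.2 (show (1 : ℝ) < 11 / 10 by norm_num))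
    simpa using this
  set Ck := ∑' k : ℕ, 1 / ((k : ℝ) + 1) ^ (11 / 10 : ℝ) with hCk
  have hCk0 : 0 ≤ Ck := tsum_nonneg fun k => by positivity
  set S0 := 3 / 2 * poissonSum (3 / 2) 0 with hS0
  have hS00 : 0 ≤ S0 := mul_nonneg (by norm_num) (tsum_nonneg fun ρ => by positivity)
  refine ⟨S0 + 2 * K + Ck + 1, by positivity, fun V t hV => ?_⟩
  set z : ℂ := ((1 / 2 + V : ℝ) : ℂ) + t * Complex.I with hz
  have hzre : z.re = 1 / 2 + V := by simp [hz]
  have hsum := hasSum_logDeriv_riemannZeta₁ (z := z) (w := 2)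
    (riemannZeta₁_ne_zero_of_one_le_re (by rw [hzre]; linarith))
    (riemannZeta₁_ne_zero_of_one_le_re (by norm_num))
  have hre := Complex.hasSum_re hsum
  obtain ⟨h1, h2, h3⟩ := summable_split hRH (φ := fun ρ => ((analyticOrderNatAt riemannZeta₁ ρ : ℂ) *
      (1 / (z - ρ) - 1 / (2 - ρ))).re) hre.summable
  rw [hre.tsum_eq] at h3
  have eNT : ∀ ρ : {ρ : ℂ // IsNontrivialZero ρ},
      ((analyticOrderNatAt riemannZeta₁ (ρ : ℂ) : ℂ) * (1 / (z - ρ) - 1 / (2 - ρ))).re =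
      V * ((zetaZeroOrder ρ : ℝ) / (V ^ 2 + (t - (ρ : ℂ).im) ^ 2)) -
        3 / 2 * ((zetaZeroOrder ρ : ℝ) / ((3 / 2) ^ 2 + (0 - (ρ : ℂ).im) ^ 2)) := by
    intro ρ
    have hr := ρ.2.re_eq hRH
    have e1 : z - ρ = ((V : ℝ) : ℂ) + ((t - (ρ : ℂ).im : ℝ) : ℂ) * Complex.I := by
      apply Complex.ext <;> simp [hz, hr]
    have e2 : 2 - (ρ : ℂ) = ((3 / 2 : ℝ) : ℂ) + ((0 - (ρ : ℂ).im : ℝ) : ℂ) * Complex.I := by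
      apply Complex.ext <;> simp [hr]; norm_num
    rw [← zetaZeroOrder_eq ρ.2.ne_one, ← Complex.ofReal_natCast, Complex.re_ofReal_mul, Complex.sub_re,
      e1, e2, one_div_re, one_div_re]
    ring
  have eT : ∀ k : ℕ, ((analyticOrderNatAt riemannZeta₁ (trivialZero k) : ℂ) *
      (1 / (z - trivialZero k) - 1 / (2 - trivialZero k))).re =
      -(1 / (2 * (k : ℝ) + 4) - (V + 2 * k + 5 / 2) / ((V + 2 * k + 5 / 2) ^ 2 + t ^ 2)) := by
    intro k
    have e1 : z - trivialZero k = ((V + 2 * k + 5 / 2 : ℝ) : ℂ) + (t : ℂ) * Complex.I := by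
      apply Complex.ext <;> simp [hz, trivialZero]; ring
    have e2 : 2 - trivialZero k = ((2 * k + 4 : ℝ) : ℂ) + ((0 : ℝ) : ℂ) * Complex.I := by
      apply Complex.ext <;> simp [trivialZero]; ring
    rw [analyticOrderNatAt_trivialZero, Nat.cast_one, one_mul, Complex.sub_re,
      e1, e2, one_div_re, one_div_re]
    have : (2 * (k : ℝ) + 4) ≠ 0 := by positivity
    field_simp
    ring
  rw [tsum_congr eNT, tsum_congr eT, tsum_neg, Summable.tsum_sub
    ((summable_nontrivial_poisson hRH (by linarith) t).mul_left _)
    ((summable_nontrivial_poisson hRH (by norm_num) 0).mul_left _), tsum_mul_left, tsum_mul_left] at h3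
  have hT : (∑' k : ℕ, (1 / (2 * (k : ℝ) + 4) - (V + 2 * k + 5 / 2) / ((V + 2 * k + 5 / 2) ^ 2 + t ^ 2)))
      ≤ (1 + |t| + V) ^ (1 / 10 : ℝ) * Ck := by
    rw [hCk, ← tsum_mul_left]
    refine Summable.tsum_le_tsum (fun k => trivial_term_le hV k) ?_ (hsk.mul_left _)
    simpa using (h2.congr eT).neg
  have hb : (logDeriv riemannZeta₁ z - logDeriv riemannZeta₁ 2).re ≤ 2 * K := by
    refine (Complex.re_le_norm _).trans ((norm_sub_le _ _).trans ?_)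
    linarith [hY z (by rw [hzre]; linarith), hY 2 (by norm_num)]
  have hq : 1 ≤ (1 + |t| + V) ^ (1 / 10 : ℝ) :=
    Real.one_le_rpow (by linarith [abs_nonneg t]) (by norm_num)
  change V * poissonSum V t ≤ _
  change _ = V * poissonSum V t - S0 + _ at h3
  nlinarith

lemma integrableOn_laplace {f : ℝ → ℂ} {A c₀ : ℝ} (hf : ContinuousOn f (Set.Ioi 0))
    (hb : ∀ y, 0 < y → ‖f y‖ ≤ A * Real.exp (c₀ * y)) {w : ℂ} (hw : c₀ < w.re) :
    IntegrableOn (fun y : ℝ => Complex.exp (-w * y) * f y) (Set.Ioi 0) := by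
  have hc : ContinuousOn (fun y : ℝ => Complex.exp (-w * y) * f y) (Set.Ioi 0) := by
    refine ContinuousOn.mul (Continuous.continuousOn (by fun_prop)) hf
  refine Integrable.mono' ((integrableOn_exp_mul_Ioi (a := c₀ - w.re) (by linarith) 0).const_mul A)
    (hc.aestronglyMeasurable measurableSet_Ioi) ?_
  refine (ae_restrict_iff' measurableSet_Ioi).2 (Filter.Eventually.of_forall fun y hy => ?_)
  rw [norm_mul, Complex.norm_exp]
  calc Real.exp ((-w * y).re) * ‖f y‖ ≤ Real.exp ((-w * y).re) * (A * Real.exp (c₀ * y)) := by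
        gcongr; exact hb y hy
    _ = A * Real.exp ((c₀ - w.re) * y) := by
        rw [show (c₀ - w.re) * y = (-w * y).re + c₀ * y by simp; ring, Real.exp_add]; ring

lemma laplace_unique {f : ℝ → ℂ} {A c₀ c₁ : ℝ} (hc : c₀ < c₁) (hf : ContinuousOn f (Set.Ioi 0))
    (hb : ∀ y, 0 < y → ‖f y‖ ≤ A * Real.exp (c₀ * y))
    (h0 : ∀ w : ℂ, w.re = c₁ → ∫ y in Set.Ioi (0 : ℝ), Complex.exp (-w * y) * f y = 0)
    {y : ℝ} (hy : 0 < y) : f y = 0 := by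
  set G : ℝ → ℂ := Set.indicator (Set.Ioi 0) (fun y : ℝ => Complex.exp (-(c₁ : ℂ) * y) * f y) with hG
  have hGi : Integrable G := by
    rw [hG, integrable_indicator_iff measurableSet_Ioi]
    exact integrableOn_laplace hf hb (by simpa using hc)
  have hF : FourierTransform.fourier G = 0 := by
    ext ξ
    rw [Real.fourier_real_eq_integral_exp_smul, Pi.zero_apply,
      ← h0 ((c₁ : ℂ) + 2 * π * ξ * Complex.I) (by simp), ← integral_indicator measurableSet_Ioi]
    congr 1
    ext v
    by_cases hv : v ∈ Set.Ioi (0 : ℝ)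
    · simp only [hG, Set.indicator_of_mem hv, smul_eq_mul]
      rw [← mul_assoc, ← Complex.exp_add]
      congr 2
      push_cast; ring
    · simp [hG, Set.indicator_of_notMem hv]
  have hcont : ContinuousAt G y := by
    have hloc : G =ᶠ[nhds y] fun y : ℝ => Complex.exp (-(c₁ : ℂ) * y) * f y := by
      filter_upwards [isOpen_Ioi.mem_nhds hy] with v hv
      simp only [hG, Set.indicator_of_mem hv]
    refine ContinuousAt.congr ?_ hloc.symm
    exact ContinuousAt.mul (Continuous.continuousAt (by fun_prop))
      (hf.continuousAt (isOpen_Ioi.mem_nhds hy))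
  have hinv := hGi.fourierInv_fourier_eq (by rw [hF]; exact integrable_zero _ _ _) hcont
  rw [hF] at hinv
  have h1 : G y = 0 := by
    rw [← hinv]
    simp [Real.fourierInv_eq]
  simp only [hG, Set.indicator_of_mem (Set.mem_Ioi.2 hy)] at h1
  exact (mul_eq_zero.1 h1).resolve_left (Complex.exp_ne_zero _)

lemma laplace_series {ι : Type*} [Countable ι] {F : ι → ℝ → ℂ} {u : ι → ℝ} {c₀ : ℝ} (hc₀ : 0 ≤ c₀)
    (hu : Summable u) (hF : ∀ i, ContinuousOn (F i) (Set.Ioi 0))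
    (hb : ∀ i y, 0 < y → ‖F i y‖ ≤ u i * Real.exp (c₀ * y)) :
    ContinuousOn (fun y => ∑' i, F i y) (Set.Ioi 0) ∧
    (∀ y, 0 < y → ‖∑' i, F i y‖ ≤ (∑' i, u i) * Real.exp (c₀ * y)) ∧
    ∀ w : ℂ, c₀ < w.re → HasSum (fun i => ∫ y in Set.Ioi (0 : ℝ), Complex.exp (-w * y) * F i y)
      (∫ y in Set.Ioi (0 : ℝ), Complex.exp (-w * y) * ∑' i, F i y) := by
  have hu0 : ∀ i, 0 ≤ u i := fun i => by
    have := (norm_nonneg _).trans (hb i 1 one_pos)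
    exact nonneg_of_mul_nonneg_left this (Real.exp_pos _)
  refine ⟨fun y hy => ?_, fun y hy => ?_, fun w hw => ?_⟩
  · have h1 : ContinuousOn (fun y => ∑' i, F i y) (Set.Ioo 0 (y + 1)) := by
      refine continuousOn_tsum (u := fun i => u i * Real.exp (c₀ * (y + 1)))
        (fun i => (hF i).mono Set.Ioo_subset_Ioi_self) (hu.mul_right _) fun i v hv => ?_
      refine (hb i v hv.1).trans ?_
      have := hu0 i
      gcongr
      exact hv.2.le
    exact (h1.continuousAt (Ioo_mem_nhds hy (by linarith))).continuousWithinAt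
  · rw [← tsum_mul_right]
    exact tsum_of_norm_bounded (hu.mul_right _).hasSum fun i => hb i y hy
  · have := hasSum_integral_of_summable_integral_norm
      (μ := volume.restrict (Set.Ioi (0 : ℝ))) (F := fun i y => Complex.exp (-w * (y : ℂ)) * F i y)
      (fun i => integrableOn_laplace (hF i) (hb i) hw) ?_
    · simpa only [tsum_mul_left] using this
    · have hI := (integrableOn_exp_mul_Ioi (a := c₀ - w.re) (by linarith) 0)
      refine Summable.of_nonneg_of_le (fun i => integral_nonneg fun y => norm_nonneg _) (fun i => ?_)
        (hu.mul_right (∫ y in Set.Ioi (0 : ℝ), Real.exp ((c₀ - w.re) * y)))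
      rw [← integral_const_mul]
      refine setIntegral_mono_on (integrableOn_laplace (hF i) (hb i) hw).norm (hI.const_mul _)
        measurableSet_Ioi fun y hy => ?_
      rw [norm_mul, Complex.norm_exp]
      calc Real.exp ((-w * y).re) * ‖F i y‖ ≤ Real.exp ((-w * y).re) * (u i * Real.exp (c₀ * y)) := by
            gcongr; exact hb i y hy
        _ = u i * Real.exp ((c₀ - w.re) * y) := by
            rw [show (c₀ - w.re) * y = (-w * y).re + c₀ * y by simp; ring, Real.exp_add]; ring

/-- The kernel `(e^{y-l})^{s₂} - (e^{y-l})^{s₁}` for `y ≥ l`. -/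
noncomputable def diffKernel (s₁ s₂ : ℂ) (l y : ℝ) : ℂ :=
  if l ≤ y then Complex.exp (s₂ * (y - l : ℝ)) - Complex.exp (s₁ * (y - l : ℝ)) else 0

lemma continuous_diffKernel (s₁ s₂ : ℂ) (l : ℝ) : Continuous (diffKernel s₁ s₂ l) := by
  unfold diffKernel
  refine Continuous.if_le (by fun_prop) continuous_const continuous_const continuous_id ?_
  rintro y rfl
  simp

lemma norm_diffKernel_le {s₁ s₂ : ℂ} (h : s₂.re ≤ s₁.re) (l y : ℝ) :
    ‖diffKernel s₁ s₂ l y‖ ≤ 2 * Real.exp (s₁.re * (y - l)) := by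
  unfold diffKernel
  split_ifs with hl
  · refine (norm_sub_le _ _).trans ?_
    rw [Complex.norm_exp, Complex.norm_exp, Complex.re_mul_ofReal, Complex.re_mul_ofReal]
    have : Real.exp (s₂.re * (y - l)) ≤ Real.exp (s₁.re * (y - l)) := by
      apply Real.exp_le_exp.2
      exact mul_le_mul_of_nonneg_right h (by linarith)
    linarith
  · simp; positivity

lemma laplace_exp {s w : ℂ} (h : s.re < w.re) (l : ℝ) :
    ∫ y in Set.Ioi l, Complex.exp (-w * y) * Complex.exp (s * (y - l : ℝ)) =
      Complex.exp (-w * l) / (w - s) := by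
  have e : ∀ y : ℝ, Complex.exp (-w * y) * Complex.exp (s * (y - l : ℝ)) =
      Complex.exp (-s * l) * Complex.exp ((s - w) * y) := by
    intro y
    rw [← Complex.exp_add, ← Complex.exp_add]
    congr 1; push_cast; ring
  have hne : w - s ≠ 0 := fun h0 => by
    have := congrArg Complex.re h0; simp at this; linarith
  have hne' : s - w ≠ 0 := fun h0 => hne (by rw [← neg_sub, h0, neg_zero])
  simp_rw [e]
  rw [integral_const_mul, integral_exp_mul_complex_Ioi (by simpa using h), mul_div_assoc', mul_neg,
    ← Complex.exp_add, show -s * l + (s - w) * l = -w * (l : ℂ) by ring, div_eq_div_iff hne' hne]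
  ring

lemma laplace_exp_integrable {s w : ℂ} (h : s.re < w.re) (l : ℝ) :
    IntegrableOn (fun y : ℝ => Complex.exp (-w * y) * Complex.exp (s * (y - l : ℝ))) (Set.Ioi l) := by
  have e : ∀ y : ℝ, Complex.exp (-w * y) * Complex.exp (s * (y - l : ℝ)) =
      Complex.exp (-s * l) * Complex.exp ((s - w) * y) := by
    intro y
    rw [← Complex.exp_add, ← Complex.exp_add]
    congr 1; push_cast; ring
  simp_rw [e]
  exact (integrableOn_exp_mul_complex_Ioi (by simpa using h) l).const_mul _

lemma laplace_diffKernel {s₁ s₂ w : ℂ} (h1 : s₁.re < w.re) (h2 : s₂.re < w.re) {l : ℝ} (hl : 0 ≤ l) :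
    ∫ y in Set.Ioi (0 : ℝ), Complex.exp (-w * y) * diffKernel s₁ s₂ l y =
      Complex.exp (-w * l) * (1 / (w - s₂) - 1 / (w - s₁)) := by
  have e : ∫ y in Set.Ioi (0 : ℝ), Complex.exp (-w * y) * diffKernel s₁ s₂ l y =
      ∫ y in Set.Ioi l, Complex.exp (-w * y) * diffKernel s₁ s₂ l y := by
    refine setIntegral_eq_of_subset_of_forall_sdiff_eq_zero measurableSet_Ioi
      (Set.Ioi_subset_Ioi hl) fun y hy => ?_
    have hy2 : y ≤ l := not_lt.1 hy.2
    unfold diffKernel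
    split_ifs with h
    · simp [le_antisymm hy2 h]
    · simp
  rw [e]
  have e2 : ∫ y in Set.Ioi l, Complex.exp (-w * y) * diffKernel s₁ s₂ l y =
      ∫ y in Set.Ioi l, (Complex.exp (-w * y) * Complex.exp (s₂ * (y - l : ℝ)) -
        Complex.exp (-w * y) * Complex.exp (s₁ * (y - l : ℝ))) := by
    refine setIntegral_congr_fun measurableSet_Ioi fun y hy => ?_
    simp only [diffKernel, if_pos (le_of_lt (Set.mem_Ioi.1 hy)), mul_sub]
  rw [e2, integral_sub (laplace_exp_integrable h2 l) (laplace_exp_integrable h1 l), laplace_exp h2,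
    laplace_exp h1]
  ring

lemma countable_riemannZeta₁_zeros : Countable {ρ : ℂ // riemannZeta₁ ρ = 0} := by
  have hsub : {ρ : ℂ | riemannZeta₁ ρ = 0} ⊆ ⋃ n : ℕ, zerosIn riemannZeta₁ (n : ℝ) := by
    intro ρ hρ
    obtain ⟨n, hn⟩ := exists_nat_ge ‖ρ‖
    exact Set.mem_iUnion.2 ⟨n, hρ, hn⟩
  exact ((Set.countable_iUnion fun n : ℕ =>
    (finite_zerosIn differentiable_riemannZeta₁ riemannZeta₁_zero_ne (n : ℝ)).countable).mono hsub).to_subtype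

/-- The continuation of `∑ Λ(n) n^{-s}`. -/
noncomputable def vonMangoldtL (s : ℂ) : ℂ := 1 / (s - 1) - logDeriv riemannZeta₁ s

lemma vonMangoldtL_eq {s : ℂ} (hs : 1 < s.re) :
    vonMangoldtL s = LSeries (fun n => (ArithmeticFunction.vonMangoldt n : ℂ)) s := by
  rw [vonMangoldtL, logDeriv_riemannZeta₁_eq hs]; ring

lemma norm_exp_neg_mul_log {w : ℂ} {n : ℕ} (hn : n ≠ 0) : Complex.exp (-w * (Real.log n : ℝ)) =
    1 / (n : ℂ) ^ w := by
  rw [Complex.cpow_def_of_ne_zero (by exact_mod_cast hn), one_div, ← Complex.exp_neg,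
    Complex.ofReal_log (by positivity)]
  congr 1
  push_cast
  ring

lemma term_vonMangoldt_eq (w : ℂ) (n : ℕ) :
    LSeries.term (fun n => (ArithmeticFunction.vonMangoldt n : ℂ)) w n =
      (ArithmeticFunction.vonMangoldt n : ℂ) * Complex.exp (-w * (Real.log n : ℝ)) := by
  rcases eq_or_ne n 0 with rfl | hn
  · simp
  · rw [LSeries.term_of_ne_zero hn, norm_exp_neg_mul_log hn]; ring

theorem explicit_formula {s₁ s₂ : ℂ} (h1 : 1 < s₁.re) (h2 : s₂.re ≤ s₁.re) (h21 : s₂ ≠ 1)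
    (hz : riemannZeta₁ s₂ ≠ 0) {y : ℝ} (hy : 0 < y) :
    ∑' n : ℕ, (ArithmeticFunction.vonMangoldt n : ℂ) * diffKernel s₁ s₂ (Real.log n) y =
      vonMangoldtL s₂ * Complex.exp (s₂ * y) - vonMangoldtL s₁ * Complex.exp (s₁ * y) +
      (s₁ - s₂) / ((s₁ - 1) * (1 - s₂)) * Complex.exp y +
      ∑' ρ : {ρ : ℂ // riemannZeta₁ ρ = 0}, (analyticOrderNatAt riemannZeta₁ ρ : ℂ) *
        (1 / (s₂ - ρ) - 1 / (s₁ - ρ)) * Complex.exp (ρ * y) := by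
  have := countable_riemannZeta₁_zeros
  have hz1 : riemannZeta₁ s₁ ≠ 0 := riemannZeta₁_ne_zero_of_one_le_re h1.le
  have hc₀ : 0 ≤ s₁.re := by linarith
  set F : ℕ → ℝ → ℂ := fun n y =>
    (ArithmeticFunction.vonMangoldt n : ℂ) * diffKernel s₁ s₂ (Real.log n) y with hF
  set c : {ρ : ℂ // riemannZeta₁ ρ = 0} → ℂ := fun ρ => (analyticOrderNatAt riemannZeta₁ ρ : ℂ) *
        (1 / (s₂ - ρ) - 1 / (s₁ - ρ)) with hcdef
  set P : ℝ → ℂ := fun y => vonMangoldtL s₂ * Complex.exp (s₂ * y) -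
    vonMangoldtL s₁ * Complex.exp (s₁ * y) +
      (s₁ - s₂) / ((s₁ - 1) * (1 - s₂)) * Complex.exp y with hP
  have hcs : Summable fun ρ => ‖c ρ‖ := (hasSum_logDeriv_riemannZeta₁ hz hz1).summable.norm
  have hus : Summable fun n : ℕ =>
      2 * ‖LSeries.term (fun n => (ArithmeticFunction.vonMangoldt n : ℂ)) s₁ n‖ :=
    (ArithmeticFunction.LSeriesSummable_vonMangoldt h1).norm.mul_left 2
  obtain ⟨a1, a2, a3⟩ := laplace_series (F := F) hc₀ hus
    (fun n => (continuous_const.mul (continuous_diffKernel _ _ _)).continuousOn) (by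
      intro n y _
      rw [hF, norm_mul, term_vonMangoldt_eq, norm_mul, Complex.norm_exp]
      refine (mul_le_mul_of_nonneg_left (norm_diffKernel_le h2 _ _) (norm_nonneg _)).trans ?_
      rw [show s₁.re * (y - Real.log n) = (-s₁ * (Real.log n : ℝ)).re + s₁.re * y by
        rw [Complex.re_mul_ofReal]; simp; ring, Real.exp_add]
      exact le_of_eq (by ring))
  obtain ⟨b1, b2, b3⟩ := laplace_series (F := fun (ρ : {ρ : ℂ // riemannZeta₁ ρ = 0}) (y : ℝ) =>
      c ρ * Complex.exp ((ρ : ℂ) * y)) hc₀ hcs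
    (fun ρ => Continuous.continuousOn (by fun_prop)) (by
      intro ρ y hy
      rw [norm_mul, Complex.norm_exp, Complex.re_mul_ofReal]
      have : (ρ : ℂ).re ≤ s₁.re := by
        by_contra h
        exact riemannZeta₁_ne_zero_of_one_le_re (by linarith) ρ.2
      gcongr)
  have hPc : Continuous P := by fun_prop
  set B : ℝ := ‖vonMangoldtL s₂‖ + ‖vonMangoldtL s₁‖ + ‖(s₁ - s₂) / ((s₁ - 1) * (1 - s₂))‖ with hB
  have hPb : ∀ y, 0 < y → ‖P y‖ ≤ B * Real.exp (s₁.re * y) := by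
    intro y hy
    refine (norm_add_le _ _).trans ?_
    refine (add_le_add (norm_sub_le _ _) le_rfl).trans ?_
    rw [norm_mul, norm_mul, norm_mul, Complex.norm_exp, Complex.norm_exp, Complex.norm_exp,
      Complex.re_mul_ofReal, Complex.re_mul_ofReal, Complex.ofReal_re, hB, add_mul, add_mul]
    gcongr
    nlinarith
  have key := laplace_unique (f := fun y => (∑' n, F n y) - (P y +
      ∑' ρ : {ρ : ℂ // riemannZeta₁ ρ = 0}, c ρ * Complex.exp ((ρ : ℂ) * y)))
    (A := (∑' n : ℕ, 2 * ‖LSeries.term (fun n => (ArithmeticFunction.vonMangoldt n : ℂ)) s₁ n‖) +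
      (B + ∑' ρ, ‖c ρ‖)) (lt_add_one s₁.re) (a1.sub (hPc.continuousOn.add b1)) (by
      intro y hy
      refine (norm_sub_le _ _).trans ?_
      rw [add_mul, add_mul B]
      exact add_le_add (a2 y hy) ((norm_add_le _ _).trans (add_le_add (hPb y hy) (b2 y hy)))) (by
      intro w hw
      have hw1 : s₁.re < w.re := by linarith
      have hw2 : s₂.re < w.re := by linarith
      have ne1 : w - s₁ ≠ 0 := fun h0 => by
        have := congrArg Complex.re h0; simp at this; linarith
      have ne2 : w - s₂ ≠ 0 := fun h0 => by
        have := congrArg Complex.re h0; simp at this; linarith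
      have ne3 : w - 1 ≠ 0 := fun h0 => by
        have := congrArg Complex.re h0; simp at this; linarith
      have ne4 : s₁ - 1 ≠ 0 := fun h0 => by
        have := congrArg Complex.re h0; simp at this; linarith
      have ne5 : 1 - s₂ ≠ 0 := sub_ne_zero.2 (Ne.symm h21)
      have hzw : riemannZeta₁ w ≠ 0 := riemannZeta₁_ne_zero_of_one_le_re (by linarith)
      simp_rw [mul_sub, mul_add]
      have i1 := integrableOn_laplace a1 a2 hw1
      have i2 := integrableOn_laplace hPc.continuousOn hPb hw1
      have i3 := integrableOn_laplace b1 b2 hw1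
      rw [integral_sub (g := fun y : ℝ => Complex.exp (-w * y) * P y + Complex.exp (-w * y) *
          ∑' ρ : {ρ : ℂ // riemannZeta₁ ρ = 0}, c ρ * Complex.exp ((ρ : ℂ) * y)) i1 (i2.add i3),
        integral_add i2 i3]
      have e1 : ∫ y in Set.Ioi (0 : ℝ), Complex.exp (-w * y) * ∑' n, F n y =
          vonMangoldtL w * (1 / (w - s₂) - 1 / (w - s₁)) := by
        refine (a3 w hw1).unique ?_
        rw [vonMangoldtL_eq (by linarith)]
        have := ((ArithmeticFunction.LSeriesSummable_vonMangoldt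
          (show 1 < w.re by linarith)).hasSum).mul_right (1 / (w - s₂) - 1 / (w - s₁))
        refine this.congr_fun ?_
        intro n
        rw [term_vonMangoldt_eq, mul_assoc, ← laplace_diffKernel hw1 hw2 (Real.log_natCast_nonneg n),
          ← integral_const_mul]
        congr 1
        ext y
        simp only [hF]
        ring
      have e2 : ∫ y in Set.Ioi (0 : ℝ), Complex.exp (-w * y) * P y = vonMangoldtL s₂ / (w - s₂) -
          vonMangoldtL s₁ / (w - s₁) + (s₁ - s₂) / ((s₁ - 1) * (1 - s₂)) / (w - 1) := by
        have j1 := (laplace_exp_integrable hw1 0).const_mul (vonMangoldtL s₁)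
        have j2 := (laplace_exp_integrable hw2 0).const_mul (vonMangoldtL s₂)
        have j3 := (laplace_exp_integrable (s := 1) (w := w) (by simp; linarith) 0).const_mul
          ((s₁ - s₂) / ((s₁ - 1) * (1 - s₂)))
        have k3 := laplace_exp (s := 1) (w := w) (by simp; linarith) 0
        have k1 := laplace_exp hw1 0
        have k2 := laplace_exp hw2 0
        have : ∀ y : ℝ, Complex.exp (-w * y) * P y =
          vonMangoldtL s₂ * (Complex.exp (-w * y) * Complex.exp (s₂ * (y - 0 : ℝ))) -
          vonMangoldtL s₁ * (Complex.exp (-w * y) * Complex.exp (s₁ * (y - 0 : ℝ))) +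
          (s₁ - s₂) / ((s₁ - 1) * (1 - s₂)) *
            (Complex.exp (-w * y) * Complex.exp (1 * (y - 0 : ℝ))) := by
          intro y
          simp only [hP, sub_zero, one_mul]; ring
        simp_rw [this]
        rw [integral_add (f := fun y : ℝ =>
          vonMangoldtL s₂ * (Complex.exp (-w * y) * Complex.exp (s₂ * (y - 0 : ℝ))) -
          vonMangoldtL s₁ * (Complex.exp (-w * y) * Complex.exp (s₁ * (y - 0 : ℝ)))) (j2.sub j1) j3,
          integral_sub j2 j1, integral_const_mul, integral_const_mul,
          integral_const_mul, k1, k2, k3]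
        simp only [Complex.ofReal_zero, mul_zero, Complex.exp_zero]
        ring
      have e3 : ∫ y in Set.Ioi (0 : ℝ), Complex.exp (-w * y) *
          ∑' ρ : {ρ : ℂ // riemannZeta₁ ρ = 0}, c ρ * Complex.exp ((ρ : ℂ) * y) =
          (logDeriv riemannZeta₁ s₂ - logDeriv riemannZeta₁ w) / (w - s₂) -
          (logDeriv riemannZeta₁ s₁ - logDeriv riemannZeta₁ w) / (w - s₁) := by
        refine (b3 w hw1).unique ?_
        have := ((hasSum_logDeriv_riemannZeta₁ hz hzw).div_const (w - s₂)).sub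
          ((hasSum_logDeriv_riemannZeta₁ hz1 hzw).div_const (w - s₁))
        refine this.congr_fun ?_
        intro ρ
        have hρ : (ρ : ℂ).re < w.re := by
          by_contra h
          exact riemannZeta₁_ne_zero_of_one_le_re (by linarith) ρ.2
        have k := laplace_exp hρ 0
        have : ∀ y : ℝ, Complex.exp (-w * y) * (c ρ * Complex.exp (ρ * y)) =
            c ρ * (Complex.exp (-w * y) * Complex.exp (ρ * (y - 0 : ℝ))) := by
          intro y
          rw [sub_zero]; ring
        simp_rw [this]
        rw [integral_const_mul, k, hcdef]
        have n1 : w - ρ ≠ 0 := sub_ne_zero.2 fun h => hzw (h ▸ ρ.2)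
        have n2 : s₁ - ρ ≠ 0 := sub_ne_zero.2 fun h => hz1 (h ▸ ρ.2)
        have n3 : s₂ - ρ ≠ 0 := sub_ne_zero.2 fun h => hz (h ▸ ρ.2)
        simp only [Complex.ofReal_zero, mul_zero, Complex.exp_zero]
        field_simp
        ring
      rw [e1, e2, e3, vonMangoldtL, vonMangoldtL, vonMangoldtL]
      have ne6 : s₂ - 1 ≠ 0 := fun h => ne5 (by rw [← neg_sub, h, neg_zero])
      have : (1 - s₂) = -(s₂ - 1) := by ring
      rw [this]
      field_simp
      ring) hy
  exact sub_eq_zero.1 key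

/-! ### The explicit formula with a two-sided exponential kernel -/

/-- The kernel `(e^{y-l})^{s₂}` for `l ≤ y` and `(e^{y-l})^{s₁}` for `y < l`. -/
noncomputable def twoKernel (s₁ s₂ : ℂ) (l y : ℝ) : ℂ :=
  if l ≤ y then Complex.exp (s₂ * (y - l : ℝ)) else Complex.exp (s₁ * (y - l : ℝ))

lemma twoKernel_eq (s₁ s₂ : ℂ) (l y : ℝ) :
    twoKernel s₁ s₂ l y = diffKernel s₁ s₂ l y + Complex.exp (s₁ * y) * Complex.exp (-s₁ * l) := by
  rw [← Complex.exp_add, show s₁ * y + -s₁ * l = s₁ * ((y - l : ℝ) : ℂ) by push_cast; ring]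
  unfold twoKernel diffKernel
  split_ifs <;> ring

lemma norm_twoKernel_le {s₁ s₂ : ℂ} (h2 : s₂.re ≤ s₁.re) (l y : ℝ) :
    ‖twoKernel s₁ s₂ l y‖ ≤ Real.exp (s₁.re * y) * Real.exp (-s₁.re * l) := by
  rw [← Real.exp_add, show s₁.re * y + -s₁.re * l = s₁.re * (y - l) by ring]
  unfold twoKernel
  split_ifs with h
  · rw [Complex.norm_exp, Complex.re_mul_ofReal]
    exact Real.exp_le_exp.2 (mul_le_mul_of_nonneg_right h2 (by linarith))
  · rw [Complex.norm_exp, Complex.re_mul_ofReal]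

lemma summable_vonMangoldt_exp {s : ℂ} (h : 1 < s.re) :
    Summable fun n : ℕ => (ArithmeticFunction.vonMangoldt n : ℂ) *
      Complex.exp (-s * (Real.log n : ℝ)) := by
  have := ArithmeticFunction.LSeriesSummable_vonMangoldt h
  exact this.congr fun n => term_vonMangoldt_eq s n

lemma summable_vonMangoldt_twoKernel {s₁ s₂ : ℂ} (h1 : 1 < s₁.re) (h2 : s₂.re ≤ s₁.re) (y : ℝ) :
    Summable fun n : ℕ => (ArithmeticFunction.vonMangoldt n : ℂ) *
      twoKernel s₁ s₂ (Real.log n) y := by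
  refine Summable.of_norm_bounded ((summable_vonMangoldt_exp h1).norm.mul_left (Real.exp (s₁.re * y)))
    fun n => ?_
  rw [norm_mul, norm_mul, Complex.norm_exp, Complex.re_mul_ofReal, Complex.neg_re]
  refine (mul_le_mul_of_nonneg_left (norm_twoKernel_le h2 _ _) (norm_nonneg _)).trans (le_of_eq ?_)
  ring

theorem explicit_formula_twoKernel {s₁ s₂ : ℂ} (h1 : 1 < s₁.re) (h2 : s₂.re ≤ s₁.re) (h21 : s₂ ≠ 1)
    (hz : riemannZeta₁ s₂ ≠ 0) {y : ℝ} (hy : 0 < y) :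
    ∑' n : ℕ, (ArithmeticFunction.vonMangoldt n : ℂ) * twoKernel s₁ s₂ (Real.log n) y =
      vonMangoldtL s₂ * Complex.exp (s₂ * y) +
      (s₁ - s₂) / ((s₁ - 1) * (1 - s₂)) * Complex.exp y +
      ∑' ρ : {ρ : ℂ // riemannZeta₁ ρ = 0}, (analyticOrderNatAt riemannZeta₁ ρ : ℂ) *
        (1 / (s₂ - ρ) - 1 / (s₁ - ρ)) * Complex.exp (ρ * y) := by
  have e : ∀ n : ℕ, (ArithmeticFunction.vonMangoldt n : ℂ) * twoKernel s₁ s₂ (Real.log n) y =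
      (ArithmeticFunction.vonMangoldt n : ℂ) * diffKernel s₁ s₂ (Real.log n) y +
      Complex.exp (s₁ * y) * ((ArithmeticFunction.vonMangoldt n : ℂ) *
      Complex.exp (-s₁ * (Real.log n : ℝ))) := fun n => by rw [twoKernel_eq]; ring
  have hs1 := (summable_vonMangoldt_exp h1).mul_left (Complex.exp (s₁ * y))
  have hs2 : Summable fun n : ℕ => (ArithmeticFunction.vonMangoldt n : ℂ) *
      diffKernel s₁ s₂ (Real.log n) y := by
    refine ((summable_vonMangoldt_twoKernel h1 h2 y).sub hs1).congr fun n => ?_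
    rw [e]; ring
  have hL : vonMangoldtL s₁ = ∑' n : ℕ, (ArithmeticFunction.vonMangoldt n : ℂ) *
      Complex.exp (-s₁ * (Real.log n : ℝ)) := by
    rw [vonMangoldtL_eq h1]
    exact tsum_congr fun n => term_vonMangoldt_eq s₁ n
  rw [tsum_congr e, hs2.tsum_add hs1, tsum_mul_left, ← hL, explicit_formula h1 h2 h21 hz hy]
  ring

lemma norm_trivial_coeff_le {s₁ s₂ : ℂ} (h1 : 3 / 2 ≤ s₁.re) (h2 : -(3 / 2) ≤ s₂.re)
    (h12 : ‖s₁ - s₂‖ ≤ 5) (k : ℕ) :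
    ‖1 / (s₂ - trivialZero k) - 1 / (s₁ - trivialZero k)‖ ≤ 10 * (1 / ((k : ℝ) + 1) ^ 2) := by
  have a1 : 2 * (k : ℝ) + 2 ≤ ‖s₁ - trivialZero k‖ := by
    refine le_trans ?_ (Complex.re_le_norm _)
    simp [trivialZero]; linarith
  have a2 : ((k : ℝ) + 1) / 2 ≤ ‖s₂ - trivialZero k‖ := by
    refine le_trans ?_ (Complex.re_le_norm _)
    simp [trivialZero]
    have : (0 : ℝ) ≤ k := by positivity
    linarith
  have n1 : s₁ - trivialZero k ≠ 0 := norm_pos_iff.1 (lt_of_lt_of_le (by positivity) a1)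
  have n2 : s₂ - trivialZero k ≠ 0 := norm_pos_iff.1 (lt_of_lt_of_le (by positivity) a2)
  rw [div_sub_div _ _ n2 n1, norm_div, norm_mul,
    show 1 * (s₁ - trivialZero k) - (s₂ - trivialZero k) * 1 = s₁ - s₂ by ring]
  rw [mul_one_div, div_le_div_iff₀ (by positivity) (by positivity)]
  have : ((k : ℝ) + 1) / 2 * (2 * k + 2) ≤ ‖s₂ - trivialZero k‖ * ‖s₁ - trivialZero k‖ := by gcongr
  nlinarith [sq_nonneg ((k : ℝ) + 1)]

lemma exists_explicit_formula_bound (hRH : RiemannHypothesis) : ∃ C : ℝ, 0 < C ∧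
    ∀ s₁ s₂ : ℂ, 3 / 2 ≤ s₁.re → -(3 / 2) ≤ s₂.re → s₂.re ≤ -(1 / 2) → ‖s₁ - s₂‖ ≤ 5 →
    ∀ y : ℝ, 0 < y → (Summable fun ρ : {ρ : ℂ // IsNontrivialZero ρ} =>
        (zetaZeroOrder ρ : ℂ) * (1 / (s₂ - ρ) - 1 / (s₁ - ρ))) ∧
      ‖(∑' n : ℕ, (ArithmeticFunction.vonMangoldt n : ℂ) * twoKernel s₁ s₂ (Real.log n) y) -
        (s₁ - s₂) / ((s₁ - 1) * (1 - s₂)) * Complex.exp y -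
        ∑' ρ : {ρ : ℂ // IsNontrivialZero ρ}, (zetaZeroOrder ρ : ℂ) *
          (1 / (s₂ - ρ) - 1 / (s₁ - ρ)) * Complex.exp (ρ * y)‖ ≤
      C * (1 + ∑' ρ : {ρ : ℂ // IsNontrivialZero ρ}, (zetaZeroOrder ρ : ℝ) *
          ‖1 / (s₂ - (ρ : ℂ)) - 1 / (s₁ - ρ)‖) * Real.exp (s₂.re * y) := by
  obtain ⟨K, hK, hY⟩ := exists_norm_logDeriv_riemannZeta₁_le
  have hsk : Summable fun k : ℕ => 10 * (1 / ((k : ℝ) + 1) ^ 2) := by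
    have := (summable_nat_add_iff 1).2 (Real.summable_one_div_nat_pow.2 (show 1 < 2 by norm_num))
    simpa using this.mul_left (10 : ℝ)
  set A := ∑' k : ℕ, 10 * (1 / ((k : ℝ) + 1) ^ 2) with hA
  have hA0 : 0 ≤ A := tsum_nonneg fun k => by positivity
  refine ⟨1 + K + 2 * A + 1, by positivity, fun s₁ s₂ h1 h2 h2' h12 y hy => ?_⟩
  have hz1 : riemannZeta₁ s₁ ≠ 0 := riemannZeta₁_ne_zero_of_one_le_re (by linarith)
  have hz2 : riemannZeta₁ s₂ ≠ 0 := riemannZeta₁_ne_zero hRH (by linarith) (by linarith)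
  have h21 : s₂ ≠ 1 := by rintro rfl; norm_num at h2'
  have hsum := hasSum_logDeriv_riemannZeta₁ hz2 hz1
  obtain ⟨p1, p2, p3⟩ := summable_split hRH (φ := fun ρ => (analyticOrderNatAt riemannZeta₁ ρ : ℂ) *
    (1 / (s₂ - ρ) - 1 / (s₁ - ρ))) hsum.summable
  have p1' : Summable fun ρ : {ρ : ℂ // IsNontrivialZero ρ} =>
        (zetaZeroOrder ρ : ℂ) * (1 / (s₂ - ρ) - 1 / (s₁ - ρ)) :=
    p1.congr fun ρ => by rw [zetaZeroOrder_eq ρ.2.ne_one]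
  refine ⟨p1', ?_⟩
  set S := ∑' ρ : {ρ : ℂ // IsNontrivialZero ρ}, (zetaZeroOrder ρ : ℝ) *
          ‖1 / (s₂ - (ρ : ℂ)) - 1 / (s₁ - ρ)‖ with hS
  have hS0 : 0 ≤ S := tsum_nonneg fun ρ => by positivity
  have hn1 : Summable fun ρ : {ρ : ℂ // IsNontrivialZero ρ} => (zetaZeroOrder ρ : ℝ) *
          ‖1 / (s₂ - (ρ : ℂ)) - 1 / (s₁ - ρ)‖ :=
    p1'.norm.congr fun ρ => by rw [norm_mul, Complex.norm_natCast]
  rw [hsum.tsum_eq] at p3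
  have hY2 : ‖logDeriv riemannZeta₁ s₂‖ ≤ K + S + A := by
    have e : logDeriv riemannZeta₁ s₂ = logDeriv riemannZeta₁ s₁ + (_ + _) :=
      (sub_eq_iff_eq_add'.1 p3)
    rw [e]
    refine (norm_add_le _ _).trans ?_
    rw [add_assoc]
    refine add_le_add (hY s₁ h1) ((norm_add_le _ _).trans (add_le_add ?_ ?_))
    · refine tsum_of_norm_bounded hn1.hasSum fun ρ => ?_
      rw [norm_mul, Complex.norm_natCast, zetaZeroOrder_eq ρ.2.ne_one]
    · refine tsum_of_norm_bounded hsk.hasSum fun k => ?_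
      rw [analyticOrderNatAt_trivialZero, Nat.cast_one, one_mul]
      exact norm_trivial_coeff_le h1 h2 h12 k
  have hL2 : ‖vonMangoldtL s₂‖ ≤ 1 + (K + S + A) := by
    refine (norm_sub_le _ _).trans (add_le_add ?_ hY2)
    have : 1 ≤ ‖s₂ - 1‖ := by
      refine le_trans ?_ (Complex.abs_re_le_norm _)
      rw [Complex.sub_re, Complex.one_re, abs_of_neg (by linarith)]; linarith
    rw [norm_div, norm_one]
    exact (div_le_one (by linarith)).2 this
  have hsum2 : Summable fun ρ : {ρ : ℂ // riemannZeta₁ ρ = 0} =>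
      (analyticOrderNatAt riemannZeta₁ ρ : ℂ) *
        (1 / (s₂ - ρ) - 1 / (s₁ - ρ)) * Complex.exp (ρ * y) := by
    refine Summable.of_norm_bounded (hsum.summable.norm.mul_right (Real.exp y)) fun ρ => ?_
    rw [norm_mul, Complex.norm_exp, Complex.re_mul_ofReal]
    gcongr
    have : (ρ : ℂ).re ≤ 1 := by
      by_contra h
      exact riemannZeta₁_ne_zero_of_one_le_re (by linarith) ρ.2
    nlinarith
  obtain ⟨q1, q2, q3⟩ := summable_split hRH (φ := fun ρ => (analyticOrderNatAt riemannZeta₁ ρ : ℂ) *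
    (1 / (s₂ - ρ) - 1 / (s₁ - ρ)) * Complex.exp (ρ * y)) hsum2
  rw [explicit_formula_twoKernel (by linarith) (by linarith) h21 hz2 hy, q3]
  have e1 : (∑' ρ : {ρ : ℂ // IsNontrivialZero ρ}, (zetaZeroOrder ρ : ℂ) *
          (1 / (s₂ - ρ) - 1 / (s₁ - ρ)) * Complex.exp (ρ * y)) =
      ∑' ρ : {ρ : ℂ // IsNontrivialZero ρ}, (analyticOrderNatAt riemannZeta₁ ρ : ℂ) *
          (1 / (s₂ - ρ) - 1 / (s₁ - ρ)) * Complex.exp (ρ * y) :=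
    tsum_congr fun ρ => by rw [zetaZeroOrder_eq ρ.2.ne_one]
  rw [e1]
  set W := ∑' k : ℕ, (analyticOrderNatAt riemannZeta₁ (trivialZero k) : ℂ) *
          (1 / (s₂ - trivialZero k) - 1 / (s₁ - trivialZero k)) * Complex.exp (trivialZero k * y) with hW
  have hWb : ‖W‖ ≤ A * Real.exp (s₂.re * y) := by
    rw [hA, ← tsum_mul_right]
    refine tsum_of_norm_bounded (hsk.mul_right _).hasSum fun k => ?_
    rw [analyticOrderNatAt_trivialZero, Nat.cast_one, one_mul, norm_mul, Complex.norm_exp,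
      Complex.re_mul_ofReal]
    refine mul_le_mul (norm_trivial_coeff_le h1 h2 h12 k) ?_ (Real.exp_pos _).le (by positivity)
    apply Real.exp_le_exp.2
    refine mul_le_mul_of_nonneg_right ?_ hy.le
    simp [trivialZero]
    have : (0 : ℝ) ≤ k := by positivity
    linarith
  have hE : 0 < Real.exp (s₂.re * y) := Real.exp_pos _
  have : ∀ a b c d : ℂ, a + b + (c + d) - b - c = a + d := fun a b c d => by ring
  rw [this]
  refine (norm_add_le _ _).trans ?_
  rw [norm_mul, Complex.norm_exp, Complex.re_mul_ofReal]
  calc ‖vonMangoldtL s₂‖ * Real.exp (s₂.re * y) + ‖W‖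
      ≤ (1 + (K + S + A)) * Real.exp (s₂.re * y) + A * Real.exp (s₂.re * y) := by gcongr
    _ = (1 + K + 2 * A + S) * Real.exp (s₂.re * y) := by ring
    _ ≤ _ := by
      gcongr
      nlinarith

/-- The weight `min(√(n/x), (x/n)^{3/2})`. -/
noncomputable def wt (x : ℝ) (n : ℕ) : ℝ :=
  if (n : ℝ) ≤ x then (n / x : ℝ) ^ (1 / 2 : ℝ) else (x / n : ℝ) ^ (3 / 2 : ℝ)

/-- The Dirichlet series side of the explicit formula. -/
noncomputable def dirSum (x t : ℝ) : ℂ :=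
  ∑' n : ℕ, (ArithmeticFunction.vonMangoldt n : ℂ) * (wt x n * Complex.exp (-Complex.I * t * Real.log n))

/-- The zeros side of the explicit formula. -/
noncomputable def zeroSum (x t : ℝ) : ℂ :=
  ∑' ρ : {ρ : ℂ // IsNontrivialZero ρ}, ((zetaZeroOrder ρ * (2 / (1 + (t - (ρ : ℂ).im) ^ 2)) : ℝ) : ℂ) *
    Complex.exp (Complex.I * (ρ : ℂ).im * Real.log x)

lemma wt_nonneg {x : ℝ} (hx : 0 < x) (n : ℕ) : 0 ≤ wt x n := by
  unfold wt; split_ifs <;> positivity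

lemma twoKernel_eq_wt {x : ℝ} (hx : 0 < x) {n : ℕ} (hn : n ≠ 0) (t : ℝ) :
    twoKernel (3 / 2 + t * Complex.I) (-1 / 2 + t * Complex.I) (Real.log n) (Real.log x) =
      Complex.exp (Complex.I * t * Real.log x) *
        (wt x n * Complex.exp (-Complex.I * t * Real.log n)) := by
  have hn0 : (0 : ℝ) < n := by positivity
  unfold twoKernel wt
  simp only [Real.log_le_log_iff hn0 hx]
  split_ifs with h
  · rw [Real.rpow_def_of_pos (by positivity), Real.log_div hn0.ne' hx.ne', Complex.ofReal_exp,
      ← Complex.exp_add, ← Complex.exp_add]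
    congr 1; push_cast; ring
  · rw [Real.rpow_def_of_pos (by positivity), Real.log_div hx.ne' hn0.ne', Complex.ofReal_exp,
      ← Complex.exp_add, ← Complex.exp_add]
    congr 1; push_cast; ring

lemma summable_vonMangoldt_wt {x : ℝ} (hx : 0 < x) :
    Summable fun n : ℕ => ArithmeticFunction.vonMangoldt n * wt x n := by
  have h := (summable_vonMangoldt_twoKernel (s₁ := 3 / 2 + ((0 : ℝ) : ℂ) * Complex.I)
    (s₂ := -1 / 2 + ((0 : ℝ) : ℂ) * Complex.I) (by norm_num) (by norm_num) (Real.log x)).norm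
  refine h.congr fun n => ?_
  rcases eq_or_ne n 0 with rfl | hn
  · simp
  · rw [twoKernel_eq_wt hx hn]
    simp only [Complex.ofReal_zero, mul_zero, zero_mul, Complex.exp_zero, one_mul, mul_one, norm_mul,
      Complex.norm_real, Real.norm_eq_abs]
    rw [abs_of_nonneg (wt_nonneg hx n), abs_of_nonneg ArithmeticFunction.vonMangoldt_nonneg]

lemma exists_zeroSum_bound (hRH : RiemannHypothesis) : ∃ C : ℝ, 0 < C ∧ ∀ x t : ℝ, 1 < x →
    ‖zeroSum x t + Complex.exp (Complex.I * t * Real.log x) * ((1 / √x : ℝ) * dirSum x t)‖ ≤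
      C * (√x / (1 + t ^ 2) + (2 + |t|) ^ (1 / 10 : ℝ) / x) := by
  obtain ⟨C₁, hC₁, hE⟩ := exists_explicit_formula_bound hRH
  obtain ⟨C₂, hC₂, hP⟩ := exists_poissonSum_le hRH
  refine ⟨4 + C₁ * (1 + 2 * C₂), by positivity, fun x t hx => ?_⟩
  have hx0 : 0 < x := by linarith
  have hsx : 0 < √x := Real.sqrt_pos.2 hx0
  set s₁ : ℂ := 3 / 2 + t * Complex.I with hs₁
  set s₂ : ℂ := -1 / 2 + t * Complex.I with hs₂
  have r1 : s₁.re = 3 / 2 := by simp [hs₁]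
  have r2 : s₂.re = -1 / 2 := by simp [hs₂]
  obtain ⟨hs, hb⟩ := hE s₁ s₂ (by rw [r1]) (by rw [r2]; norm_num) (by rw [r2]; norm_num)
    (by rw [hs₁, hs₂]; norm_num) (Real.log x) (Real.log_pos hx)
  have hcoef : ∀ ρ : {ρ : ℂ // IsNontrivialZero ρ}, 1 / (s₂ - (ρ : ℂ)) - 1 / (s₁ - ρ) =
      ((-(2 / (1 + (t - (ρ : ℂ).im) ^ 2)) : ℝ) : ℂ) := by
    intro ρ
    have hr := ρ.2.re_eq hRH
    set u : ℝ := t - (ρ : ℂ).im with hu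
    have e1 : s₁ - ρ = 1 + u * Complex.I := by
      apply Complex.ext <;> simp [hs₁, hr, hu]; norm_num
    have e2 : s₂ - ρ = -1 + u * Complex.I := by
      apply Complex.ext <;> simp [hs₂, hr, hu]; norm_num
    have n1 : (1 : ℂ) + u * Complex.I ≠ 0 := fun h => by
      have := congrArg Complex.re h; simp at this
    have n2 : (-1 : ℂ) + u * Complex.I ≠ 0 := fun h => by
      have := congrArg Complex.re h; simp at this
    have n3 : (1 : ℂ) + (u : ℂ) ^ 2 ≠ 0 := by
      have : (1 : ℝ) + u ^ 2 ≠ 0 := by positivity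
      exact_mod_cast this
    rw [e1, e2, div_sub_div _ _ n2 n1]
    push_cast
    rw [← neg_div, div_eq_div_iff (mul_ne_zero n2 n1) n3]
    linear_combination (2 * (u : ℂ) ^ 2) * Complex.I_sq
  have hS : ∑' ρ : {ρ : ℂ // IsNontrivialZero ρ}, (zetaZeroOrder ρ : ℝ) *
          ‖1 / (s₂ - (ρ : ℂ)) - 1 / (s₁ - ρ)‖ = 2 * poissonSum 1 t := by
    rw [poissonSum, ← tsum_mul_left]
    refine tsum_congr fun ρ => ?_
    rw [hcoef, Complex.norm_real, norm_neg, Real.norm_of_nonneg (by positivity)]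
    ring
  have hZ : ∑' ρ : {ρ : ℂ // IsNontrivialZero ρ}, (zetaZeroOrder ρ : ℂ) *
          (1 / (s₂ - ρ) - 1 / (s₁ - ρ)) * Complex.exp (ρ * (Real.log x : ℝ)) =
      -((√x : ℝ) : ℂ) * zeroSum x t := by
    rw [zeroSum, ← tsum_mul_left]
    refine tsum_congr fun ρ => ?_
    have hr := ρ.2.re_eq hRH
    have e : Complex.exp (ρ * (Real.log x : ℝ)) =
        ((√x : ℝ) : ℂ) * Complex.exp (Complex.I * (ρ : ℂ).im * Real.log x) := by
      rw [Real.sqrt_eq_rpow, Real.rpow_def_of_pos hx0, Complex.ofReal_exp, ← Complex.exp_add]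
      congr 1
      conv_lhs => rw [← Complex.re_add_im (ρ : ℂ), hr]
      push_cast; ring
    rw [hcoef, e]
    push_cast
    ring
  have hD : ∑' n : ℕ, (ArithmeticFunction.vonMangoldt n : ℂ) * twoKernel s₁ s₂ (Real.log n) (Real.log x) =
      Complex.exp (Complex.I * t * Real.log x) * dirSum x t := by
    rw [dirSum, ← tsum_mul_left]
    refine tsum_congr fun n => ?_
    rcases eq_or_ne n 0 with rfl | hn
    · simp
    · rw [twoKernel_eq_wt hx0 hn]; ring
  have hP1 := hP 1 t le_rfl
  rw [one_mul, show 1 + |t| + 1 = 2 + |t| by ring] at hP1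
  have hex : Complex.exp ((Real.log x : ℝ) : ℂ) = x := by
    rw [← Complex.ofReal_exp, Real.exp_log hx0]
  have hsq : √x * √x = x := Real.mul_self_sqrt hx0.le
  have hex2 : Real.exp (s₂.re * Real.log x) = 1 / √x := by
    rw [r2, Real.sqrt_eq_rpow, Real.rpow_def_of_pos hx0, one_div, ← Real.exp_neg]; congr 1; ring
  rw [hS, hZ, hD, hex, hex2] at hb
  set E := Complex.exp (Complex.I * t * Real.log x)
  set Q : ℂ := (s₁ - s₂) / ((s₁ - 1) * (1 - s₂)) with hQ
  have hQb : ‖Q‖ ≤ 4 / (1 + t ^ 2) := by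
    have e1 : s₁ - s₂ = 2 := by rw [hs₁, hs₂]; ring
    have q1 : (1 + t ^ 2) / 4 ≤ ‖s₁ - 1‖ ^ 2 := by
      rw [Complex.sq_norm, Complex.normSq_apply]
      simp [hs₁]; nlinarith [sq_nonneg t]
    have q2 : (1 + t ^ 2) ≤ ‖1 - s₂‖ ^ 2 := by
      rw [Complex.sq_norm, Complex.normSq_apply]
      simp [hs₂]; nlinarith [sq_nonneg t]
    have q3 : (1 + t ^ 2) / 2 ≤ ‖s₁ - 1‖ * ‖1 - s₂‖ := by
      refine le_of_sq_le_sq ?_ (by positivity)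
      rw [mul_pow]
      calc ((1 + t ^ 2) / 2) ^ 2 = (1 + t ^ 2) / 4 * (1 + t ^ 2) := by ring
        _ ≤ _ := by gcongr
    rw [hQ, e1, norm_div, norm_mul, div_le_div_iff₀ (lt_of_lt_of_le (by positivity) q3) (by positivity)]
    norm_num
    linarith
  have hfin : zeroSum x t + E * ((1 / √x : ℝ) * dirSum x t) = ((1 / √x : ℝ) : ℂ) *
      (E * dirSum x t - Q * x - -((√x : ℝ) : ℂ) * zeroSum x t) + ((√x : ℝ) : ℂ) * Q := by
    have c1 : ((1 / √x : ℝ) : ℂ) * ((√x : ℝ) : ℂ) = 1 := by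
      rw [← Complex.ofReal_mul, one_div_mul_cancel hsx.ne', Complex.ofReal_one]
    have c2 : ((√x : ℝ) : ℂ) * ((√x : ℝ) : ℂ) = x := by rw [← Complex.ofReal_mul, hsq]
    linear_combination (-(zeroSum x t) + Q * ((√x : ℝ) : ℂ)) * c1 - Q * ((1 / √x : ℝ) : ℂ) * c2
  rw [hfin]
  refine (norm_add_le _ _).trans ?_
  rw [norm_mul, norm_mul, Complex.norm_real, Complex.norm_real, Real.norm_of_nonneg (by positivity),
    Real.norm_of_nonneg (by positivity)]
  set q := (2 + |t|) ^ (1 / 10 : ℝ) with hq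
  have hq1 : 1 ≤ q := Real.one_le_rpow (by linarith [abs_nonneg t]) (by norm_num)
  have hxx : 1 / √x * (1 / √x) = 1 / x := by rw [one_div_mul_one_div, hsq]
  calc 1 / √x * ‖E * dirSum x t - Q * x - -((√x : ℝ) : ℂ) * zeroSum x t‖ + √x * ‖Q‖
      ≤ 1 / √x * (C₁ * (1 + 2 * poissonSum 1 t) * (1 / √x)) + √x * (4 / (1 + t ^ 2)) := by gcongr
    _ = C₁ * (1 + 2 * poissonSum 1 t) * (1 / √x * (1 / √x)) + 4 * (√x / (1 + t ^ 2)) := by ring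
    _ ≤ C₁ * (q + 2 * (C₂ * q)) * (1 / x) + 4 * (√x / (1 + t ^ 2)) := by rw [hxx]; gcongr
    _ = C₁ * (1 + 2 * C₂) * (q / x) + 4 * (√x / (1 + t ^ 2)) := by ring
    _ ≤ _ := by
      have : 0 ≤ q / x := by positivity
      have : 0 ≤ √x / (1 + t ^ 2) := by positivity
      have : 0 ≤ C₁ * (1 + 2 * C₂) * (√x / (1 + t ^ 2)) := by positivity
      nlinarith

/-! ### Montgomery's function as a mean square of a Dirichlet series -/

lemma tendsto_div_one_add_sq_atTop :
    Filter.Tendsto (fun p : ℝ => p / (1 + p ^ 2)) Filter.atTop (nhds 0) := by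
  refine tendsto_of_tendsto_of_tendsto_of_le_of_le' tendsto_const_nhds tendsto_inv_atTop_zero ?_ ?_
  · filter_upwards [Filter.eventually_ge_atTop 0] with p hp using by positivity
  · filter_upwards [Filter.eventually_gt_atTop 0] with p hp
    rw [← one_div, div_le_div_iff₀ (by positivity) hp]
    nlinarith

lemma tendsto_div_one_add_sq_atBot :
    Filter.Tendsto (fun p : ℝ => p / (1 + p ^ 2)) Filter.atBot (nhds 0) := by
  have := (tendsto_div_one_add_sq_atTop.comp Filter.tendsto_neg_atBot_atTop).neg
  rw [neg_zero] at this
  refine this.congr fun p => ?_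
  simp only [Function.comp]
  rw [neg_sq, neg_div, neg_neg]

lemma tendsto_inv_one_add_sq_atTop :
    Filter.Tendsto (fun p : ℝ => 1 / (1 + p ^ 2)) Filter.atTop (nhds 0) := by
  refine tendsto_of_tendsto_of_tendsto_of_le_of_le' tendsto_const_nhds tendsto_div_one_add_sq_atTop ?_ ?_
  · filter_upwards with p using by positivity
  · filter_upwards [Filter.eventually_ge_atTop 1] with p hp
    gcongr

lemma tendsto_inv_one_add_sq_atBot :
    Filter.Tendsto (fun p : ℝ => 1 / (1 + p ^ 2)) Filter.atBot (nhds 0) := by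
  refine (tendsto_inv_one_add_sq_atTop.comp Filter.tendsto_neg_atBot_atTop).congr fun p => ?_
  simp only [Function.comp, neg_sq]

lemma integrable_cauchy_mul (u : ℝ) :
    Integrable fun p : ℝ => 1 / ((1 + p ^ 2) * (1 + (p + u) ^ 2)) := by
  refine Integrable.mono' integrable_inv_one_add_sq ?_ (Filter.Eventually.of_forall fun p => ?_)
  · refine Continuous.aestronglyMeasurable ?_
    refine continuous_const.div (by fun_prop) fun p => by positivity
  · rw [Real.norm_of_nonneg (by positivity), ← one_div]
    refine one_div_le_one_div_of_le (by positivity) ?_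
    nlinarith [mul_nonneg (sq_nonneg p) (sq_nonneg (p + u)), sq_nonneg (p + u)]

lemma integral_cauchy_mul (u : ℝ) :
    ∫ p : ℝ, 1 / ((1 + p ^ 2) * (1 + (p + u) ^ 2)) = 2 * π / (4 + u ^ 2) := by
  rcases eq_or_ne u 0 with rfl | hu
  · have hd : ∀ p : ℝ, HasDerivAt (fun p => (Real.arctan p + p / (1 + p ^ 2)) / 2)
        (1 / ((1 + p ^ 2) * (1 + (p + 0) ^ 2))) p := by
      intro p
      have h0 : (1 + p ^ 2) ≠ 0 := by positivity
      have h1 := ((Real.hasDerivAt_arctan p).add ((hasDerivAt_id p).div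
        (((hasDerivAt_pow 2 p).const_add 1)) h0)).div_const 2
      refine h1.congr_deriv ?_
      simp only [id, add_zero]
      field_simp
      ring
    have hT : Filter.Tendsto (fun p => (Real.arctan p + p / (1 + p ^ 2)) / 2) Filter.atTop
        (nhds ((π / 2 + 0) / 2)) :=
      ((tendsto_nhds_of_tendsto_nhdsWithin Real.tendsto_arctan_atTop).add
        tendsto_div_one_add_sq_atTop).div_const 2
    have hB : Filter.Tendsto (fun p => (Real.arctan p + p / (1 + p ^ 2)) / 2) Filter.atBot
        (nhds ((-(π / 2) + 0) / 2)) :=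
      ((tendsto_nhds_of_tendsto_nhdsWithin Real.tendsto_arctan_atBot).add
        tendsto_div_one_add_sq_atBot).div_const 2
    rw [integral_of_hasDerivAt_of_tendsto hd (integrable_cauchy_mul 0) hB hT]
    ring
  · have hd : ∀ p : ℝ, HasDerivAt (fun p => (Real.arctan p + Real.arctan (p + u) +
        1 / u * (Real.log ((1 + (p + u) ^ 2) / (1 + p ^ 2)))) / (4 + u ^ 2))
        (1 / ((1 + p ^ 2) * (1 + (p + u) ^ 2))) p := by
      intro p
      have h0 : (1 + p ^ 2) ≠ 0 := by positivity
      have h0' : (1 + (p + u) ^ 2) ≠ 0 := by positivity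
      have h4 : (4 + u ^ 2) ≠ 0 := by positivity
      have hp : HasDerivAt (fun p : ℝ => p + u) 1 p := (hasDerivAt_id p).add_const u
      have h1 := (((Real.hasDerivAt_arctan p).add ((Real.hasDerivAt_arctan (p + u)).comp p hp)).add
        (((((hp.pow 2).const_add 1).div ((hasDerivAt_pow 2 p).const_add 1) h0).log
          (div_ne_zero h0' h0)).const_mul (1 / u))).div_const (4 + u ^ 2)
      refine h1.congr_deriv ?_
      simp only [Pi.pow_apply, Pi.div_apply, Nat.cast_ofNat, mul_one, Nat.add_one_sub_one, pow_one]
      field_simp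
      ring
    have hquot : ∀ p : ℝ, (1 + (p + u) ^ 2) / (1 + p ^ 2) =
        1 + 2 * u * (p / (1 + p ^ 2)) + u ^ 2 * (1 / (1 + p ^ 2)) := by
      intro p
      have h0 : (1 + p ^ 2) ≠ 0 := by positivity
      field_simp
      ring
    have hlog : ∀ l : Filter ℝ, Filter.Tendsto (fun p : ℝ => p / (1 + p ^ 2)) l (nhds 0) →
        Filter.Tendsto (fun p : ℝ => 1 / (1 + p ^ 2)) l (nhds 0) →
        Filter.Tendsto (fun p => Real.log ((1 + (p + u) ^ 2) / (1 + p ^ 2))) l (nhds 0) := by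
      intro l h1 h2
      have : Filter.Tendsto (fun p => (1 + (p + u) ^ 2) / (1 + p ^ 2)) l (nhds 1) := by
        simp_rw [hquot]
        simpa using (tendsto_const_nhds.add (h1.const_mul (2 * u))).add (h2.const_mul (u ^ 2))
      simpa using this.log one_ne_zero
    have hT := (((tendsto_nhds_of_tendsto_nhdsWithin Real.tendsto_arctan_atTop).add
        ((tendsto_nhds_of_tendsto_nhdsWithin Real.tendsto_arctan_atTop).comp
          (Filter.tendsto_atTop_add_const_right _ u Filter.tendsto_id))).add
        ((hlog _ tendsto_div_one_add_sq_atTop tendsto_inv_one_add_sq_atTop).const_mul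
          (1 / u))).div_const (4 + u ^ 2)
    have hB := (((tendsto_nhds_of_tendsto_nhdsWithin Real.tendsto_arctan_atBot).add
        ((tendsto_nhds_of_tendsto_nhdsWithin Real.tendsto_arctan_atBot).comp
          (Filter.tendsto_atBot_add_const_right _ u Filter.tendsto_id))).add
        ((hlog _ tendsto_div_one_add_sq_atBot tendsto_inv_one_add_sq_atBot).const_mul
          (1 / u))).div_const (4 + u ^ 2)
    rw [integral_of_hasDerivAt_of_tendsto hd (integrable_cauchy_mul u) hB hT]
    ring

lemma integrable_cauchy_shift (a b : ℝ) :
    Integrable fun t : ℝ => (2 / (1 + (t - a) ^ 2)) * (2 / (1 + (t - b) ^ 2)) := by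
  refine (((integrable_cauchy_mul (a - b)).comp_sub_right a).const_mul 4).congr
    (Filter.Eventually.of_forall fun t => ?_)
  simp only
  rw [show t - a + (a - b) = t - b by ring, div_mul_div_comm]
  ring

lemma integral_cauchy_shift (a b : ℝ) :
    ∫ t : ℝ, (2 / (1 + (t - a) ^ 2)) * (2 / (1 + (t - b) ^ 2)) = 2 * π * (4 / (4 + (a - b) ^ 2)) := by
  have h := integral_sub_right_eq_self (μ := volume)
    (fun p : ℝ => 4 * (1 / ((1 + p ^ 2) * (1 + (p + (a - b)) ^ 2)))) a
  have h2 : ∫ p : ℝ, 4 * (1 / ((1 + p ^ 2) * (1 + (p + (a - b)) ^ 2))) =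
      4 * (2 * π / (4 + (a - b) ^ 2)) := by
    rw [integral_const_mul, integral_cauchy_mul]
  rw [show 2 * π * (4 / (4 + (a - b) ^ 2)) = 4 * (2 * π / (4 + (a - b) ^ 2)) by ring, ← h2, ← h]
  congr 1
  ext t
  rw [show t - a + (a - b) = t - b by ring, div_mul_div_comm]
  ring

lemma finite_zeros_window (T : ℝ) :
    Finite {ρ : ℂ // IsNontrivialZero ρ ∧ 0 ≤ ρ.im ∧ ρ.im ≤ T} := by
  refine Set.Finite.to_subtype ((finite_zerosIn differentiable_riemannZeta₁ riemannZeta₁_zero_ne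
    (1 + T)).subset fun ρ hρ => ⟨hρ.1.riemannZeta₁, ?_⟩)
  have h1 := Complex.norm_le_abs_re_add_abs_im ρ
  rw [abs_of_nonneg hρ.2.1, abs_of_pos hρ.1.2.1] at h1
  linarith [hρ.1.2.2, hρ.2.2]

/-- The zeros side restricted to zeros with ordinates in `[0, T]`. -/
noncomputable def zeroSumTrunc (x T t : ℝ) : ℂ :=
  ∑' ρ : {ρ : ℂ // IsNontrivialZero ρ ∧ 0 ≤ ρ.im ∧ ρ.im ≤ T},
    ((zetaZeroOrder ρ * (2 / (1 + (t - (ρ : ℂ).im) ^ 2)) : ℝ) : ℂ) *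
    Complex.exp (Complex.I * (ρ : ℂ).im * Real.log x)

lemma integral_zeroSumTrunc {x : ℝ} (hx : 0 < x) (T : ℝ) :
    Integrable (fun t => ‖zeroSumTrunc x T t‖ ^ 2) ∧
    ((∫ t : ℝ, ‖zeroSumTrunc x T t‖ ^ 2 : ℝ) : ℂ) = 2 * π * Fpair x T := by
  have := finite_zeros_window T
  have := Fintype.ofFinite {ρ : ℂ // IsNontrivialZero ρ ∧ 0 ≤ ρ.im ∧ ρ.im ≤ T}
  have e : ∀ t : ℝ, ((‖zeroSumTrunc x T t‖ ^ 2 : ℝ) : ℂ) =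
      ∑ ρ : {ρ : ℂ // IsNontrivialZero ρ ∧ 0 ≤ ρ.im ∧ ρ.im ≤ T},
      ∑ ρ' : {ρ : ℂ // IsNontrivialZero ρ ∧ 0 ≤ ρ.im ∧ ρ.im ≤ T},
      (((zetaZeroOrder ρ * zetaZeroOrder ρ' : ℕ) : ℂ) *
        (x : ℂ) ^ (Complex.I * (((ρ : ℂ).im - (ρ' : ℂ).im : ℝ) : ℂ))) *
        (((2 / (1 + (t - (ρ : ℂ).im) ^ 2)) * (2 / (1 + (t - (ρ' : ℂ).im) ^ 2)) : ℝ) : ℂ) := by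
    intro t
    rw [Complex.ofReal_pow, ← Complex.mul_conj', zeroSumTrunc, tsum_fintype, map_sum,
      Finset.sum_mul_sum]
    refine Finset.sum_congr rfl fun ρ _ => Finset.sum_congr rfl fun ρ' _ => ?_
    rw [map_mul, Complex.conj_ofReal, ← Complex.exp_conj, Complex.cpow_def_of_ne_zero
      (by exact_mod_cast hx.ne'), ← Complex.ofReal_log hx.le]
    simp only [map_mul, Complex.conj_I, Complex.conj_ofReal]
    rw [show ((Real.log x : ℝ) : ℂ) * (Complex.I * (((ρ : ℂ).im - (ρ' : ℂ).im : ℝ) : ℂ)) =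
      Complex.I * (ρ : ℂ).im * Real.log x + -Complex.I * (ρ' : ℂ).im * Real.log x by
        push_cast; ring, Complex.exp_add]
    push_cast
    ring
  have hi : ∀ (c : ℂ) (a b : ℝ), Integrable fun t : ℝ => c *
      (((2 / (1 + (t - a) ^ 2)) * (2 / (1 + (t - b) ^ 2)) : ℝ) : ℂ) := fun c a b =>
    ((integrable_cauchy_shift a b).ofReal).const_mul c
  constructor
  · have : Integrable fun t : ℝ => ((‖zeroSumTrunc x T t‖ ^ 2 : ℝ) : ℂ) := by
      simp_rw [e]
      exact integrable_finsetSum _ fun ρ _ => integrable_finsetSum _ fun ρ' _ => hi _ _ _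
    exact this.re.congr (Filter.Eventually.of_forall fun t => Complex.ofReal_re _)
  · rw [← integral_complex_ofReal]
    simp_rw [e]
    rw [integral_finsetSum _ fun ρ _ => integrable_finsetSum _ fun ρ' _ => hi _ _ _, Fpair,
      tsum_fintype, Finset.mul_sum]
    refine Finset.sum_congr rfl fun ρ _ => ?_
    rw [integral_finsetSum _ fun ρ' _ => hi _ _ _, tsum_fintype, Finset.mul_sum]
    refine Finset.sum_congr rfl fun ρ' _ => ?_
    rw [integral_const_mul, integral_complex_ofReal, integral_cauchy_shift]
    push_cast
    ring

/-- The summand of `zeroSum`. -/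
noncomputable def zeroTerm (x t : ℝ) (ρ : ℂ) : ℂ :=
  ((zetaZeroOrder ρ * (2 / (1 + (t - ρ.im) ^ 2)) : ℝ) : ℂ) *
    Complex.exp (Complex.I * ρ.im * Real.log x)

lemma norm_zeroTerm (x t : ℝ) (ρ : ℂ) :
    ‖zeroTerm x t ρ‖ = zetaZeroOrder ρ * (2 / (1 + (t - ρ.im) ^ 2)) := by
  rw [zeroTerm, norm_mul, Complex.norm_real, Real.norm_of_nonneg (by positivity),
    show Complex.I * ρ.im * Real.log x = ((ρ.im * Real.log x : ℝ) : ℂ) * Complex.I by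
      push_cast; ring, Complex.norm_exp_ofReal_mul_I, mul_one]

lemma zeroSum_eq_tsum_indicator (x t : ℝ) :
    zeroSum x t = ∑' ρ : ℂ, {ρ | IsNontrivialZero ρ}.indicator (zeroTerm x t) ρ := by
  rw [← tsum_subtype]
  rfl

lemma zeroSumTrunc_eq_tsum_indicator (x T t : ℝ) :
    zeroSumTrunc x T t = ∑' ρ : ℂ,
      {ρ | IsNontrivialZero ρ ∧ 0 ≤ ρ.im ∧ ρ.im ≤ T}.indicator (zeroTerm x t) ρ := by
  rw [← tsum_subtype]
  rfl

lemma indicator_poisson_summable (hRH : RiemannHypothesis) {V : ℝ} (hV : 0 < V) (t : ℝ) :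
    Summable ({ρ | IsNontrivialZero ρ}.indicator
      fun ρ : ℂ => (zetaZeroOrder ρ : ℝ) / (V ^ 2 + (t - ρ.im) ^ 2)) :=
  summable_subtype_iff_indicator.mp (summable_nontrivial_poisson hRH hV t)

lemma poissonSum_eq_tsum_indicator (V t : ℝ) :
    poissonSum V t = ∑' ρ : ℂ, {ρ | IsNontrivialZero ρ}.indicator
      (fun ρ : ℂ => (zetaZeroOrder ρ : ℝ) / (V ^ 2 + (t - ρ.im) ^ 2)) ρ := by
  rw [← tsum_subtype]
  rfl

lemma zeroTerm_indicator_bound (hRH : RiemannHypothesis) (x t : ℝ) {V₀ : ℝ}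
    (S : Set ℂ) (hS : ∀ ρ ∈ S, IsNontrivialZero ρ ∧ V₀ ≤ |t - ρ.im|) (hV : 0 ≤ V₀) :
    Summable (S.indicator (zeroTerm x t)) ∧
    ‖∑' ρ : ℂ, S.indicator (zeroTerm x t) ρ‖ ≤ 4 * poissonSum (max 1 V₀) t := by
  have hV1 : 0 < max 1 V₀ := by positivity
  have hs := (indicator_poisson_summable hRH hV1 t).mul_left 4
  have hle : ∀ ρ : ℂ, ‖S.indicator (zeroTerm x t) ρ‖ ≤
      4 * {ρ | IsNontrivialZero ρ}.indicator
        (fun ρ : ℂ => (zetaZeroOrder ρ : ℝ) / ((max 1 V₀) ^ 2 + (t - ρ.im) ^ 2)) ρ := by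
    intro ρ
    by_cases h : ρ ∈ S
    · rw [Set.indicator_of_mem h, Set.indicator_of_mem (by exact (hS ρ h).1), norm_zeroTerm]
      have h2 := (hS ρ h).2
      have h3 : (max 1 V₀) ^ 2 + (t - ρ.im) ^ 2 ≤ 2 * (1 + (t - ρ.im) ^ 2) := by
        rcases max_cases 1 V₀ with ⟨h, h'⟩ | ⟨h, h'⟩ <;> rw [h]
        · nlinarith [sq_nonneg (t - ρ.im)]
        · nlinarith [sq_abs (t - ρ.im)]
      rw [mul_div_assoc', mul_div_assoc', div_le_div_iff₀ (by positivity) (by positivity)]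
      nlinarith [Nat.cast_nonneg (α := ℝ) (zetaZeroOrder ρ)]
    · rw [Set.indicator_of_notMem h, norm_zero]
      refine mul_nonneg (by norm_num) (Set.indicator_nonneg (fun _ _ => by positivity) _)
  have hsum := Summable.of_norm_bounded hs hle
  refine ⟨hsum, ?_⟩
  rw [poissonSum_eq_tsum_indicator, ← tsum_mul_left]
  exact (norm_tsum_le_tsum_norm hsum.norm).trans (hsum.norm.tsum_le_tsum hle hs)

/-- The size of the tail error made when truncating the sum over zeros. -/
noncomputable def tailErr (T t : ℝ) : ℝ :=
  (1 + |t|) ^ (1 / 10 : ℝ) * (1 / (1 + |t|) + 1 / (1 + |t - T|))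

lemma exists_zeroSumTrunc_bound (hRH : RiemannHypothesis) : ∃ C > 0, ∀ x T t : ℝ, 0 ≤ T →
    ‖zeroSumTrunc x T t‖ ≤ C * (1 + |t|) ^ (1 / 10 : ℝ) ∧
    (t ∈ Set.Icc 0 T → ‖zeroSum x t - zeroSumTrunc x T t‖ ≤ C * tailErr T t) ∧
    (t ∉ Set.Icc 0 T → ‖zeroSumTrunc x T t‖ ≤ C * tailErr T t) := by
  obtain ⟨C, hC, hP⟩ := exists_poissonSum_le hRH
  have key : ∀ t V₀ : ℝ, 0 ≤ V₀ → V₀ ≤ |t| → 4 * poissonSum (max 1 V₀) t ≤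
      16 * C * (1 + |t|) ^ (1 / 10 : ℝ) * (1 / (1 + V₀)) := by
    intro t V₀ h0 h1
    have hV1 : 1 ≤ max 1 V₀ := le_max_left _ _
    have h2 := hP (max 1 V₀) t hV1
    have h3 : (1 + |t| + max 1 V₀) ^ (1 / 10 : ℝ) ≤ 2 * (1 + |t|) ^ (1 / 10 : ℝ) := by
      have hm : max 1 V₀ ≤ 1 + |t| := max_le (by linarith [abs_nonneg t]) (by linarith)
      calc (1 + |t| + max 1 V₀) ^ (1 / 10 : ℝ) ≤ (2 * (1 + |t|)) ^ (1 / 10 : ℝ) :=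
            Real.rpow_le_rpow (by positivity) (by linarith) (by norm_num)
        _ = 2 ^ (1 / 10 : ℝ) * (1 + |t|) ^ (1 / 10 : ℝ) :=
            Real.mul_rpow (by norm_num) (by positivity)
        _ ≤ 2 ^ (1 : ℝ) * (1 + |t|) ^ (1 / 10 : ℝ) := by
            gcongr <;> norm_num
        _ = _ := by rw [Real.rpow_one]
    have h4 : max 1 V₀ * poissonSum (max 1 V₀) t ≤ 2 * C * (1 + |t|) ^ (1 / 10 : ℝ) := by
      nlinarith
    have h5 : 0 ≤ poissonSum (max 1 V₀) t := tsum_nonneg fun _ => by positivity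
    have h6 : 1 + V₀ ≤ 2 * max 1 V₀ := by linarith [le_max_right 1 V₀]
    rw [mul_one_div, le_div_iff₀ (by linarith)]
    nlinarith
  refine ⟨16 * C, by positivity, fun x T t hT => ?_⟩
  have hmin : 0 ≤ min |t| |t - T| := by positivity
  have hp : 0 < (1 + |t|) ^ (1 / 10 : ℝ) := by positivity
  have herr : 16 * C * (1 + |t|) ^ (1 / 10 : ℝ) * (1 / (1 + min |t| |t - T|)) ≤
      16 * C * tailErr T t := by
    rw [tailErr, ← mul_assoc]
    refine mul_le_mul_of_nonneg_left ?_ (by positivity)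
    rcases min_cases |t| |t - T| with ⟨h, _⟩ | ⟨h, _⟩ <;> rw [h]
    · have : 0 < 1 / (1 + |t - T|) := by positivity
      linarith
    · have : 0 < 1 / (1 + |t|) := by positivity
      linarith
  refine ⟨?_, fun ht => ?_, fun ht => ?_⟩
  · rw [zeroSumTrunc_eq_tsum_indicator]
    refine (zeroTerm_indicator_bound hRH x t (V₀ := 0) _ (fun ρ h => ⟨h.1, abs_nonneg _⟩) le_rfl).2.trans ?_
    simpa using key t 0 le_rfl (abs_nonneg t)
  · have h1 := (zeroTerm_indicator_bound hRH x t (V₀ := 0) {ρ | IsNontrivialZero ρ}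
      (fun ρ h => ⟨h, abs_nonneg _⟩) le_rfl).1
    have h2 := (zeroTerm_indicator_bound hRH x t (V₀ := 0)
      {ρ | IsNontrivialZero ρ ∧ 0 ≤ ρ.im ∧ ρ.im ≤ T}
      (fun ρ h => ⟨h.1, abs_nonneg _⟩) le_rfl).1
    have hd : zeroSum x t - zeroSumTrunc x T t = ∑' ρ : ℂ,
        ({ρ | IsNontrivialZero ρ} \ {ρ | IsNontrivialZero ρ ∧ 0 ≤ ρ.im ∧ ρ.im ≤ T}).indicator
          (zeroTerm x t) ρ := by
      rw [zeroSum_eq_tsum_indicator, zeroSumTrunc_eq_tsum_indicator, ← h1.tsum_sub h2]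
      refine tsum_congr fun ρ => ?_
      rw [Set.indicator_sdiff (fun ρ h => h.1)]
      rfl
    rw [hd]
    refine (zeroTerm_indicator_bound hRH x t (V₀ := min |t| |t - T|) _
      (fun ρ h => ⟨h.1, ?_⟩) hmin).2.trans ((key _ _ hmin (min_le_left _ _)).trans herr)
    have h3 : ρ.im < 0 ∨ T < ρ.im := by
      by_contra! h4
      exact h.2 ⟨h.1, h4⟩
    rcases h3 with h3 | h3
    · refine (min_le_left _ _).trans ?_
      rw [abs_of_nonneg ht.1, abs_of_nonneg (by linarith [ht.1])]
      linarith
    · refine (min_le_right _ _).trans ?_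
      rw [abs_sub_comm, abs_of_nonneg (by linarith [ht.2]), abs_sub_comm,
        abs_of_nonneg (by linarith [ht.2])]
      linarith
  · rw [zeroSumTrunc_eq_tsum_indicator]
    refine (zeroTerm_indicator_bound hRH x t (V₀ := min |t| |t - T|) _
      (fun ρ h => ⟨h.1, ?_⟩) hmin).2.trans ((key _ _ hmin (min_le_left _ _)).trans herr)
    obtain ⟨_, h3, h4⟩ := h
    have h5 : t < 0 ∨ T < t := by
      by_contra! h4
      exact ht h4
    rcases h5 with h5 | h5
    · refine (min_le_left _ _).trans ?_
      rw [abs_of_neg h5, abs_of_neg (by linarith)]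
      linarith
    · refine (min_le_right _ _).trans ?_
      rw [abs_of_pos (by linarith), abs_of_pos (by linarith)]
      linarith

/-- An integrable majorant for `tailErr ^ 2` and `1 / (1 + t ^ 2)`. -/
noncomputable def decay (t : ℝ) : ℝ := (1 + |t|) ^ (-(11 / 10) : ℝ)

lemma decay_pos (t : ℝ) : 0 < decay t := by unfold decay; positivity

lemma integrable_decay : Integrable decay := by
  have h := integrable_one_add_norm (E := ℝ) (μ := volume) (r := 11 / 10) (by norm_num)
  simp only [Real.norm_eq_abs] at h
  exact h

lemma decay_mul_rpow (t : ℝ) : decay t * (1 + |t|) ^ (1 / 10 : ℝ) = 1 / (1 + |t|) := by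
  rw [decay, ← Real.rpow_add (by positivity), one_div (1 + |t|), ← Real.rpow_neg_one (1 + |t|)]
  congr 1
  norm_num

lemma sq_rpow_mul_inv_le_decay (t : ℝ) :
    ((1 + |t|) ^ (1 / 10 : ℝ) * (1 / (1 + |t|))) ^ 2 ≤ decay t := by
  have h : (1 : ℝ) ≤ 1 + |t| := by linarith [abs_nonneg t]
  rw [one_div (1 + |t|), ← Real.rpow_neg_one (1 + |t|), ← Real.rpow_add (by positivity), ← Real.rpow_natCast,
    ← Real.rpow_mul (by positivity), decay]
  exact Real.rpow_le_rpow_of_exponent_le h (by norm_num)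

lemma inv_one_add_sq_le_decay (t : ℝ) : 1 / (1 + t ^ 2) ≤ 2 * decay t := by
  have h : (1 : ℝ) ≤ 1 + |t| := by linarith [abs_nonneg t]
  have h1 : (1 + |t|) ^ (-2 : ℝ) ≤ decay t := Real.rpow_le_rpow_of_exponent_le h (by norm_num)
  have h2 : (1 + |t|) ^ (-2 : ℝ) = 1 / (1 + |t|) ^ 2 := by
    rw [Real.rpow_neg (by positivity), one_div]
    norm_num
  have h3 : 1 / (1 + t ^ 2) ≤ 2 * (1 / (1 + |t|) ^ 2) := by
    rw [mul_one_div, div_le_div_iff₀ (by positivity) (by positivity)]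
    nlinarith [sq_abs t, sq_nonneg (1 - |t|)]
  linarith

lemma tailErr_nonneg (T t : ℝ) : 0 ≤ tailErr T t := by
  unfold tailErr; positivity

lemma tailErr_le {T t : ℝ} (ht : t ∈ Set.Icc 0 T) :
    tailErr T t ≤ 2 * (2 + T) ^ (1 / 10 : ℝ) ∧
    tailErr T t ≤ ((2 + T) ^ (1 / 10 : ℝ)) ^ 2 * (decay t + decay (t - T)) := by
  have h1 : (1 + |t|) ^ (1 / 10 : ℝ) ≤ (2 + T) ^ (1 / 10 : ℝ) :=
    Real.rpow_le_rpow (by positivity) (by rw [abs_of_nonneg ht.1]; linarith [ht.2]) (by norm_num)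
  have h2 : (1 + |t - T|) ^ (1 / 10 : ℝ) ≤ (2 + T) ^ (1 / 10 : ℝ) :=
    Real.rpow_le_rpow (by positivity)
      (by rw [abs_of_nonpos (by linarith [ht.2])]; linarith [ht.1]) (by norm_num)
  have h3 := decay_pos t
  have h4 := decay_pos (t - T)
  have h0 : 0 < (1 + |t|) ^ (1 / 10 : ℝ) := by positivity
  constructor
  · have u1 : 1 / (1 + |t|) ≤ 1 := by
      rw [div_le_one (by positivity)]; linarith [abs_nonneg t]
    have u2 : 1 / (1 + |t - T|) ≤ 1 := by
      rw [div_le_one (by positivity)]; linarith [abs_nonneg (t - T)]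
    unfold tailErr
    nlinarith
  · rw [tailErr, ← decay_mul_rpow, ← decay_mul_rpow, sq, mul_assoc]
    have hq0 : 0 ≤ (2 + T) ^ (1 / 10 : ℝ) := h0.le.trans h1
    refine mul_le_mul h1 ?_ (add_nonneg (mul_nonneg h3.le h0.le) (mul_nonneg h4.le (by positivity))) hq0
    linarith [mul_le_mul_of_nonneg_left h1 h3.le, mul_le_mul_of_nonneg_left h2 h4.le]

lemma tailErr_sq_le {T : ℝ} (t : ℝ) (hT : 0 ≤ T) :
    tailErr T t ^ 2 ≤ 2 * ((2 + T) ^ (1 / 10 : ℝ)) ^ 2 * (decay t + decay (t - T)) := by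
  have h1 := sq_rpow_mul_inv_le_decay t
  have h2 := sq_rpow_mul_inv_le_decay (t - T)
  have hq : 1 ≤ (2 + T) ^ (1 / 10 : ℝ) := Real.one_le_rpow (by linarith) (by norm_num)
  have hp : (1 + |t|) ^ (1 / 10 : ℝ) ≤ (2 + T) ^ (1 / 10 : ℝ) * (1 + |t - T|) ^ (1 / 10 : ℝ) := by
    rw [← Real.mul_rpow (by positivity) (by positivity)]
    refine Real.rpow_le_rpow (by positivity) ?_ (by norm_num)
    have := abs_sub_abs_le_abs_sub t T
    rw [abs_of_nonneg hT] at this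
    nlinarith [abs_nonneg (t - T)]
  have h3 := decay_pos t
  have h4 : ((1 + |t|) ^ (1 / 10 : ℝ) * (1 / (1 + |t - T|))) ^ 2 ≤
      ((2 + T) ^ (1 / 10 : ℝ)) ^ 2 * decay (t - T) := by
    calc _ ≤ ((2 + T) ^ (1 / 10 : ℝ) * (1 + |t - T|) ^ (1 / 10 : ℝ) * (1 / (1 + |t - T|))) ^ 2 := by
          gcongr
      _ = ((2 + T) ^ (1 / 10 : ℝ)) ^ 2 *
          ((1 + |t - T|) ^ (1 / 10 : ℝ) * (1 / (1 + |t - T|))) ^ 2 := by ring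
      _ ≤ _ := by gcongr
  have h5 : decay t ≤ ((2 + T) ^ (1 / 10 : ℝ)) ^ 2 * decay t :=
    le_mul_of_one_le_left h3.le (one_le_pow₀ hq)
  rw [tailErr, mul_add]
  nlinarith [sq_nonneg ((1 + |t|) ^ (1 / 10 : ℝ) * (1 / (1 + |t|)) -
    (1 + |t|) ^ (1 / 10 : ℝ) * (1 / (1 + |t - T|)))]

lemma sq_sub_sq_bound {a b C q E x w : ℝ} (ha : 0 ≤ a) (haq : a ≤ C * q)
    (hE : 0 ≤ E) (hEq : E ≤ 2 * q) (hx : 1 < x) (hw : 0 ≤ w) (hw1 : w ≤ 1) (hq : 1 ≤ q)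
    (hC : 0 < C) (hab : |a - b| ≤ C * (E + √x * w + q / x)) :
    |a ^ 2 - b ^ 2| ≤ C ^ 2 * (8 * (q * E) + 5 * ((q ^ 2 + x) * w) + 5 * (q ^ 2 / x)) := by
  set d := E + √x * w + q / x with hd
  have hx0 : 0 < x := by linarith
  have hs := Real.sq_sqrt hx0.le
  have hs0 := Real.sqrt_nonneg x
  have hqx : 0 ≤ q / x := by positivity
  have hd0 : 0 ≤ d := by positivity
  have hb : |a + b| ≤ 2 * (C * q) + C * d := by
    have : a + b = 2 * a - (a - b) := by ring
    rw [this]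
    refine (abs_sub _ _).trans ?_
    rw [abs_of_nonneg (by positivity)]
    linarith
  have h1 : |a ^ 2 - b ^ 2| ≤ C * d * (2 * (C * q) + C * d) := by
    rw [show a ^ 2 - b ^ 2 = (a - b) * (a + b) by ring, abs_mul]
    exact mul_le_mul hab hb (abs_nonneg _) (by positivity)
  refine h1.trans ?_
  rw [show C * d * (2 * (C * q) + C * d) = C ^ 2 * (2 * (q * d) + d ^ 2) by ring]
  refine mul_le_mul_of_nonneg_left ?_ (by positivity)
  have h2 : d ^ 2 ≤ 3 * (E ^ 2 + (√x * w) ^ 2 + (q / x) ^ 2) := by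
    nlinarith [sq_nonneg (E - √x * w), sq_nonneg (E - q / x), sq_nonneg (√x * w - q / x)]
  have h3 : (√x * w) ^ 2 ≤ x * w := by
    rw [mul_pow, hs]; nlinarith [mul_nonneg hx0.le hw]
  have h4 : (q / x) ^ 2 ≤ q ^ 2 / x := by
    rw [div_pow, div_le_div_iff₀ (by positivity) hx0]
    nlinarith [sq_nonneg q, mul_pos hx0 hx0, mul_nonneg (sq_nonneg q) hx0.le]
  have h5 : E ^ 2 ≤ 2 * (q * E) := by nlinarith
  have h6 : q * d = q * E + (q * √x) * w + q ^ 2 / x := by rw [hd]; ring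
  have h7 : (q * √x) * w ≤ (q ^ 2 + x) * w := by
    refine mul_le_mul_of_nonneg_right ?_ hw
    nlinarith [sq_nonneg (q - √x), mul_nonneg (by linarith : 0 ≤ q) hs0]
  nlinarith [mul_nonneg (sq_nonneg q) hw]

lemma exists_pointwise_comparison (hRH : RiemannHypothesis) : ∃ C > 0, ∀ x T t : ℝ, 1 < x → 0 ≤ T →
    |‖zeroSumTrunc x T t‖ ^ 2 - (Set.Icc 0 T).indicator (fun t => ‖dirSum x t‖ ^ 2 / x) t| ≤
      C * ((((2 + T) ^ (1 / 10 : ℝ)) ^ 3 + x) * (decay t + decay (t - T)) +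
        (Set.Icc 0 T).indicator (fun _ => ((2 + T) ^ (1 / 10 : ℝ)) ^ 2 / x) t) := by
  obtain ⟨C₁, hC₁, h₁⟩ := exists_zeroSumTrunc_bound hRH
  obtain ⟨C₂, hC₂, h₂⟩ := exists_zeroSum_bound hRH
  refine ⟨18 * (C₁ + C₂) ^ 2, by positivity, fun x T t hx hT => ?_⟩
  obtain ⟨ha, hin, hout⟩ := h₁ x T t hT
  have hq : 1 ≤ (2 + T) ^ (1 / 10 : ℝ) := Real.one_le_rpow (by linarith) (by norm_num)
  have hE := tailErr_nonneg T t
  have hE2 := tailErr_sq_le t hT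
  have d1 := decay_pos t
  have d2 := decay_pos (t - T)
  set q := (2 + T) ^ (1 / 10 : ℝ) with hqd
  have hq3 : q ^ 2 ≤ q ^ 3 := pow_le_pow_right₀ hq (by norm_num)
  by_cases ht : t ∈ Set.Icc 0 T
  · rw [Set.indicator_of_mem ht, Set.indicator_of_mem ht]
    obtain ⟨e1, e2⟩ := tailErr_le ht
    have hb : ‖dirSum x t‖ ^ 2 / x = (1 / √x * ‖dirSum x t‖) ^ 2 := by
      rw [mul_pow, div_pow, Real.sq_sqrt (by linarith)]; ring
    have hp : (1 + |t|) ^ (1 / 10 : ℝ) ≤ q :=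
      Real.rpow_le_rpow (by positivity) (by rw [abs_of_nonneg ht.1]; linarith [ht.2]) (by norm_num)
    have hp2 : (2 + |t|) ^ (1 / 10 : ℝ) ≤ q :=
      Real.rpow_le_rpow (by positivity) (by rw [abs_of_nonneg ht.1]; linarith [ht.2]) (by norm_num)
    have hn : ‖Complex.exp (Complex.I * t * Real.log x) * ((1 / √x : ℝ) * dirSum x t)‖ =
        1 / √x * ‖dirSum x t‖ := by
      rw [norm_mul, show Complex.I * t * Real.log x = ((t * Real.log x : ℝ) : ℂ) * Complex.I by
        push_cast; ring, Complex.norm_exp_ofReal_mul_I, one_mul, norm_mul, Complex.norm_real,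
        Real.norm_of_nonneg (by positivity)]
    have hab : |‖zeroSumTrunc x T t‖ - 1 / √x * ‖dirSum x t‖| ≤
        (C₁ + C₂) * (tailErr T t + √x * (1 / (1 + t ^ 2)) + q / x) := by
      have g1 := hin ht
      have g2 := h₂ x t hx
      have g3 := abs_norm_sub_norm_le (zeroSumTrunc x T t)
        (-(Complex.exp (Complex.I * t * Real.log x) * ((1 / √x : ℝ) * dirSum x t)))
      rw [norm_neg, hn, sub_neg_eq_add] at g3
      have g4 : ‖zeroSumTrunc x T t +
          Complex.exp (Complex.I * t * Real.log x) * ((1 / √x : ℝ) * dirSum x t)‖ ≤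
          C₁ * tailErr T t + C₂ * (√x / (1 + t ^ 2) + (2 + |t|) ^ (1 / 10 : ℝ) / x) := by
        refine le_trans ?_ (add_le_add g1 g2)
        rw [norm_sub_rev]
        refine le_trans (le_of_eq ?_) (norm_add_le _ _)
        congr 1
        ring
      have g5 : (2 + |t|) ^ (1 / 10 : ℝ) / x ≤ q / x := by gcongr
      have g6 : √x / (1 + t ^ 2) = √x * (1 / (1 + t ^ 2)) := by ring
      have g7 : 0 ≤ √x * (1 / (1 + t ^ 2)) + q / x := by positivity
      rw [g6] at g4
      nlinarith [g3.trans g4, mul_nonneg hC₂.le hE, mul_nonneg hC₁.le g7,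
        mul_le_mul_of_nonneg_left g5 hC₂.le]
    have hw := inv_one_add_sq_le_decay t
    rw [hb]
    refine (sq_sub_sq_bound (norm_nonneg _) (C := C₁ + C₂) (q := q) ?_ hE e1 hx (by positivity)
      (by rw [div_le_one (by positivity)]; nlinarith [sq_nonneg t]) hq (by positivity) hab).trans ?_
    · refine ha.trans ?_
      gcongr
      linarith
    · rw [mul_comm 18, mul_assoc]
      refine mul_le_mul_of_nonneg_left ?_ (by positivity)
      have k1 : q * tailErr T t ≤ q ^ 3 * (decay t + decay (t - T)) := by
        rw [show q ^ 3 = q * q ^ 2 by ring, mul_assoc]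
        gcongr
      have k2 : (q ^ 2 + x) * (1 / (1 + t ^ 2)) ≤ (q ^ 3 + x) * (2 * decay t) := by
        gcongr
      have k3 : 0 ≤ q ^ 2 / x := by positivity
      nlinarith [mul_pos (by positivity : 0 < q ^ 3 + x) d2, mul_pos (by positivity : 0 < q ^ 3 + x) d1,
        mul_pos (by linarith : 0 < x) d1, mul_pos (by linarith : 0 < x) d2]
  · rw [Set.indicator_of_notMem ht, Set.indicator_of_notMem ht, sub_zero, add_zero,
      abs_of_nonneg (sq_nonneg _)]
    have h3 : ‖zeroSumTrunc x T t‖ ^ 2 ≤ C₁ ^ 2 * tailErr T t ^ 2 := by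
      rw [← mul_pow]
      gcongr
      exact hout ht
    have h4 : 2 * q ^ 2 * (decay t + decay (t - T)) ≤ 18 * ((q ^ 3 + x) * (decay t + decay (t - T))) := by
      rw [← mul_assoc]
      refine mul_le_mul_of_nonneg_right ?_ (by positivity)
      nlinarith [sq_nonneg q]
    calc _ ≤ C₁ ^ 2 * (18 * ((q ^ 3 + x) * (decay t + decay (t - T)))) := by
          refine h3.trans ?_
          gcongr
          exact hE2.trans h4
      _ ≤ (C₁ + C₂) ^ 2 * (18 * ((q ^ 3 + x) * (decay t + decay (t - T)))) := by
          gcongr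
          linarith
      _ = _ := by ring

lemma continuous_dirSum {x : ℝ} (hx : 0 < x) : Continuous (dirSum x) := by
  unfold dirSum
  refine continuous_tsum (fun n => by fun_prop) (summable_vonMangoldt_wt hx) fun n t => ?_
  rw [norm_mul, norm_mul, Complex.norm_real, Complex.norm_real,
    Real.norm_of_nonneg ArithmeticFunction.vonMangoldt_nonneg, Real.norm_of_nonneg (wt_nonneg hx n),
    show -Complex.I * t * Real.log n = ((-(t * Real.log n) : ℝ) : ℂ) * Complex.I by
      push_cast; ring, Complex.norm_exp_ofReal_mul_I, mul_one]

lemma norm_dirSum_neg (x t : ℝ) : ‖dirSum x (-t)‖ = ‖dirSum x t‖ := by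
  rw [← RCLike.norm_conj (dirSum x t), dirSum, dirSum, Complex.conj_tsum]
  congr 1
  refine tsum_congr fun n => ?_
  rw [map_mul, map_mul, Complex.conj_ofReal, Complex.conj_ofReal, ← Complex.exp_conj,
    map_mul, map_mul, map_neg, Complex.conj_I, Complex.conj_ofReal, Complex.conj_ofReal]
  push_cast
  ring_nf

/-- The mean square of the Dirichlet side over `[-V, V]`. -/
noncomputable def meanSq (x V : ℝ) : ℝ := ∫ t in (-V)..V, ‖dirSum x t‖ ^ 2

lemma exists_Fpair_sub_meanSq (hRH : RiemannHypothesis) : ∃ C > 0, ∀ x T : ℝ, 1 < x → 0 ≤ T →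
    ‖Fpair x T - ((1 / (4 * π) * (meanSq x T / x) : ℝ) : ℂ)‖ ≤
      C * (x + ((2 + T) ^ (1 / 10 : ℝ)) ^ 3 + ((2 + T) ^ (1 / 10 : ℝ)) ^ 2 * T / x) := by
  obtain ⟨C, hC, h⟩ := exists_pointwise_comparison hRH
  set I := ∫ t, decay t with hI
  have hI0 : 0 ≤ I := integral_nonneg fun t => (decay_pos t).le
  refine ⟨C * (2 * I + 1), by positivity, fun x T hx hT => ?_⟩
  have hx0 : 0 < x := by linarith
  set q := (2 + T) ^ (1 / 10 : ℝ) with hqd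
  have hq0 : 0 < q := by positivity
  obtain ⟨i1, e1⟩ := integral_zeroSumTrunc hx0 T
  have hc : Continuous fun t => ‖dirSum x t‖ ^ 2 := (continuous_dirSum hx0).norm.pow 2
  have i2 : Integrable ((Set.Icc 0 T).indicator fun t => ‖dirSum x t‖ ^ 2 / x) := by
    rw [integrable_indicator_iff measurableSet_Icc]
    exact (hc.div_const x).continuousOn.integrableOn_compact isCompact_Icc
  have i3 : Integrable ((Set.Icc 0 T).indicator fun _ : ℝ => q ^ 2 / x) := by
    rw [integrable_indicator_iff measurableSet_Icc]
    exact continuous_const.continuousOn.integrableOn_compact isCompact_Icc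
  have e2 : ∫ t, (Set.Icc 0 T).indicator (fun t => ‖dirSum x t‖ ^ 2 / x) t = meanSq x T / x / 2 := by
    rw [integral_indicator measurableSet_Icc, integral_Icc_eq_integral_Ioc,
      ← intervalIntegral.integral_of_le hT, intervalIntegral.integral_div, meanSq,
      ← intervalIntegral.integral_add_adjacent_intervals (a := -T) (b := 0)
        (hc.intervalIntegrable _ _) (hc.intervalIntegrable _ _)]
    have : ∫ t in (-T)..0, ‖dirSum x t‖ ^ 2 = ∫ t in (0)..T, ‖dirSum x t‖ ^ 2 := by
      have := intervalIntegral.integral_comp_neg (a := 0) (b := T) (fun t => ‖dirSum x t‖ ^ 2)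
      rw [neg_zero] at this
      rw [← this]
      simp_rw [norm_dirSum_neg]
    rw [this]
    ring
  have i4 : Integrable fun t => C * ((q ^ 3 + x) * (decay t + decay (t - T)) +
        (Set.Icc 0 T).indicator (fun _ => q ^ 2 / x) t) :=
    ((((integrable_decay.add (integrable_decay.comp_sub_right T)).const_mul _).add i3).const_mul C)
  have e4 : ∫ t, C * ((q ^ 3 + x) * (decay t + decay (t - T)) +
        (Set.Icc 0 T).indicator (fun _ => q ^ 2 / x) t) =
        C * ((q ^ 3 + x) * (2 * I) + T * (q ^ 2 / x)) := by
    have i5 : Integrable fun t => (q ^ 3 + x) * (decay t + decay (t - T)) :=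
      (integrable_decay.add (integrable_decay.comp_sub_right T)).const_mul _
    rw [integral_const_mul, integral_add i5 i3, integral_const_mul, integral_add integrable_decay (integrable_decay.comp_sub_right T),
      integral_sub_right_eq_self (μ := volume) decay T, integral_indicator measurableSet_Icc,
      setIntegral_const, ← hI]
    simp [hT]
    left; left; ring
  have h5 : |(∫ t, ‖zeroSumTrunc x T t‖ ^ 2) - meanSq x T / x / 2| ≤
      C * ((q ^ 3 + x) * (2 * I) + T * (q ^ 2 / x)) := by
    rw [← e2, ← integral_sub i1 i2, ← e4]
    refine abs_integral_le_integral_abs.trans (integral_mono (i1.sub i2).abs i4 fun t => ?_)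
    exact h x T t hx hT
  have h6 : Fpair x T = ((1 / (2 * π) * ∫ t, ‖zeroSumTrunc x T t‖ ^ 2 : ℝ) : ℂ) := by
    push_cast
    rw [e1]
    field_simp
  rw [h6, ← Complex.ofReal_sub, Complex.norm_real, Real.norm_eq_abs,
    show 1 / (2 * π) * (∫ t, ‖zeroSumTrunc x T t‖ ^ 2) - 1 / (4 * π) * (meanSq x T / x) =
      1 / (2 * π) * ((∫ t, ‖zeroSumTrunc x T t‖ ^ 2) - meanSq x T / x / 2) by field_simp; ring,
    abs_mul, abs_of_pos (by positivity)]
  have h7 : 1 / (2 * π) ≤ 1 := by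
    rw [div_le_one (by positivity)]; linarith [Real.pi_gt_three]
  have h8 : 0 ≤ T * (q ^ 2 / x) := by positivity
  calc _ ≤ 1 * (C * ((q ^ 3 + x) * (2 * I) + T * (q ^ 2 / x))) := by gcongr
    _ ≤ C * ((2 * I + 1) * (x + q ^ 3 + q ^ 2 * T / x)) := by
        rw [one_mul, show q ^ 2 * T / x = T * (q ^ 2 / x) by ring]
        gcongr
        nlinarith [mul_nonneg hI0 h8, pow_pos hq0 3]
    _ = _ := by ring

/-! ### The mean square under the twin prime conjecture -/

/-- The kernel `∫_{-v}^v cos (t l) dt`. -/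
noncomputable def dirichletKer (v l : ℝ) : ℝ := 2 * v * Real.sinc (v * l)

/-- The kernel `∫_0^V ∫_{-v}^v cos (t l) dt dv`. -/
noncomputable def fejerKer (V l : ℝ) : ℝ := ∫ v in (0)..V, dirichletKer v l

lemma mul_dirichletKer (v l : ℝ) : l * dirichletKer v l = 2 * Real.sin (v * l) := by
  rcases eq_or_ne (v * l) 0 with h | h
  · rw [dirichletKer, h]
    simp only [Real.sin_zero, Real.sinc_zero]
    linear_combination 2 * h
  · rw [dirichletKer, Real.sinc_of_ne_zero h]
    have h1 := left_ne_zero_of_mul h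
    have h2 := right_ne_zero_of_mul h
    field_simp

lemma integral_cos_mul (v l : ℝ) : ∫ t in (-v)..v, Real.cos (t * l) = dirichletKer v l := by
  rcases eq_or_ne l 0 with rfl | hl
  · simp [dirichletKer]; ring
  · have h := intervalIntegral.integral_comp_mul_right (a := -v) (b := v) Real.cos hl
    rw [h, integral_cos, neg_mul, Real.sin_neg, smul_eq_mul]
    apply mul_left_cancel₀ hl
    rw [mul_dirichletKer]
    field_simp
    ring

lemma continuous_dirichletKer (l : ℝ) : Continuous fun v => dirichletKer v l := by
  unfold dirichletKer
  exact (by fun_prop : Continuous fun v : ℝ => 2 * v).mul (Real.continuous_sinc.comp (by fun_prop))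

lemma abs_dirichletKer_le {v : ℝ} (hv : 0 ≤ v) (l : ℝ) : |dirichletKer v l| ≤ 2 * v := by
  rw [dirichletKer, abs_mul, abs_of_nonneg (by positivity : 0 ≤ 2 * v)]
  exact mul_le_of_le_one_right (by positivity) (abs_le.mpr ⟨Real.neg_one_le_sinc _, Real.sinc_le_one _⟩)

lemma abs_dirichletKer_sub_le {v : ℝ} (hv : 0 ≤ v) (l l' : ℝ) :
    |dirichletKer v l - dirichletKer v l'| ≤ 2 * v ^ 2 * |l - l'| := by
  rw [← integral_cos_mul, ← integral_cos_mul, ← intervalIntegral.integral_sub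
    (Continuous.intervalIntegrable (by fun_prop) _ _) (Continuous.intervalIntegrable (by fun_prop) _ _)]
  have := intervalIntegral.norm_integral_le_of_norm_le_const (a := -v) (b := v)
    (f := fun t => Real.cos (t * l) - Real.cos (t * l')) (C := v * |l - l'|) ?_
  · rw [Real.norm_eq_abs] at this
    refine this.trans (le_of_eq ?_)
    rw [abs_of_nonneg (by linarith : 0 ≤ v - -v)]
    ring
  · intro t ht
    rw [Set.uIoc_of_le (by linarith)] at ht
    rw [Real.norm_eq_abs]
    refine (Real.abs_cos_sub_cos_le _ _).trans ?_
    rw [← mul_sub, abs_mul]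
    gcongr
    exact abs_le.mpr ⟨ht.1.le, ht.2⟩

lemma fejerKer_zero (V : ℝ) : fejerKer V 0 = V ^ 2 := by
  simp only [fejerKer, dirichletKer, mul_zero, Real.sinc_zero, mul_one]
  rw [intervalIntegral.integral_const_mul, integral_id]
  ring

lemma fejerKer_neg (V l : ℝ) : fejerKer V (-l) = fejerKer V l := by
  simp only [fejerKer, dirichletKer, mul_neg, Real.sinc_neg]

lemma abs_fejerKer_le {V : ℝ} (hV : 0 ≤ V) (l : ℝ) : |fejerKer V l| ≤ V ^ 2 := by
  rw [← fejerKer_zero V, fejerKer, fejerKer, ← Real.norm_eq_abs]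
  refine intervalIntegral.norm_integral_le_of_norm_le hV
    (Filter.Eventually.of_forall fun v hv => ?_) ((continuous_dirichletKer 0).intervalIntegrable _ _)
  refine (abs_dirichletKer_le hv.1.le l).trans (le_of_eq ?_)
  simp [dirichletKer]

lemma sq_mul_fejerKer (V l : ℝ) : l ^ 2 * fejerKer V l = 2 * (1 - Real.cos (V * l)) := by
  rcases eq_or_ne l 0 with rfl | hl
  · simp
  · rw [sq, mul_assoc, fejerKer, ← intervalIntegral.integral_const_mul]
    simp_rw [mul_dirichletKer]
    rw [intervalIntegral.integral_const_mul,
      intervalIntegral.integral_comp_mul_right (fun x => Real.sin x) hl, integral_sin]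
    simp
    field_simp

lemma abs_fejerKer_le_rpow {V l : ℝ} (hV : 0 ≤ V) (hl : 0 < l) :
    |fejerKer V l| ≤ 4 * V ^ (1 / 2 : ℝ) * l ^ (-(3 / 2) : ℝ) := by
  have h1 := abs_fejerKer_le hV l
  have h2 : |fejerKer V l| ≤ 4 * l ^ (-2 : ℝ) := by
    rw [Real.rpow_neg hl.le, ← div_eq_mul_inv, le_div_iff₀ (by positivity), Real.rpow_two,
      mul_comm, ← abs_of_nonneg (sq_nonneg l), ← abs_mul,
      sq_mul_fejerKer, abs_le]
    constructor <;> linarith [Real.neg_one_le_cos (V * l), Real.cos_le_one (V * l)]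
  have h0 := abs_nonneg (fejerKer V l)
  calc |fejerKer V l| = |fejerKer V l| ^ (1 / 4 : ℝ) * |fejerKer V l| ^ (3 / 4 : ℝ) := by
        rw [← Real.rpow_add' h0 (by norm_num)]; norm_num
    _ ≤ (V ^ 2) ^ (1 / 4 : ℝ) * (4 * l ^ (-2 : ℝ)) ^ (3 / 4 : ℝ) := by gcongr
    _ = V ^ (1 / 2 : ℝ) * (4 ^ (3 / 4 : ℝ) * l ^ (-(3 / 2) : ℝ)) := by
        rw [← Real.rpow_natCast V 2, ← Real.rpow_mul hV, Real.mul_rpow (by norm_num) (by positivity),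
          ← Real.rpow_mul hl.le]
        norm_num
    _ ≤ V ^ (1 / 2 : ℝ) * (4 ^ (1 : ℝ) * l ^ (-(3 / 2) : ℝ)) := by
        gcongr <;> norm_num
    _ = _ := by rw [Real.rpow_one]; ring

lemma abs_fejerKer_sub_le {V : ℝ} (hV : 0 ≤ V) (l l' : ℝ) :
    |fejerKer V l - fejerKer V l'| ≤ 2 * V ^ 3 * |l - l'| := by
  rw [fejerKer, fejerKer, ← intervalIntegral.integral_sub
    ((continuous_dirichletKer l).intervalIntegrable _ _)
    ((continuous_dirichletKer l').intervalIntegrable _ _), ← Real.norm_eq_abs]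
  have := intervalIntegral.norm_integral_le_of_norm_le_const (a := 0) (b := V)
    (f := fun v => dirichletKer v l - dirichletKer v l') (C := 2 * V ^ 2 * |l - l'|) ?_
  · refine this.trans (le_of_eq ?_)
    rw [sub_zero, abs_of_nonneg hV]
    ring
  · intro v hv
    rw [Set.uIoc_of_le hV] at hv
    refine (abs_dirichletKer_sub_le hv.1.le l l').trans ?_
    gcongr
    · exact hv.1.le
    · exact hv.2

lemma fejerKer_sub (V W l : ℝ) : fejerKer W l - fejerKer V l = ∫ v in V..W, dirichletKer v l :=
  intervalIntegral.integral_interval_sub_left ((continuous_dirichletKer l).intervalIntegrable _ _)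
    ((continuous_dirichletKer l).intervalIntegrable _ _)

/-- The coefficients of the smoothed Dirichlet series. -/
noncomputable def coef (x : ℝ) (n : ℕ) : ℝ := ArithmeticFunction.vonMangoldt n * wt x n

lemma coef_nonneg {x : ℝ} (hx : 0 < x) (n : ℕ) : 0 ≤ coef x n :=
  mul_nonneg ArithmeticFunction.vonMangoldt_nonneg (wt_nonneg hx n)

lemma summable_coef {x : ℝ} (hx : 0 < x) : Summable (coef x) := summable_vonMangoldt_wt hx

lemma summable_coef_mul {x : ℝ} (hx : 0 < x) :
    Summable fun p : ℕ × ℕ => coef x p.1 * coef x p.2 :=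
  (summable_coef hx).mul_of_nonneg (summable_coef hx) (coef_nonneg hx) (coef_nonneg hx)

lemma hasSum_norm_dirSum_sq {x : ℝ} (hx : 0 < x) (t : ℝ) :
    HasSum (fun p : ℕ × ℕ => coef x p.1 * coef x p.2 *
      Real.cos (t * (Real.log p.1 - Real.log p.2))) (‖dirSum x t‖ ^ 2) := by
  obtain ⟨z, hz⟩ : ∃ z : ℕ → ℂ, z = fun n : ℕ => (coef x n : ℂ) *
    Complex.exp ((-(t * Real.log n) : ℝ) * Complex.I) := ⟨_, rfl⟩
  have hD : dirSum x t = ∑' n, z n := by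
    refine tsum_congr fun n => ?_
    simp only [hz, coef]
    rw [show ((-(t * Real.log n) : ℝ) : ℂ) * Complex.I = -Complex.I * t * Real.log n by
      push_cast; ring]
    push_cast
    ring
  have hn : ∀ n : ℕ, ‖z n‖ = coef x n := fun n => by
    rw [hz, norm_mul, Complex.norm_real, Real.norm_of_nonneg (coef_nonneg hx n),
      Complex.norm_exp_ofReal_mul_I, mul_one]
  have hsn : Summable fun n => ‖z n‖ := by simp_rw [hn]; exact summable_coef hx
  have h1 := hsn.of_norm.hasSum
  have h2 : HasSum (fun n => (starRingEnd ℂ) (z n)) ((starRingEnd ℂ) (∑' n, z n)) :=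
    Complex.hasSum_conj'.mpr (by simpa using h1)
  obtain ⟨w, hw⟩ : ∃ w : ℕ → ℂ, w = fun n => (starRingEnd ℂ) (z n) := ⟨_, rfl⟩
  rw [← hw] at h2
  have hwn : Summable fun n => ‖w n‖ := by simpa [hw] using hsn
  have h3 := h1.mul h2 (summable_mul_of_summable_norm hsn hwn)
  have h4 := Complex.hasSum_re h3
  rw [← hD, Complex.mul_conj', ← Complex.ofReal_pow, Complex.ofReal_re] at h4
  refine h4.congr_fun fun p => ?_
  have h6 : z p.1 * w p.2 = ((coef x p.1 * coef x p.2 : ℝ) : ℂ) *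
      Complex.exp ((-(t * (Real.log p.1 - Real.log p.2)) : ℝ) * Complex.I) := by
    simp only [hw, hz]
    rw [map_mul, Complex.conj_ofReal, ← Complex.exp_conj, map_mul, Complex.conj_I,
      Complex.conj_ofReal, show ((-(t * (Real.log p.1 - Real.log p.2)) : ℝ) : ℂ) * Complex.I =
        ((-(t * Real.log p.1) : ℝ) : ℂ) * Complex.I + ((-(t * Real.log p.2) : ℝ) : ℂ) * -Complex.I by
          push_cast; ring, Complex.exp_add]
    push_cast
    ring
  rw [h6, Complex.re_ofReal_mul, Complex.exp_ofReal_mul_I_re, Real.cos_neg]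

lemma hasSum_meanSq {x : ℝ} (hx : 0 < x) (v : ℝ) :
    HasSum (fun p : ℕ × ℕ => coef x p.1 * coef x p.2 *
      dirichletKer v (Real.log p.1 - Real.log p.2)) (meanSq x v) := by
  have h := intervalIntegral.hasSum_integral_of_dominated_convergence (μ := volume) (a := -v) (b := v)
    (F := fun (p : ℕ × ℕ) t => coef x p.1 * coef x p.2 *
      Real.cos (t * (Real.log p.1 - Real.log p.2))) (f := fun t => ‖dirSum x t‖ ^ 2)
    (fun p _ => coef x p.1 * coef x p.2)
    (fun p => Continuous.aestronglyMeasurable (by fun_prop))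
    (fun p => Filter.Eventually.of_forall fun t _ => ?_)
    (Filter.Eventually.of_forall fun t _ => summable_coef_mul hx) (by simp)
    (Filter.Eventually.of_forall fun t _ => hasSum_norm_dirSum_sq hx t)
  · refine h.congr_fun fun p => ?_
    rw [intervalIntegral.integral_const_mul, integral_cos_mul]
  · have hc := mul_nonneg (coef_nonneg hx p.1) (coef_nonneg hx p.2)
    rw [norm_mul, Real.norm_of_nonneg hc]
    exact mul_le_of_le_one_right hc (Real.abs_cos_le_one _)

lemma hasSum_integral_meanSq {x : ℝ} (hx : 0 < x) {V : ℝ} (hV : 0 ≤ V) :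
    HasSum (fun p : ℕ × ℕ => coef x p.1 * coef x p.2 *
      fejerKer V (Real.log p.1 - Real.log p.2)) (∫ v in (0)..V, meanSq x v) := by
  have h := intervalIntegral.hasSum_integral_of_dominated_convergence (μ := volume) (a := 0) (b := V)
    (F := fun (p : ℕ × ℕ) v => coef x p.1 * coef x p.2 *
      dirichletKer v (Real.log p.1 - Real.log p.2)) (f := meanSq x)
    (fun p _ => coef x p.1 * coef x p.2 * (2 * V))
    (fun p => ((continuous_dirichletKer _).const_mul _).aestronglyMeasurable)
    (fun p => Filter.Eventually.of_forall fun v hv => ?_)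
    (Filter.Eventually.of_forall fun t _ => (summable_coef_mul hx).mul_right _) (by simp)
    (Filter.Eventually.of_forall fun t _ => hasSum_meanSq hx t)
  · refine h.congr_fun fun p => ?_
    rw [intervalIntegral.integral_const_mul, fejerKer]
  · have hc := mul_nonneg (coef_nonneg hx p.1) (coef_nonneg hx p.2)
    rw [Set.uIoc_of_le hV] at hv
    rw [norm_mul, Real.norm_of_nonneg hc]
    refine mul_le_mul_of_nonneg_left ((abs_dirichletKer_le hv.1.le _).trans ?_) hc
    linarith [hv.2]

/-- Splitting a symmetric double series into its diagonal and off-diagonal parts. -/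
lemma hasSum_diag_offDiag {f : ℕ × ℕ → ℝ} (hf : Summable f) (hs : ∀ m n, f (m, n) = f (n, m)) :
    Summable (fun p : ℕ × ℕ => f (p.1, p.1 + p.2 + 1)) ∧
    ∑' p, f p = ∑' n, f (n, n) + 2 * ∑' p : ℕ × ℕ, f (p.1, p.1 + p.2 + 1) := by
  have i1 : Function.Injective fun n : ℕ => (n, n) := fun a b h => (Prod.mk.inj h).1
  have i2 : Function.Injective fun p : ℕ × ℕ => (p.1, p.1 + p.2 + 1) := by
    rintro ⟨a, b⟩ ⟨c, d⟩ h
    simp only [Prod.mk.injEq] at h ⊢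
    omega
  have i3 : Function.Injective fun p : ℕ × ℕ => (p.1 + p.2 + 1, p.1) := by
    rintro ⟨a, b⟩ ⟨c, d⟩ h
    simp only [Prod.mk.injEq] at h ⊢
    omega
  refine ⟨hf.comp_injective i2, ?_⟩
  have e1 : ∑' n, f (n, n) = ∑' p, {p : ℕ × ℕ | p.1 = p.2}.indicator f p := by
    rw [← i1.tsum_eq (f := {p : ℕ × ℕ | p.1 = p.2}.indicator f)]
    · exact tsum_congr fun n => (Set.indicator_of_mem (by simp) f).symm
    · rintro ⟨a, b⟩ h
      have h' : a = b := Set.mem_of_indicator_ne_zero (f := f) h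
      exact ⟨a, by simp [h']⟩
  have e2 : ∑' p : ℕ × ℕ, f (p.1, p.1 + p.2 + 1) =
      ∑' p, {p : ℕ × ℕ | p.1 < p.2}.indicator f p := by
    rw [← i2.tsum_eq (f := {p : ℕ × ℕ | p.1 < p.2}.indicator f)]
    · refine tsum_congr fun n => (Set.indicator_of_mem ?_ f).symm
      change n.1 < n.1 + n.2 + 1
      omega
    · rintro ⟨a, b⟩ h
      have h' : a < b := Set.mem_of_indicator_ne_zero (f := f) h
      exact ⟨(a, b - a - 1), Prod.ext rfl (by change a + (b - a - 1) + 1 = b; omega)⟩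
  have e3 : ∑' p : ℕ × ℕ, f (p.1, p.1 + p.2 + 1) =
      ∑' p, {p : ℕ × ℕ | p.2 < p.1}.indicator f p := by
    rw [← i3.tsum_eq (f := {p : ℕ × ℕ | p.2 < p.1}.indicator f)]
    · refine tsum_congr fun n => ?_
      rw [Set.indicator_of_mem, hs]
      change n.1 < n.1 + n.2 + 1
      omega
    · rintro ⟨a, b⟩ h
      have h' : b < a := Set.mem_of_indicator_ne_zero (f := f) h
      exact ⟨(b, a - b - 1), Prod.ext (by change b + (a - b - 1) + 1 = a; omega) rfl⟩
  rw [two_mul, e1]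
  nth_rewrite 1 [e2]
  rw [e3, ← (hf.indicator _).tsum_add (hf.indicator _), ← (hf.indicator _).tsum_add
    ((hf.indicator _).add (hf.indicator _))]
  refine tsum_congr fun p => ?_
  rcases lt_trichotomy p.1 p.2 with h | h | h
  · simp [Set.indicator, h, h.ne, h.le]
  · simp [Set.indicator, h]
  · simp [Set.indicator, h, h.ne', h.le]

lemma wt_zero {x : ℝ} (hx : 0 < x) : wt x 0 = 0 := by
  simp [wt, hx.le]

lemma wt_eq_min {x : ℝ} (hx : 0 < x) {n : ℕ} (hn : 0 < n) :
    wt x n = min ((n / x : ℝ) ^ (1 / 2 : ℝ)) ((x / n : ℝ) ^ (3 / 2 : ℝ)) := by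
  have hn' : (0 : ℝ) < n := by exact_mod_cast hn
  unfold wt
  split_ifs with h
  · rw [min_eq_left]
    have h1 : (n / x : ℝ) ^ (1 / 2 : ℝ) ≤ 1 :=
      Real.rpow_le_one (by positivity) ((div_le_one hx).mpr h) (by norm_num)
    have h2 : 1 ≤ (x / n : ℝ) ^ (3 / 2 : ℝ) :=
      Real.one_le_rpow ((one_le_div hn').mpr h) (by norm_num)
    linarith
  · push Not at h
    rw [min_eq_right]
    have h1 : 1 ≤ (n / x : ℝ) ^ (1 / 2 : ℝ) :=
      Real.one_le_rpow ((one_le_div hx).mpr h.le) (by norm_num)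
    have h2 : (x / n : ℝ) ^ (3 / 2 : ℝ) ≤ 1 :=
      Real.rpow_le_one (by positivity) ((div_le_one hn').mpr h.le) (by norm_num)
    linarith

lemma wt_pos {x : ℝ} (hx : 0 < x) {n : ℕ} (hn : 0 < n) : 0 < wt x n := by
  have hn' : (0 : ℝ) < n := by exact_mod_cast hn
  rw [wt_eq_min hx hn]
  positivity

lemma wt_le_rpow {x : ℝ} (hx : 0 < x) {n : ℕ} (hn : 0 < n) {k : ℝ} (h1 : -(1 / 2) ≤ k)
    (h2 : k ≤ 3 / 2) : wt x n ≤ (x / n : ℝ) ^ k := by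
  have hn' : (0 : ℝ) < n := by exact_mod_cast hn
  unfold wt
  split_ifs with h
  · rw [← inv_div, Real.inv_rpow (by positivity), ← Real.rpow_neg (by positivity)]
    exact Real.rpow_le_rpow_of_exponent_le ((one_le_div hn').mpr h) h1
  · push Not at h
    exact Real.rpow_le_rpow_of_exponent_ge (by positivity) ((div_le_one hn').mpr h.le) h2

lemma wt_sq_le_rpow {x : ℝ} (hx : 0 < x) {n : ℕ} (hn : 0 < n) {k : ℝ} (h1 : -1 ≤ k)
    (h2 : k ≤ 3) : wt x n ^ 2 ≤ (x / n : ℝ) ^ k := by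
  have h := wt_le_rpow hx hn (k := k / 2) (by linarith) (by linarith)
  calc wt x n ^ 2 ≤ ((x / n : ℝ) ^ (k / 2)) ^ 2 := by
        have := wt_nonneg hx n
        gcongr
    _ = _ := by
        rw [← Real.rpow_natCast, ← Real.rpow_mul (by positivity)]
        norm_num

/-- A power of `n` against the squared weight gains the corresponding power of `x`. -/
lemma wt_sq_mul_rpow_le {x : ℝ} (hx : 0 < x) {n : ℕ} (hn : 0 < n) {s d : ℝ} (h1 : -2 ≤ d - s)
    (h2 : d - s ≤ 2) :
    wt x n ^ 2 * (n : ℝ) ^ (-s) ≤ x ^ (1 + d - s) * (n : ℝ) ^ (-(1 + d)) := by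
  have hn' : (0 : ℝ) < n := by exact_mod_cast hn
  calc wt x n ^ 2 * (n : ℝ) ^ (-s) ≤ (x / n : ℝ) ^ (1 + d - s) * (n : ℝ) ^ (-s) := by
        gcongr
        exact wt_sq_le_rpow hx hn (by linarith) (by linarith)
    _ = _ := by
        rw [Real.div_rpow hx.le hn'.le, div_eq_mul_inv, ← Real.rpow_neg hn'.le, mul_assoc,
          ← Real.rpow_add hn']
        congr 2
        ring

lemma wt_add_bounds {x : ℝ} (hx : 0 < x) {n : ℕ} (hn : 0 < n) (h : ℕ) :
    |wt x (n + h) - wt x n| ≤ 3 / 2 * (h / n) * wt x n := by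
  have hn' : (0 : ℝ) < n := by exact_mod_cast hn
  have hh : (0 : ℝ) ≤ h := Nat.cast_nonneg h
  have hw := wt_pos hx hn
  set r : ℝ := (n + h) / n with hr
  have hr1 : r = 1 + h / n := by rw [hr]; field_simp
  have hrpos : 0 < r := by positivity
  have hr1' : 1 ≤ r := by rw [hr1]; linarith [div_nonneg hh hn'.le]
  have e1 : (((n + h : ℕ) : ℝ) / x) = r * (n / x) := by rw [hr]; push_cast; field_simp
  have e2 : (x / ((n + h : ℕ) : ℝ)) = r⁻¹ * (x / n) := by rw [hr]; push_cast; field_simp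
  have hadd := wt_eq_min hx (Nat.add_pos_left hn h)
  rw [e1, e2, Real.mul_rpow hrpos.le (by positivity), Real.mul_rpow (by positivity) (by positivity)] at hadd
  have hwn := wt_eq_min hx hn
  have hA : 0 < (n / x : ℝ) ^ (1 / 2 : ℝ) := by positivity
  have hB : 0 < (x / n : ℝ) ^ (3 / 2 : ℝ) := by positivity
  have hp1 : 1 ≤ r ^ (1 / 2 : ℝ) := Real.one_le_rpow hr1' (by norm_num)
  have hp2 : r⁻¹ ^ (3 / 2 : ℝ) ≤ 1 :=
    Real.rpow_le_one (by positivity) (inv_le_one_of_one_le₀ hr1') (by norm_num)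
  have hp2' : 0 < r⁻¹ ^ (3 / 2 : ℝ) := by positivity
  have up : wt x (n + h) ≤ r ^ (1 / 2 : ℝ) * wt x n := by
    rw [hadd, hwn, mul_min_of_nonneg _ _ (by positivity)]
    refine min_le_min le_rfl ?_
    nlinarith
  have lo : r⁻¹ ^ (3 / 2 : ℝ) * wt x n ≤ wt x (n + h) := by
    rw [hadd, hwn, mul_min_of_nonneg _ _ (by positivity)]
    refine min_le_min ?_ le_rfl
    nlinarith
  have b1 : r ^ (1 / 2 : ℝ) ≤ 1 + 3 / 2 * (h / n) := by
    have : r ^ (1 / 2 : ℝ) ≤ r ^ (1 : ℝ) := Real.rpow_le_rpow_of_exponent_le hr1' (by norm_num)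
    rw [Real.rpow_one] at this
    have h0 : (0 : ℝ) ≤ h / n := by positivity
    linarith
  have b2 : 1 - 3 / 2 * (h / n) ≤ r⁻¹ ^ (3 / 2 : ℝ) := by
    have h3 := one_add_mul_self_le_rpow_one_add (s := r⁻¹ - 1) (by linarith [inv_pos.mpr hrpos])
      (p := 3 / 2) (by norm_num)
    rw [add_sub_cancel] at h3
    have h4 : 1 - h / n ≤ r⁻¹ := by
      have h0 : (0 : ℝ) ≤ h / n := by positivity
      rw [← one_div, le_div_iff₀ hrpos]
      nlinarith
    linarith
  rw [abs_le]
  constructor <;> nlinarith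

lemma abs_wt_sq_succ_sub_le {x : ℝ} (hx : 0 < x) {n : ℕ} (hn : 0 < n) :
    |wt x (n + 1) ^ 2 - wt x n ^ 2| ≤ 6 * wt x n ^ 2 / n ∧ wt x (n + 1) ^ 2 ≤ 7 * wt x n ^ 2 := by
  have hn' : (1 : ℝ) ≤ n := by exact_mod_cast hn
  have h := wt_add_bounds hx hn 1
  have hw := wt_pos hx hn
  have hw' := wt_pos hx (Nat.add_pos_left hn 1)
  rw [Nat.cast_one] at h
  have h1 : (1 : ℝ) / n ≤ 1 := by rw [div_le_one (by linarith)]; exact hn'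
  have h2 : wt x (n + 1) ≤ 5 / 2 * wt x n := by
    have := (abs_le.mp h).2
    nlinarith
  constructor
  · rw [sq_sub_sq, abs_mul, abs_of_pos (by positivity)]
    calc _ ≤ (5 / 2 * wt x n + wt x n) * (3 / 2 * (1 / n) * wt x n) := by gcongr
      _ = 21 / 4 * (wt x n ^ 2 / n) := by ring
      _ ≤ 6 * (wt x n ^ 2 / n) := by gcongr; norm_num
      _ = _ := by ring
  · nlinarith

lemma wt_sq_mul_cube {x : ℝ} (hx : 0 < x) (n : ℕ) :
    wt x n ^ 2 * (n : ℝ) ^ 3 = min ((n : ℝ) ^ 4 / x) (x ^ 3) := by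
  rcases Nat.eq_zero_or_pos n with rfl | hn
  · simp [hx.le]
  have hn' : (0 : ℝ) < n := by exact_mod_cast hn
  unfold wt
  split_ifs with h
  · rw [min_eq_left, ← Real.rpow_natCast _ 2, ← Real.rpow_mul (by positivity)]
    · norm_num
      field_simp
    · rw [div_le_iff₀ hx, ← pow_succ]
      gcongr
  · push Not at h
    rw [min_eq_right, ← Real.rpow_natCast _ 2, ← Real.rpow_mul (by positivity)]
    · norm_num
      field_simp
    · rw [le_div_iff₀ hx, ← pow_succ]
      gcongr

lemma monotone_wt_sq_mul_cube {x : ℝ} (hx : 0 < x) :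
    Monotone fun n : ℕ => wt x n ^ 2 * (n : ℝ) ^ 3 := by
  intro m n h
  simp only [wt_sq_mul_cube hx]
  gcongr

lemma exists_sum_rpow_le {d : ℝ} (hd : 0 < d) : ∃ C > 0, ∀ N : ℕ,
    ∑ n ∈ Finset.range N, (n : ℝ) ^ (-(1 + d)) ≤ C := by
  have hs : Summable fun n : ℕ => (n : ℝ) ^ (-(1 + d)) := Real.summable_nat_rpow.mpr (by linarith)
  refine ⟨∑' n : ℕ, (n : ℝ) ^ (-(1 + d)) + 1, ?_, fun N => ?_⟩
  · have : 0 ≤ ∑' n : ℕ, (n : ℝ) ^ (-(1 + d)) := tsum_nonneg fun _ => by positivity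
    linarith
  · linarith [hs.sum_le_tsum (Finset.range N) fun _ _ => by positivity]

lemma vonMangoldt_le_rpow (n : ℕ) :
    ArithmeticFunction.vonMangoldt n ≤ 1000 * (n : ℝ) ^ (1 / 1000 : ℝ) := by
  refine ArithmeticFunction.vonMangoldt_le_log.trans ?_
  have := Real.log_le_rpow_div (x := n) (ε := 1 / 1000) (Nat.cast_nonneg n) (by norm_num)
  linarith

lemma vonMangoldt_mul_le {n h : ℕ} (hn : 0 < n) (hh : 0 < h) :
    ArithmeticFunction.vonMangoldt n * ArithmeticFunction.vonMangoldt (n + h) ≤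
      2000000 * (n : ℝ) ^ (2 / 1000 : ℝ) * (h : ℝ) ^ (1 / 1000 : ℝ) := by
  have hn' : (1 : ℝ) ≤ n := by exact_mod_cast hn
  have hh' : (1 : ℝ) ≤ h := by exact_mod_cast hh
  have h1 := vonMangoldt_le_rpow n
  have h2 := vonMangoldt_le_rpow (n + h)
  have h3 : ((n + h : ℕ) : ℝ) ^ (1 / 1000 : ℝ) ≤
      2 * ((n : ℝ) ^ (1 / 1000 : ℝ) * (h : ℝ) ^ (1 / 1000 : ℝ)) := by
    calc ((n + h : ℕ) : ℝ) ^ (1 / 1000 : ℝ) ≤ (2 * (n * h : ℝ)) ^ (1 / 1000 : ℝ) := by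
          gcongr
          push_cast
          nlinarith
      _ = 2 ^ (1 / 1000 : ℝ) * ((n : ℝ) ^ (1 / 1000 : ℝ) * (h : ℝ) ^ (1 / 1000 : ℝ)) := by
          rw [Real.mul_rpow (by norm_num) (by positivity), Real.mul_rpow (by positivity) (by positivity)]
      _ ≤ 2 ^ (1 : ℝ) * ((n : ℝ) ^ (1 / 1000 : ℝ) * (h : ℝ) ^ (1 / 1000 : ℝ)) := by
          gcongr <;> norm_num
      _ = _ := by rw [Real.rpow_one]
  calc _ ≤ (1000 * (n : ℝ) ^ (1 / 1000 : ℝ)) *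
        (1000 * (2 * ((n : ℝ) ^ (1 / 1000 : ℝ) * (h : ℝ) ^ (1 / 1000 : ℝ)))) := by
        refine mul_le_mul h1 (h2.trans (by gcongr)) ArithmeticFunction.vonMangoldt_nonneg
          (by positivity)
    _ = 2000000 * ((n : ℝ) ^ (1 / 1000 : ℝ) * (n : ℝ) ^ (1 / 1000 : ℝ)) *
        (h : ℝ) ^ (1 / 1000 : ℝ) := by ring
    _ = _ := by rw [← Real.rpow_add (by linarith)]; norm_num

lemma coef_zero (x : ℝ) : coef x 0 = 0 := by simp [coef]

lemma abs_log_sub_log_add_sub_le {n h : ℕ} (hn : 0 < n) :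
    |Real.log (n + h : ℕ) - Real.log n - h / n| ≤ ((h : ℝ) / n) ^ 2 ∧
      (h : ℝ) / (n + h : ℕ) ≤ Real.log (n + h : ℕ) - Real.log n := by
  have hn' : (0 : ℝ) < n := by exact_mod_cast hn
  have hh : (0 : ℝ) ≤ h := Nat.cast_nonneg h
  set u : ℝ := h / n with hu
  have hu0 : 0 ≤ u := by positivity
  have e1 : Real.log (n + h : ℕ) - Real.log n = Real.log (1 + u) := by
    rw [← Real.log_div (by positivity) hn'.ne', hu]
    congr 1
    push_cast
    field_simp
  have h1 : Real.log (1 + u) ≤ u := by linarith [Real.log_le_sub_one_of_pos (x := 1 + u) (by linarith)]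
  have h2 : 1 - (1 + u)⁻¹ ≤ Real.log (1 + u) := Real.one_sub_inv_le_log_of_pos (by linarith)
  have h3 : u - u ^ 2 ≤ 1 - (1 + u)⁻¹ := by
    rw [← one_div, le_sub_iff_add_le, ← le_sub_iff_add_le', div_le_iff₀ (by linarith)]
    nlinarith [pow_nonneg hu0 3]
  rw [e1]
  refine ⟨abs_le.mpr ⟨by linarith, by nlinarith⟩, le_trans (le_of_eq ?_) h2⟩
  rw [hu]
  push_cast
  field_simp
  ring

/-- The trivial bound for a shifted sum, efficient when the shift is large. -/
lemma exists_sum_shift_large_le : ∃ C > 0, ∀ (x V : ℝ) (h N : ℕ), 0 < x → 0 ≤ V → 0 < h →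
    ∑ n ∈ Finset.range N, |coef x n * coef x (n + h) *
      fejerKer V (Real.log (n + h : ℕ) - Real.log n)| ≤
      C * (V ^ (1 / 2 : ℝ) * x ^ (2503 / 1000 : ℝ) * (h : ℝ) ^ (-(1499 / 1000) : ℝ)) := by
  obtain ⟨C, hC, hsum⟩ := exists_sum_rpow_le (d := 1 / 1000) (by norm_num)
  refine ⟨8000000 * C, by positivity, fun x V h N hx hV hh => ?_⟩
  have hh' : (0 : ℝ) < h := by exact_mod_cast hh
  set K := V ^ (1 / 2 : ℝ) * x ^ (2503 / 1000 : ℝ) * (h : ℝ) ^ (-(1499 / 1000) : ℝ) with hK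
  have hK0 : 0 ≤ K := by positivity
  have key : ∀ n ∈ Finset.range N, |coef x n * coef x (n + h) *
      fejerKer V (Real.log (n + h : ℕ) - Real.log n)| ≤
        8000000 * K * (n : ℝ) ^ (-(1 + 1 / 1000) : ℝ) := by
    intro n _
    rcases Nat.eq_zero_or_pos n with rfl | hn
    · rw [coef_zero]; simp only [zero_mul, abs_zero]; positivity
    have hn' : (0 : ℝ) < n := by exact_mod_cast hn
    have hl := (abs_log_sub_log_add_sub_le (h := h) hn).2
    set m : ℝ := ((n + h : ℕ) : ℝ) with hm
    have hm0 : 0 < m := by positivity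
    have hl0 : 0 < (h : ℝ) / m := by positivity
    set l := Real.log m - Real.log n with hldef
    have h1 := abs_fejerKer_le_rpow hV (hl0.trans_le hl)
    have h2 : l ^ (-(3 / 2) : ℝ) ≤ (h / m) ^ (-(3 / 2) : ℝ) :=
      Real.rpow_le_rpow_of_nonpos hl0 hl (by norm_num)
    have h3 := wt_le_rpow hx (Nat.add_pos_left hn h) (k := 3 / 2) (by norm_num) le_rfl
    have h4 := wt_le_rpow hx hn (k := 1003 / 1000) (by norm_num) (by norm_num)
    have h5 := vonMangoldt_mul_le hn hh
    rw [abs_mul, abs_of_nonneg (mul_nonneg (coef_nonneg hx _) (coef_nonneg hx _))]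
    have hw1 := wt_nonneg hx n
    have hw2 := wt_nonneg hx (n + h)
    rw [← hm] at h3
    calc coef x n * coef x (n + h) * |fejerKer V l|
        = (ArithmeticFunction.vonMangoldt n * ArithmeticFunction.vonMangoldt (n + h)) *
          (wt x n * (wt x (n + h) * |fejerKer V l|)) := by unfold coef; ring
      _ ≤ (2000000 * (n : ℝ) ^ (2 / 1000 : ℝ) * (h : ℝ) ^ (1 / 1000 : ℝ)) *
          ((x / n) ^ (1003 / 1000 : ℝ) * ((x / m) ^ (3 / 2 : ℝ) *
            (4 * V ^ (1 / 2 : ℝ) * (h / m) ^ (-(3 / 2) : ℝ)))) := by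
          gcongr
          exact h1.trans (by gcongr)
      _ = _ := by
          rw [hK, Real.div_rpow hx.le hn'.le, Real.div_rpow hx.le hm0.le, Real.div_rpow hh'.le hm0.le,
            Real.rpow_neg hm0.le, Real.rpow_neg hh'.le, Real.rpow_neg hh'.le, Real.rpow_neg hn'.le,
            show (2503 / 1000 : ℝ) = 1003 / 1000 + 3 / 2 by norm_num, Real.rpow_add hx,
            show (3 / 2 : ℝ) = 1499 / 1000 + 1 / 1000 by norm_num, Real.rpow_add hh',
            show (1 + 1 / 1000 : ℝ) = 1003 / 1000 - 2 / 1000 by norm_num, Real.rpow_sub hn']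
          field_simp
          ring
  calc _ ≤ ∑ n ∈ Finset.range N, 8000000 * K * (n : ℝ) ^ (-(1 + 1 / 1000) : ℝ) :=
        Finset.sum_le_sum key
    _ = 8000000 * K * ∑ n ∈ Finset.range N, (n : ℝ) ^ (-(1 + 1 / 1000) : ℝ) := by
        rw [Finset.mul_sum]
    _ ≤ 8000000 * K * C := by gcongr; exact hsum N
    _ = _ := by ring

/-- Replacing a shifted product of weights by a square, and `log (1 + h / n)` by `h / n`. -/
lemma exists_sum_shift_sub_le : ∃ C > 0, ∀ (x V : ℝ) (h N : ℕ), 0 < x → 0 ≤ V → 0 < h →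
    ∑ n ∈ Finset.range N, |coef x n * coef x (n + h) *
      fejerKer V (Real.log (n + h : ℕ) - Real.log n) -
        ArithmeticFunction.vonMangoldt n * ArithmeticFunction.vonMangoldt (n + h) *
          (wt x n ^ 2 * fejerKer V (h / n))| ≤
      C * ((h : ℝ) ^ (1001 / 1000 : ℝ) * V ^ 2 * x ^ (3 / 1000 : ℝ) +
        (h : ℝ) ^ (2001 / 1000 : ℝ) * V ^ 3 * x ^ (-(997 / 1000) : ℝ)) := by
  obtain ⟨C, hC, hsum⟩ := exists_sum_rpow_le (d := 1 / 1000) (by norm_num)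
  refine ⟨4000000 * C, by positivity, fun x V h N hx hV hh => ?_⟩
  have hh' : (0 : ℝ) < h := by exact_mod_cast hh
  set K := (h : ℝ) ^ (1001 / 1000 : ℝ) * V ^ 2 * x ^ (3 / 1000 : ℝ) +
        (h : ℝ) ^ (2001 / 1000 : ℝ) * V ^ 3 * x ^ (-(997 / 1000) : ℝ) with hK
  have hK0 : 0 ≤ K := by positivity
  have key : ∀ n ∈ Finset.range N, |coef x n * coef x (n + h) *
      fejerKer V (Real.log (n + h : ℕ) - Real.log n) -
        ArithmeticFunction.vonMangoldt n * ArithmeticFunction.vonMangoldt (n + h) *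
          (wt x n ^ 2 * fejerKer V (h / n))| ≤
        4000000 * K * (n : ℝ) ^ (-(1 + 1 / 1000) : ℝ) := by
    intro n _
    rcases Nat.eq_zero_or_pos n with rfl | hn
    · simp only [coef_zero, wt_zero hx, zero_mul, ne_eq, OfNat.ofNat_ne_zero, not_false_eq_true,
        zero_pow, mul_zero, sub_zero, abs_zero]
      positivity
    have hn' : (0 : ℝ) < n := by exact_mod_cast hn
    have hl := (abs_log_sub_log_add_sub_le (h := h) hn).1
    set l := Real.log (n + h : ℕ) - Real.log n with hldef
    have h1 := abs_fejerKer_le hV l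
    have h2 := (abs_fejerKer_sub_le hV l (h / n)).trans
      (mul_le_mul_of_nonneg_left hl (by positivity))
    have h3 := wt_add_bounds hx hn h
    have h5 := vonMangoldt_mul_le hn hh
    have hw1 := wt_nonneg hx n
    have s1 := wt_sq_mul_rpow_le hx hn (s := 998 / 1000) (d := 1 / 1000) (by norm_num) (by norm_num)
    have s2 := wt_sq_mul_rpow_le hx hn (s := 1998 / 1000) (d := 1 / 1000) (by norm_num)
      (by norm_num)
    have d1 : |wt x n * wt x (n + h) * fejerKer V l - wt x n ^ 2 * fejerKer V (h / n)| ≤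
        wt x n ^ 2 * (2 * (h / n) * V ^ 2 + 2 * V ^ 3 * (h / n) ^ 2) := by
      have e : wt x n * wt x (n + h) * fejerKer V l - wt x n ^ 2 * fejerKer V (h / n) =
          wt x n * ((wt x (n + h) - wt x n) * fejerKer V l) +
            wt x n ^ 2 * (fejerKer V l - fejerKer V (h / n)) := by ring
      rw [e]
      refine (abs_add_le _ _).trans ?_
      rw [abs_mul, abs_mul, abs_mul, abs_of_nonneg hw1, abs_of_nonneg (by positivity : 0 ≤ wt x n ^ 2)]
      calc _ ≤ wt x n * ((3 / 2 * (h / n) * wt x n) * V ^ 2) +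
            wt x n ^ 2 * (2 * V ^ 3 * (h / n) ^ 2) := by gcongr
        _ = wt x n ^ 2 * (3 / 2 * ((h / n) * V ^ 2) + 2 * V ^ 3 * (h / n) ^ 2) := by ring
        _ ≤ wt x n ^ 2 * (2 * ((h / n) * V ^ 2) + 2 * V ^ 3 * (h / n) ^ 2) := by
            gcongr
            norm_num
        _ = _ := by ring
    have hΛ : 0 ≤ ArithmeticFunction.vonMangoldt n * ArithmeticFunction.vonMangoldt (n + h) :=
      mul_nonneg ArithmeticFunction.vonMangoldt_nonneg ArithmeticFunction.vonMangoldt_nonneg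
    have e0 : coef x n * coef x (n + h) * fejerKer V l -
        ArithmeticFunction.vonMangoldt n * ArithmeticFunction.vonMangoldt (n + h) *
          (wt x n ^ 2 * fejerKer V (h / n)) =
        (ArithmeticFunction.vonMangoldt n * ArithmeticFunction.vonMangoldt (n + h)) *
          (wt x n * wt x (n + h) * fejerKer V l - wt x n ^ 2 * fejerKer V (h / n)) := by
      unfold coef; ring
    rw [e0, abs_mul, abs_of_nonneg hΛ]
    calc _ ≤ (2000000 * (n : ℝ) ^ (2 / 1000 : ℝ) * (h : ℝ) ^ (1 / 1000 : ℝ)) *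
          (wt x n ^ 2 * (2 * (h / n) * V ^ 2 + 2 * V ^ 3 * (h / n) ^ 2)) := by gcongr
      _ = 4000000 * ((h : ℝ) ^ (1001 / 1000 : ℝ) * V ^ 2 *
            (wt x n ^ 2 * (n : ℝ) ^ (-(998 / 1000) : ℝ)) +
          (h : ℝ) ^ (2001 / 1000 : ℝ) * V ^ 3 * (wt x n ^ 2 * (n : ℝ) ^ (-(1998 / 1000) : ℝ))) := by
          rw [show (1001 / 1000 : ℝ) = 1 + 1 / 1000 by norm_num, Real.rpow_add hh', Real.rpow_one,
            show (2001 / 1000 : ℝ) = 2 + 1 / 1000 by norm_num, Real.rpow_add hh', Real.rpow_two,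
            show (-(998 / 1000) : ℝ) = 2 / 1000 - 1 by norm_num, Real.rpow_sub hn', Real.rpow_one,
            show (-(1998 / 1000) : ℝ) = 2 / 1000 - 2 by norm_num, Real.rpow_sub hn', Real.rpow_two]
          field_simp
          ring
      _ ≤ 4000000 * ((h : ℝ) ^ (1001 / 1000 : ℝ) * V ^ 2 *
            (x ^ (1 + 1 / 1000 - 998 / 1000 : ℝ) * (n : ℝ) ^ (-(1 + 1 / 1000) : ℝ)) +
          (h : ℝ) ^ (2001 / 1000 : ℝ) * V ^ 3 *
            (x ^ (1 + 1 / 1000 - 1998 / 1000 : ℝ) * (n : ℝ) ^ (-(1 + 1 / 1000) : ℝ))) := by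
          gcongr
      _ = _ := by
          rw [hK, show (1 + 1 / 1000 - 998 / 1000 : ℝ) = 3 / 1000 by norm_num,
            show (1 + 1 / 1000 - 1998 / 1000 : ℝ) = -(997 / 1000) by norm_num]
          ring
  calc _ ≤ ∑ n ∈ Finset.range N, 4000000 * K * (n : ℝ) ^ (-(1 + 1 / 1000) : ℝ) :=
        Finset.sum_le_sum key
    _ = 4000000 * K * ∑ n ∈ Finset.range N, (n : ℝ) ^ (-(1 + 1 / 1000) : ℝ) := by
        rw [Finset.mul_sum]
    _ ≤ 4000000 * K * C := by gcongr; exact hsum N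
    _ = _ := by ring

/-- The error term in the twin prime asymptotics for all ranges, and a bound for the constant. -/
lemma exists_twin_bounds (hTPC : TwinPrimeConjecture) : ∃ C > 0, ∀ h : ℕ, 0 < h →
    |singularSeries h| ≤ C * (h : ℝ) ^ (1 / 10 : ℝ) ∧ ∀ N : ℕ,
    |(∑ n ∈ Finset.Icc 1 N,
        ArithmeticFunction.vonMangoldt n * ArithmeticFunction.vonMangoldt (n + h)) -
      singularSeries h * N| ≤ C * ((h : ℝ) ^ (11 / 10 : ℝ) * (N : ℝ) ^ (6 / 10 : ℝ)) := by
  obtain ⟨C, hC, hT⟩ := hTPC (1 / 10) (by norm_num)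
  have htriv : ∀ N h : ℕ, 0 < h → ∑ n ∈ Finset.Icc 1 N,
      ArithmeticFunction.vonMangoldt n * ArithmeticFunction.vonMangoldt (n + h) ≤
        2000000 * (N : ℝ) ^ (1002 / 1000 : ℝ) * (h : ℝ) ^ (1 / 1000 : ℝ) := by
    intro N h hh
    rcases Nat.eq_zero_or_pos N with rfl | hN
    · simp
    have hN' : (0 : ℝ) < N := by exact_mod_cast hN
    calc _ ≤ ∑ n ∈ Finset.Icc 1 N, 2000000 * (N : ℝ) ^ (2 / 1000 : ℝ) * (h : ℝ) ^ (1 / 1000 : ℝ) := by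
          refine Finset.sum_le_sum fun n hn => ?_
          rw [Finset.mem_Icc] at hn
          refine (vonMangoldt_mul_le hn.1 hh).trans ?_
          have : (n : ℝ) ≤ N := by exact_mod_cast hn.2
          gcongr
      _ = _ := by
          rw [Finset.sum_const, Nat.card_Icc, Nat.add_sub_cancel, nsmul_eq_mul,
            show (1002 / 1000 : ℝ) = 1 + 2 / 1000 by norm_num, Real.rpow_add hN', Real.rpow_one]
          ring
  have hpos : ∀ N h : ℕ, 0 ≤ ∑ n ∈ Finset.Icc 1 N,
      ArithmeticFunction.vonMangoldt n * ArithmeticFunction.vonMangoldt (n + h) := fun N h =>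
    Finset.sum_nonneg fun n _ =>
      mul_nonneg ArithmeticFunction.vonMangoldt_nonneg ArithmeticFunction.vonMangoldt_nonneg
  have hS : ∀ h : ℕ, 0 < h → |singularSeries h| ≤ (C + 2000000) * (h : ℝ) ^ (1 / 10 : ℝ) := by
    intro h hh
    have hh' : (1 : ℝ) ≤ h := by exact_mod_cast hh
    have h0 : (0 : ℝ) < h := by linarith
    have h1 := hT h h hh le_rfl
    have h2 := htriv h h hh
    have h3 := hpos h h
    have h4 : |singularSeries h| * h ≤ C * (h : ℝ) ^ ((1 : ℝ) / 2 + 1 / 10) +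
        2000000 * (h : ℝ) ^ (1002 / 1000 : ℝ) * (h : ℝ) ^ (1 / 1000 : ℝ) := by
      rw [← abs_of_pos h0, ← abs_mul, abs_of_pos h0]
      rw [abs_le] at h1 ⊢
      constructor <;> linarith [h1.1, h1.2]
    rw [mul_assoc, ← Real.rpow_add h0] at h4
    have h5 : (h : ℝ) ^ ((1 : ℝ) / 2 + 1 / 10) ≤ (h : ℝ) ^ (11 / 10 : ℝ) :=
      Real.rpow_le_rpow_of_exponent_le hh' (by norm_num)
    have h6 : (h : ℝ) ^ (1002 / 1000 + 1 / 1000 : ℝ) ≤ (h : ℝ) ^ (11 / 10 : ℝ) :=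
      Real.rpow_le_rpow_of_exponent_le hh' (by norm_num)
    have h7 : (h : ℝ) ^ (11 / 10 : ℝ) = (h : ℝ) ^ (1 / 10 : ℝ) * h := by
      rw [show (11 / 10 : ℝ) = 1 / 10 + 1 by norm_num, Real.rpow_add h0, Real.rpow_one]
    refine le_of_mul_le_mul_right ?_ h0
    rw [mul_assoc, ← h7]
    nlinarith
  refine ⟨C + 4000000, by linarith, fun h hh => ⟨(hS h hh).trans (by gcongr; norm_num), fun N => ?_⟩⟩
  have hh' : (1 : ℝ) ≤ h := by exact_mod_cast hh
  have h0 : (0 : ℝ) < h := by linarith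
  rcases le_or_gt h N with hN | hN
  · refine (hT N h hh hN).trans ?_
    rw [show (1 : ℝ) / 2 + 1 / 10 = 6 / 10 by norm_num]
    have : (1 : ℝ) ≤ (h : ℝ) ^ (11 / 10 : ℝ) := Real.one_le_rpow hh' (by norm_num)
    have h2 : 0 ≤ (N : ℝ) ^ (6 / 10 : ℝ) := by positivity
    calc _ ≤ (C + 4000000) * (1 * (N : ℝ) ^ (6 / 10 : ℝ)) := by nlinarith
      _ ≤ _ := by gcongr
  · rcases Nat.eq_zero_or_pos N with rfl | hN0
    · simp
    have hN' : (0 : ℝ) < N := by exact_mod_cast hN0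
    have hNh : (N : ℝ) ≤ h := by exact_mod_cast hN.le
    have b1 : (N : ℝ) ^ (1002 / 1000 : ℝ) * (h : ℝ) ^ (1 / 1000 : ℝ) ≤
        (h : ℝ) ^ (11 / 10 : ℝ) * (N : ℝ) ^ (6 / 10 : ℝ) := by
      calc _ = (N : ℝ) ^ (402 / 1000 : ℝ) * (h : ℝ) ^ (1 / 1000 : ℝ) * (N : ℝ) ^ (6 / 10 : ℝ) := by
            rw [show (1002 / 1000 : ℝ) = 402 / 1000 + 6 / 10 by norm_num, Real.rpow_add hN']; ring
        _ ≤ (h : ℝ) ^ (402 / 1000 : ℝ) * (h : ℝ) ^ (1 / 1000 : ℝ) * (N : ℝ) ^ (6 / 10 : ℝ) := by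
            gcongr
        _ ≤ _ := by
            rw [← Real.rpow_add h0]
            gcongr
            norm_num
    have b2 : (h : ℝ) ^ (1 / 10 : ℝ) * N ≤ (h : ℝ) ^ (11 / 10 : ℝ) * (N : ℝ) ^ (6 / 10 : ℝ) := by
      calc _ = (h : ℝ) ^ (1 / 10 : ℝ) * (N : ℝ) ^ (4 / 10 : ℝ) * (N : ℝ) ^ (6 / 10 : ℝ) := by
            rw [mul_assoc, ← Real.rpow_add hN']; norm_num
        _ ≤ (h : ℝ) ^ (1 / 10 : ℝ) * (h : ℝ) ^ (4 / 10 : ℝ) * (N : ℝ) ^ (6 / 10 : ℝ) := by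
            gcongr
        _ ≤ _ := by
            rw [← Real.rpow_add h0]
            gcongr
            norm_num
    have b3 := htriv N h hh
    have b4 := hpos N h
    have b5 : |singularSeries h * N| ≤
        (C + 2000000) * ((h : ℝ) ^ (11 / 10 : ℝ) * (N : ℝ) ^ (6 / 10 : ℝ)) := by
      rw [abs_mul, abs_of_pos hN']
      calc _ ≤ (C + 2000000) * (h : ℝ) ^ (1 / 10 : ℝ) * N := by gcongr; exact hS h hh
        _ = (C + 2000000) * ((h : ℝ) ^ (1 / 10 : ℝ) * N) := by ring
        _ ≤ _ := by gcongr
    refine (abs_sub _ _).trans ?_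
    rw [abs_of_nonneg b4]
    nlinarith

/-- Summation by parts against a sequence with small partial sums. -/
lemma abs_sum_mul_le_of_partial {g a : ℕ → ℝ} {A : ℕ → ℝ} (hA : ∀ n, |∑ i ∈ Finset.range (n + 1), a i| ≤ A n)
    (N : ℕ) : |∑ n ∈ Finset.range (N + 1), g n * a n| ≤
      |g N| * A N + ∑ n ∈ Finset.range N, |g (n + 1) - g n| * A n := by
  have h : ∑ n ∈ Finset.range (N + 1), g n * a n = g N * ∑ i ∈ Finset.range (N + 1), a i -
      ∑ n ∈ Finset.range N, (g (n + 1) - g n) * ∑ i ∈ Finset.range (n + 1), a i := by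
    induction N with
    | zero => simp
    | succ N ih =>
      rw [Finset.sum_range_succ, ih, Finset.sum_range_succ (fun n => (g (n + 1) - g n) * _),
        Finset.sum_range_succ a (N + 1)]
      ring
  rw [h]
  refine (abs_sub _ _).trans (add_le_add ?_ ((Finset.abs_sum_le_sum_abs _ _).trans
    (Finset.sum_le_sum fun n _ => ?_))) <;>
  · rw [abs_mul]
    gcongr
    exact hA _

lemma abs_weighted_fejerKer_succ_sub_le {x V : ℝ} (hx : 0 < x) (hV : 0 ≤ V) {n : ℕ} (hn : 0 < n)
    (h : ℕ) : |wt x (n + 1) ^ 2 * fejerKer V (h / (n + 1 : ℕ)) - wt x n ^ 2 * fejerKer V (h / n)| ≤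
      14 * (wt x n ^ 2 * (V ^ 2 / n + h * V ^ 3 / n ^ 2)) := by
  have hn' : (0 : ℝ) < n := by exact_mod_cast hn
  obtain ⟨h1, h2⟩ := abs_wt_sq_succ_sub_le hx hn
  have h3 := abs_fejerKer_le hV (h / n)
  have h4 := abs_fejerKer_sub_le hV ((h : ℝ) / (n + 1 : ℕ)) (h / n)
  have h5 : |(h : ℝ) / (n + 1 : ℕ) - h / n| ≤ h / n ^ 2 := by
    have e : (h : ℝ) / (n + 1 : ℕ) - h / n = -(h / (n * (n + 1))) := by
      push_cast; field_simp; ring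
    rw [e, abs_neg, abs_of_nonneg (by positivity)]
    gcongr
    nlinarith
  have e : wt x (n + 1) ^ 2 * fejerKer V (h / (n + 1 : ℕ)) - wt x n ^ 2 * fejerKer V (h / n) =
      wt x (n + 1) ^ 2 * (fejerKer V (h / (n + 1 : ℕ)) - fejerKer V (h / n)) +
        (wt x (n + 1) ^ 2 - wt x n ^ 2) * fejerKer V (h / n) := by ring
  rw [e]
  refine (abs_add_le _ _).trans ?_
  rw [abs_mul, abs_mul, abs_of_nonneg (by positivity : 0 ≤ wt x (n + 1) ^ 2)]
  calc _ ≤ 7 * wt x n ^ 2 * (2 * V ^ 3 * (h / n ^ 2)) + 6 * wt x n ^ 2 / n * V ^ 2 := by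
        gcongr
        exact h4.trans (by gcongr)
    _ = 14 * (wt x n ^ 2 * (3 / 7 * (V ^ 2 / n) + h * V ^ 3 / n ^ 2)) := by ring
    _ ≤ _ := by
        have : 0 ≤ V ^ 2 / n := by positivity
        gcongr
        linarith

/-- Inserting the twin prime asymptotics into a smooth shifted sum. -/
lemma exists_sum_twin_le (hTPC : TwinPrimeConjecture) : ∃ C > 0, ∀ (x V : ℝ) (h N : ℕ), 0 < x →
    0 ≤ V → 0 < h →
    |∑ n ∈ Finset.range (N + 1), wt x n ^ 2 * fejerKer V (h / n) *
      (ArithmeticFunction.vonMangoldt n * ArithmeticFunction.vonMangoldt (n + h)) -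
      singularSeries h * ∑ n ∈ Finset.range (N + 1), wt x n ^ 2 * fejerKer V (h / n)| ≤
      C * ((h : ℝ) ^ (11 / 10 : ℝ) * (V ^ 2 * (x ^ (6 / 10 : ℝ) + x ^ (601 / 1000 : ℝ)) +
        h * V ^ 3 * x ^ (-(399 / 1000) : ℝ))) := by
  obtain ⟨C, hC, hT⟩ := exists_twin_bounds hTPC
  obtain ⟨D, hD, hsum⟩ := exists_sum_rpow_le (d := 1 / 1000) (by norm_num)
  refine ⟨C * (1 + 14 * D), by positivity, fun x V h N hx hV hh => ?_⟩
  have hh' : (0 : ℝ) < h := by exact_mod_cast hh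
  set g : ℕ → ℝ := fun n => wt x n ^ 2 * fejerKer V (h / n) with hg
  have hg0 : g 0 = 0 := by simp [hg, wt_zero hx]
  set a : ℕ → ℝ := fun n => if n = 0 then 0 else
    ArithmeticFunction.vonMangoldt n * ArithmeticFunction.vonMangoldt (n + h) - singularSeries h
    with ha
  have hA : ∀ n, |∑ i ∈ Finset.range (n + 1), a i| ≤
      C * ((h : ℝ) ^ (11 / 10 : ℝ) * (n : ℝ) ^ (6 / 10 : ℝ)) := by
    intro n
    refine le_trans (le_of_eq ?_) ((hT h hh).2 n)
    congr 1
    induction n with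
    | zero => simp [ha]
    | succ n ih =>
      rw [Finset.sum_range_succ, ih, Finset.sum_Icc_succ_top (Nat.le_add_left 1 n), ha]
      simp only [Nat.add_one_ne_zero, if_false]
      push_cast
      ring
  have hsub : ∑ n ∈ Finset.range (N + 1), g n *
      (ArithmeticFunction.vonMangoldt n * ArithmeticFunction.vonMangoldt (n + h)) -
      singularSeries h * ∑ n ∈ Finset.range (N + 1), g n =
        ∑ n ∈ Finset.range (N + 1), g n * a n := by
    rw [Finset.mul_sum, ← Finset.sum_sub_distrib]
    refine Finset.sum_congr rfl fun n _ => ?_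
    rcases Nat.eq_zero_or_pos n with rfl | hn
    · rw [hg0]; ring
    · rw [ha]; simp only [hn.ne', if_false]; ring
  rw [hsub]
  refine (abs_sum_mul_le_of_partial hA N).trans ?_
  set H := (h : ℝ) ^ (11 / 10 : ℝ) with hH
  set K := V ^ 2 * x ^ (601 / 1000 : ℝ) + h * V ^ 3 * x ^ (-(399 / 1000) : ℝ) with hK
  have hK0 : 0 ≤ K := by positivity
  have b1 : |g N| * (C * (H * (N : ℝ) ^ (6 / 10 : ℝ))) ≤ C * (H * (V ^ 2 * x ^ (6 / 10 : ℝ))) := by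
    rcases Nat.eq_zero_or_pos N with rfl | hN
    · rw [hg0, abs_zero, zero_mul]; positivity
    have hN' : (0 : ℝ) < N := by exact_mod_cast hN
    have h1 := wt_sq_le_rpow hx hN (k := 6 / 10) (by norm_num) (by norm_num)
    rw [Real.div_rpow hx.le hN'.le, le_div_iff₀ (by positivity)] at h1
    rw [hg, abs_mul, abs_of_nonneg (by positivity : 0 ≤ wt x N ^ 2)]
    calc _ ≤ wt x N ^ 2 * V ^ 2 * (C * (H * (N : ℝ) ^ (6 / 10 : ℝ))) := by
          gcongr; exact abs_fejerKer_le hV _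
      _ = C * (H * (V ^ 2 * (wt x N ^ 2 * (N : ℝ) ^ (6 / 10 : ℝ)))) := by ring
      _ ≤ _ := by gcongr
  have b2 : ∀ n ∈ Finset.range N, |g (n + 1) - g n| * (C * (H * (n : ℝ) ^ (6 / 10 : ℝ))) ≤
      14 * C * H * K * (n : ℝ) ^ (-(1 + 1 / 1000) : ℝ) := by
    intro n _
    rcases Nat.eq_zero_or_pos n with rfl | hn
    · rw [Nat.cast_zero, Real.zero_rpow (by norm_num), Real.zero_rpow (by norm_num)]; simp
    have hn' : (0 : ℝ) < n := by exact_mod_cast hn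
    have s1 := wt_sq_mul_rpow_le hx hn (s := 4 / 10) (d := 1 / 1000) (by norm_num) (by norm_num)
    have s2 := wt_sq_mul_rpow_le hx hn (s := 14 / 10) (d := 1 / 1000) (by norm_num) (by norm_num)
    calc _ ≤ 14 * (wt x n ^ 2 * (V ^ 2 / n + h * V ^ 3 / n ^ 2)) *
          (C * (H * (n : ℝ) ^ (6 / 10 : ℝ))) := by
          gcongr
          exact abs_weighted_fejerKer_succ_sub_le hx hV hn h
      _ = 14 * C * H * (V ^ 2 * (wt x n ^ 2 * (n : ℝ) ^ (-(4 / 10) : ℝ)) +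
          h * V ^ 3 * (wt x n ^ 2 * (n : ℝ) ^ (-(14 / 10) : ℝ))) := by
          rw [show (-(4 / 10) : ℝ) = 6 / 10 - 1 by norm_num, Real.rpow_sub hn', Real.rpow_one,
            show (-(14 / 10) : ℝ) = 6 / 10 - 2 by norm_num, Real.rpow_sub hn', Real.rpow_two]
          field_simp
      _ ≤ 14 * C * H * (V ^ 2 * (x ^ (1 + 1 / 1000 - 4 / 10 : ℝ) * (n : ℝ) ^ (-(1 + 1 / 1000) : ℝ)) +
          h * V ^ 3 * (x ^ (1 + 1 / 1000 - 14 / 10 : ℝ) * (n : ℝ) ^ (-(1 + 1 / 1000) : ℝ))) := by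
          gcongr
      _ = _ := by
          rw [hK, show (1 + 1 / 1000 - 4 / 10 : ℝ) = 601 / 1000 by norm_num,
            show (1 + 1 / 1000 - 14 / 10 : ℝ) = -(399 / 1000) by norm_num]
          ring
  have b3 : ∑ n ∈ Finset.range N, |g (n + 1) - g n| * (C * (H * (n : ℝ) ^ (6 / 10 : ℝ))) ≤
      14 * C * H * K * D := by
    refine (Finset.sum_le_sum b2).trans ?_
    rw [← Finset.mul_sum]
    gcongr
    exact hsum N
  have b4 : 0 ≤ V ^ 2 * x ^ (6 / 10 : ℝ) := by positivity
  calc _ ≤ C * (H * (V ^ 2 * x ^ (6 / 10 : ℝ))) + 14 * C * H * K * D := add_le_add b1 b3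
    _ = C * H * (1 * (V ^ 2 * x ^ (6 / 10 : ℝ)) + 14 * D * K) := by ring
    _ ≤ C * H * ((1 + 14 * D) * (V ^ 2 * x ^ (6 / 10 : ℝ)) + (1 + 14 * D) * K) := by
        gcongr <;> linarith
    _ = _ := by rw [hK]; ring

lemma abs_cos_sub_cos_sub_le {a b : ℝ} (h : a ≤ b) :
    |Real.cos a - Real.cos b - (b - a) * Real.sin b| ≤ 3 * (b - a) ^ 2 := by
  obtain ⟨d, hd⟩ : ∃ d, d = b - a := ⟨_, rfl⟩
  have hd0 : 0 ≤ d := by linarith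
  have ha : a = b - d := by linarith
  rw [ha, Real.cos_sub]
  have e : Real.cos b * Real.cos d + Real.sin b * Real.sin d - Real.cos b -
      (b - (b - d)) * Real.sin b = Real.cos b * (Real.cos d - 1) + Real.sin b * (Real.sin d - d) := by
    ring
  rw [e, sub_sub_cancel]
  have h1 : |Real.cos d - 1| ≤ d ^ 2 := by
    rw [abs_le]
    constructor <;> nlinarith [Real.one_sub_sq_div_two_le_cos (x := d), Real.cos_le_one d]
  have h2 : |Real.sin d - d| ≤ 2 * d ^ 2 := by
    have h3 := Real.sin_le hd0
    rw [abs_le]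
    refine ⟨?_, by nlinarith⟩
    rcases hd0.eq_or_lt with h0 | h0
    · simp [← h0]
    · rcases le_or_gt d 1 with h1 | h1
      · nlinarith [Real.sin_gt_sub_cube h0, pow_pos h0 2]
      · nlinarith [Real.neg_one_le_sin d]
  refine (abs_add_le _ _).trans ?_
  rw [abs_mul, abs_mul]
  nlinarith [Real.abs_cos_le_one b, Real.abs_sin_le_one b, abs_nonneg (Real.cos d - 1),
    abs_nonneg (Real.sin d - d)]

/-- Summation by parts for a monotone sequence against the increments of a bounded one. -/
lemma abs_sum_monotone_mul_sub_le {c b : ℕ → ℝ} (hc : Monotone c) (h0 : c 0 = 0) {B : ℝ}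
    (hb : ∀ n, |b n| ≤ B) (N : ℕ) :
    |∑ n ∈ Finset.range N, c n * (b (n + 1) - b n)| ≤ 2 * (c N * B) := by
  have hcN : 0 ≤ c N := h0 ▸ hc (Nat.zero_le N)
  have h1 : |∑ n ∈ Finset.range N, c n * (b (n + 1) - b n) - c N * b N| ≤ c N * B := by
    clear hcN
    induction N with
    | zero => simp [h0]
    | succ N ih =>
      have e : ∑ n ∈ Finset.range (N + 1), c n * (b (n + 1) - b n) - c (N + 1) * b (N + 1) =
          (∑ n ∈ Finset.range N, c n * (b (n + 1) - b n) - c N * b N) -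
            (c (N + 1) - c N) * b (N + 1) := by
        rw [Finset.sum_range_succ]; ring
      have hm : 0 ≤ c (N + 1) - c N := sub_nonneg.mpr (hc (Nat.le_succ N))
      rw [e]
      refine (abs_sub _ _).trans ?_
      rw [abs_mul, abs_of_nonneg hm]
      nlinarith [hb (N + 1)]
  have h2 : |c N * b N| ≤ c N * B := by
    rw [abs_mul, abs_of_nonneg hcN]
    gcongr
    exact hb N
  have := abs_add_le (∑ n ∈ Finset.range N, c n * (b (n + 1) - b n) - c N * b N) (c N * b N)
  rw [sub_add_cancel] at this
  linarith

/-- The weighted sum of the Dirichlet kernel over the fractions `h / n`. -/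
lemma exists_sum_dirichletKer_le : ∃ C > 0, ∀ (x v : ℝ) (h N : ℕ), 0 < x → 0 < v → 0 < h →
    |∑ n ∈ Finset.range N, wt x n ^ 2 * dirichletKer v (h / n)| ≤
      C * (x ^ 3 / (v * h ^ 2) + x ^ (1001 / 1000 : ℝ) + v * x ^ (1 / 1000 : ℝ)) := by
  obtain ⟨D, hD, hsum⟩ := exists_sum_rpow_le (d := 1 / 1000) (by norm_num)
  refine ⟨4 + 6 * D, by positivity, fun x v h N hx hv hh => ?_⟩
  have hh' : (1 : ℝ) ≤ h := by exact_mod_cast hh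
  have h0 : (0 : ℝ) < h := by linarith
  set b : ℕ → ℝ := fun n => Real.cos (v * (h / n)) / v with hb
  set c : ℕ → ℝ := fun n => wt x n ^ 2 * (n : ℝ) ^ 3 * (h ^ 2 : ℝ)⁻¹ with hc
  have hcm : Monotone c := (monotone_wt_sq_mul_cube hx).mul_const (by positivity)
  have hbB : ∀ n, |b n| ≤ 1 / v := fun n => by
    rw [hb, abs_div, abs_of_pos hv]
    gcongr
    exact Real.abs_cos_le_one _
  have hcN : c N ≤ x ^ 3 * (h ^ 2 : ℝ)⁻¹ := by
    rw [hc]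
    simp only [wt_sq_mul_cube hx]
    gcongr
    exact min_le_right _ _
  have m1 := abs_sum_monotone_mul_sub_le hcm (by simp [hc]) hbB N
  have key : ∀ n ∈ Finset.range N,
      |wt x n ^ 2 * dirichletKer v (h / n) - 2 * (c n * (b (n + 1) - b n))| ≤
      6 * (x ^ (1001 / 1000 : ℝ) + v * x ^ (1 / 1000 : ℝ)) * (n : ℝ) ^ (-(1 + 1 / 1000) : ℝ) := by
    intro n _
    rcases Nat.eq_zero_or_pos n with rfl | hn
    · rw [wt_zero hx]
      simp only [hc, wt_zero hx, ne_eq, OfNat.ofNat_ne_zero, not_false_eq_true, zero_pow, zero_mul,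
        mul_zero, sub_zero, abs_zero]
      positivity
    have hn' : (0 : ℝ) < n := by exact_mod_cast hn
    have s1 := wt_sq_mul_rpow_le hx hn (s := 0) (d := 1 / 1000) (by norm_num) (by norm_num)
    have s2 := wt_sq_mul_rpow_le hx hn (s := 1) (d := 1 / 1000) (by norm_num) (by norm_num)
    rw [neg_zero, Real.rpow_zero, mul_one, show (1 + 1 / 1000 - 0 : ℝ) = 1001 / 1000 by norm_num] at s1
    rw [Real.rpow_neg_one, show (1 + 1 / 1000 - 1 : ℝ) = 1 / 1000 by norm_num] at s2
    set s := Real.sin (v * (h / n)) with hs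
    have hs1 : |s| ≤ 1 := Real.abs_sin_le_one _
    have hD1 : dirichletKer v (h / n) = 2 * (n / h) * s := by
      have := mul_dirichletKer v (h / n)
      rw [← hs] at this
      field_simp at this ⊢
      linarith
    have hle : v * (h / ((n + 1 : ℕ) : ℝ)) ≤ v * (h / n) := by
      gcongr
      exact Nat.le_succ n
    have hdiff : v * (h / n) - v * (h / ((n + 1 : ℕ) : ℝ)) = v * h / (n * (n + 1)) := by
      push_cast; field_simp; ring
    have hcos := abs_cos_sub_cos_sub_le hle
    rw [hdiff, ← hs] at hcos
    have t1 : |h / n ^ 2 * s - (b (n + 1) - b n)| ≤ h / n ^ 3 + 3 * (v * h ^ 2 / n ^ 4) := by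
      have e : h / n ^ 2 * s - (b (n + 1) - b n) = h / (n ^ 2 * (n + 1)) * s -
          (Real.cos (v * (h / ((n + 1 : ℕ) : ℝ))) - Real.cos (v * (h / n)) -
            v * h / (n * (n + 1)) * s) / v := by
        rw [hb]; push_cast; field_simp; ring
      rw [e]
      refine (abs_sub _ _).trans (add_le_add ?_ ?_)
      · rw [abs_mul, abs_of_pos (by positivity)]
        calc _ ≤ (h : ℝ) / (n ^ 2 * n) * 1 := by
              gcongr
              linarith
          _ = _ := by field_simp
      · rw [abs_div, abs_of_pos hv, div_le_iff₀ hv]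
        refine hcos.trans ?_
        calc 3 * (v * h / (n * (n + 1))) ^ 2 ≤ 3 * (v * h / (n * n : ℝ)) ^ 2 := by
              gcongr
              linarith
          _ = _ := by field_simp
    have e2 : wt x n ^ 2 * dirichletKer v (h / n) - 2 * (c n * (b (n + 1) - b n)) =
        2 * c n * (h / n ^ 2 * s - (b (n + 1) - b n)) := by
      rw [hD1, hc]; field_simp
    have hc0 : 0 ≤ c n := by rw [hc]; positivity
    rw [e2, abs_mul, abs_of_nonneg (by positivity : 0 ≤ 2 * c n)]
    calc _ ≤ 2 * c n * (h / n ^ 3 + 3 * (v * h ^ 2 / n ^ 4)) := by gcongr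
      _ = 2 * (wt x n ^ 2 / h) + 6 * (v * (wt x n ^ 2 * (n : ℝ)⁻¹)) := by
          rw [hc]; field_simp; ring
      _ ≤ 6 * (wt x n ^ 2) + 6 * (v * (wt x n ^ 2 * (n : ℝ)⁻¹)) := by
          have : wt x n ^ 2 / h ≤ wt x n ^ 2 := div_le_self (by positivity) hh'
          have h2 : 0 ≤ wt x n ^ 2 := by positivity
          linarith
      _ ≤ 6 * (x ^ (1001 / 1000 : ℝ) * (n : ℝ) ^ (-(1 + 1 / 1000) : ℝ)) +
          6 * (v * (x ^ (1 / 1000 : ℝ) * (n : ℝ) ^ (-(1 + 1 / 1000) : ℝ))) := by gcongr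
      _ = _ := by ring
  set K := x ^ (1001 / 1000 : ℝ) + v * x ^ (1 / 1000 : ℝ) with hK
  have hK0 : 0 ≤ K := by positivity
  have e3 : |∑ n ∈ Finset.range N, wt x n ^ 2 * dirichletKer v (h / n) -
      2 * ∑ n ∈ Finset.range N, c n * (b (n + 1) - b n)| ≤ 6 * K * D := by
    rw [Finset.mul_sum, ← Finset.sum_sub_distrib]
    refine (Finset.abs_sum_le_sum_abs _ _).trans ((Finset.sum_le_sum key).trans ?_)
    rw [← Finset.mul_sum]
    gcongr
    exact hsum N
  have e4 : c N * (1 / v) ≤ x ^ 3 / (v * h ^ 2) := by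
    calc _ ≤ x ^ 3 * (h ^ 2 : ℝ)⁻¹ * (1 / v) := by gcongr
      _ = _ := by field_simp
  have e5 : 0 ≤ x ^ 3 / (v * h ^ 2) := by positivity
  have e6 : |∑ n ∈ Finset.range N, wt x n ^ 2 * dirichletKer v (h / n)| ≤
      6 * K * D + 4 * (x ^ 3 / (v * h ^ 2)) := by
    rw [abs_le] at e3 m1 ⊢
    constructor <;> linarith
  rw [add_assoc, ← hK]
  nlinarith [mul_nonneg hD.le e5]

/-- The corresponding bound for increments of the Fejér kernel. -/
lemma exists_sum_fejerKer_sub_le : ∃ C > 0, ∀ (x V W : ℝ) (h N : ℕ), 0 < x → 0 < V → V ≤ W → 0 < h →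
    |∑ n ∈ Finset.range N, wt x n ^ 2 * fejerKer W (h / n) -
      ∑ n ∈ Finset.range N, wt x n ^ 2 * fejerKer V (h / n)| ≤
      C * ((W - V) * (x ^ 3 / (V * h ^ 2) + x ^ (1001 / 1000 : ℝ) + W * x ^ (1 / 1000 : ℝ))) := by
  obtain ⟨C, hC, hD⟩ := exists_sum_dirichletKer_le
  refine ⟨C, hC, fun x V W h N hx hV hVW hh => ?_⟩
  have hh' : (0 : ℝ) < h := by exact_mod_cast hh
  have e : ∑ n ∈ Finset.range N, wt x n ^ 2 * fejerKer W (h / n) -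
      ∑ n ∈ Finset.range N, wt x n ^ 2 * fejerKer V (h / n) =
      ∫ v in V..W, ∑ n ∈ Finset.range N, wt x n ^ 2 * dirichletKer v (h / n) := by
    rw [intervalIntegral.integral_finsetSum fun n _ =>
      ((continuous_dirichletKer _).const_mul _).intervalIntegrable _ _, ← Finset.sum_sub_distrib]
    refine Finset.sum_congr rfl fun n _ => ?_
    rw [intervalIntegral.integral_const_mul, ← fejerKer_sub]
    ring
  rw [e, ← Real.norm_eq_abs]
  refine (intervalIntegral.norm_integral_le_of_norm_le_const
    (C := C * (x ^ 3 / (V * h ^ 2) + x ^ (1001 / 1000 : ℝ) + W * x ^ (1 / 1000 : ℝ))) ?_).trans ?_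
  · intro v hv
    rw [Set.uIoc_of_le hVW] at hv
    rw [Real.norm_eq_abs]
    refine (hD x v h N hx (hV.trans hv.1) hh).trans ?_
    gcongr
    · exact hv.1.le
    · exact hv.2
  · rw [abs_of_nonneg (by linarith)]
    exact le_of_eq (by ring)

/-- The contribution of one shift to the increment of the mean square. -/
lemma exists_shift_sum_le (hTPC : TwinPrimeConjecture) : ∃ C > 0, ∀ (T x V W : ℝ) (h N : ℕ),
    1 ≤ T → T ^ (999 / 1000 : ℝ) ≤ x → x ≤ T → T / 2 ≤ V → V ≤ W → W ≤ 2 * T → 0 < h →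
    |∑ n ∈ Finset.range (N + 1), coef x n * coef x (n + h) *
      (fejerKer W (Real.log (n + h : ℕ) - Real.log n) -
        fejerKer V (Real.log (n + h : ℕ) - Real.log n))| ≤
      C * ((W - V) * x ^ 2 + x * T ^ (1999 / 1000 : ℝ)) * (h : ℝ) ^ (-(11 / 10) : ℝ) := by
  obtain ⟨C₁, hC₁, hA⟩ := exists_sum_shift_large_le
  obtain ⟨C₂, hC₂, hB⟩ := exists_sum_shift_sub_le
  obtain ⟨C₃, hC₃, hP⟩ := exists_sum_twin_le hTPC
  obtain ⟨C₄, hC₄, hK⟩ := exists_sum_fejerKer_sub_le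
  obtain ⟨C₅, hC₅, hS⟩ := exists_twin_bounds hTPC
  refine ⟨4 * C₁ + 24 * C₂ + 32 * C₃ + 6 * (C₄ * C₅), by positivity,
    fun T x V W h N hT hTx hxT hTV hVW hWT hh => ?_⟩
  have hT0 : 0 < T := by linarith
  have hx : 0 < x := lt_of_lt_of_le (by positivity) hTx
  have hV : 0 < V := by linarith
  have hW : 0 < W := by linarith
  have hh1 : (1 : ℝ) ≤ h := by exact_mod_cast hh
  have hh0 : (0 : ℝ) < h := by linarith
  set H := (h : ℝ) ^ (-(11 / 10) : ℝ) with hH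
  have hH0 : 0 < H := by positivity
  set R := x * T ^ (1999 / 1000 : ℝ) with hR
  have hR0 : 0 < R := by positivity
  have hWV : 0 ≤ (W - V) * x ^ 2 := mul_nonneg (by linarith) (by positivity)
  have expand : ∀ n, coef x n * coef x (n + h) *
      (fejerKer W (Real.log (n + h : ℕ) - Real.log n) -
        fejerKer V (Real.log (n + h : ℕ) - Real.log n)) =
      coef x n * coef x (n + h) * fejerKer W (Real.log (n + h : ℕ) - Real.log n) -
      coef x n * coef x (n + h) * fejerKer V (Real.log (n + h : ℕ) - Real.log n) :=
    fun n => mul_sub _ _ _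
  simp_rw [expand]
  rw [Finset.sum_sub_distrib]
  have hxp : ∀ p : ℝ, 0 ≤ p → x ^ p ≤ T ^ p := fun p hp => by gcongr
  have hxn : ∀ p q : ℝ, 0 ≤ p → q ≤ 999 / 1000 * p → x ^ (-p) ≤ T ^ (-q) := fun p q hp hq => by
    calc x ^ (-p) ≤ (T ^ (999 / 1000 : ℝ)) ^ (-p) :=
          Real.rpow_le_rpow_of_nonpos (by positivity) hTx (by linarith)
      _ = T ^ (999 / 1000 * -p) := (Real.rpow_mul hT0.le _ _).symm
      _ ≤ T ^ (-q) := Real.rpow_le_rpow_of_exponent_le hT (by linarith)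
  rcases le_or_gt (h : ℝ) (T ^ (1 / 20 : ℝ)) with hhT | hhT
  · have hhp : ∀ p : ℝ, -(11 / 10) ≤ p → p ≤ 29 / 10 → (h : ℝ) ^ p ≤ T ^ (1 / 5 : ℝ) * H := by
      intro p h1 h2
      calc (h : ℝ) ^ p = (h : ℝ) ^ (p + 11 / 10) * H := by rw [hH, ← Real.rpow_add hh0]; norm_num
        _ ≤ (T ^ (1 / 20 : ℝ)) ^ (p + 11 / 10) * H := by
            gcongr
            linarith
        _ = T ^ (1 / 20 * (p + 11 / 10)) * H := by rw [← Real.rpow_mul hT0.le]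
        _ ≤ _ := by
            gcongr
            linarith
    have hRT : ∀ p : ℝ, p ≤ 2998 / 1000 → T ^ p ≤ R := fun p hp => by
      calc T ^ p ≤ T ^ (999 / 1000 + 1999 / 1000 : ℝ) :=
            Real.rpow_le_rpow_of_exponent_le hT (by linarith)
        _ = T ^ (999 / 1000 : ℝ) * T ^ (1999 / 1000 : ℝ) := Real.rpow_add hT0 _ _
        _ ≤ _ := by rw [hR]; gcongr
    have t1 : ∀ U, 0 < U → U ≤ 2 * T → (h : ℝ) ^ (1001 / 1000 : ℝ) * U ^ 2 * x ^ (3 / 1000 : ℝ) +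
        (h : ℝ) ^ (2001 / 1000 : ℝ) * U ^ 3 * x ^ (-(997 / 1000) : ℝ) ≤ 12 * (R * H) := by
      intro U hU hUT
      have a1 : (h : ℝ) ^ (1001 / 1000 : ℝ) * U ^ 2 * x ^ (3 / 1000 : ℝ) ≤ 4 * (R * H) := by
        calc _ ≤ (T ^ (1 / 5 : ℝ) * H) * (2 * T) ^ 2 * T ^ (3 / 1000 : ℝ) := by
              gcongr
              · exact hhp _ (by norm_num) (by norm_num)
          _ = 4 * (T ^ (1 / 5 + 2 + 3 / 1000 : ℝ) * H) := by
              rw [Real.rpow_add hT0, Real.rpow_add hT0, Real.rpow_two]; ring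
          _ ≤ _ := by
              gcongr
              exact hRT _ (by norm_num)
      have a2 : (h : ℝ) ^ (2001 / 1000 : ℝ) * U ^ 3 * x ^ (-(997 / 1000) : ℝ) ≤ 8 * (R * H) := by
        calc _ ≤ (T ^ (1 / 5 : ℝ) * H) * (2 * T) ^ 3 * T ^ (-(9 / 10) : ℝ) := by
              gcongr ?_ * ?_ * ?_
              · exact hhp _ (by norm_num) (by norm_num)
              · gcongr
              · exact hxn _ _ (by norm_num) (by norm_num)
          _ = 8 * (T ^ (1 / 5 + 3 + -(9 / 10) : ℝ) * H) := by
              rw [Real.rpow_add hT0, Real.rpow_add hT0, show (3 : ℝ) = (3 : ℕ) by norm_num,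
                Real.rpow_natCast]; ring
          _ ≤ _ := by
              gcongr
              exact hRT _ (by norm_num)
      linarith
    have t2 : ∀ U, 0 < U → U ≤ 2 * T → (h : ℝ) ^ (11 / 10 : ℝ) *
        (U ^ 2 * (x ^ (6 / 10 : ℝ) + x ^ (601 / 1000 : ℝ)) +
          h * U ^ 3 * x ^ (-(399 / 1000) : ℝ)) ≤ 16 * (R * H) := by
      intro U hU hUT
      have a1 : (h : ℝ) ^ (11 / 10 : ℝ) * (U ^ 2 * (x ^ (6 / 10 : ℝ) + x ^ (601 / 1000 : ℝ))) ≤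
          8 * (R * H) := by
        have b1 : x ^ (6 / 10 : ℝ) ≤ T ^ (601 / 1000 : ℝ) := (hxp _ (by norm_num)).trans
          (Real.rpow_le_rpow_of_exponent_le hT (by norm_num))
        have b2 : x ^ (601 / 1000 : ℝ) ≤ T ^ (601 / 1000 : ℝ) := hxp _ (by norm_num)
        calc _ ≤ (T ^ (1 / 5 : ℝ) * H) * ((2 * T) ^ 2 *
              (T ^ (601 / 1000 : ℝ) + T ^ (601 / 1000 : ℝ))) := by
              gcongr
              · exact hhp _ (by norm_num) (by norm_num)
          _ = 8 * (T ^ (1 / 5 + 2 + 601 / 1000 : ℝ) * H) := by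
              rw [Real.rpow_add hT0, Real.rpow_add hT0, Real.rpow_two]; ring
          _ ≤ _ := by
              gcongr
              exact hRT _ (by norm_num)
      have a2 : (h : ℝ) ^ (11 / 10 : ℝ) * (h * U ^ 3 * x ^ (-(399 / 1000) : ℝ)) ≤ 8 * (R * H) := by
        calc _ = (h : ℝ) ^ (21 / 10 : ℝ) * U ^ 3 * x ^ (-(399 / 1000) : ℝ) := by
              rw [show (21 / 10 : ℝ) = 11 / 10 + 1 by norm_num, Real.rpow_add hh0, Real.rpow_one]
              ring
          _ ≤ (T ^ (1 / 5 : ℝ) * H) * (2 * T) ^ 3 * T ^ (-(39 / 100) : ℝ) := by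
              gcongr ?_ * ?_ * ?_
              · exact hhp _ (by norm_num) (by norm_num)
              · gcongr
              · exact hxn _ _ (by norm_num) (by norm_num)
          _ = 8 * (T ^ (1 / 5 + 3 + -(39 / 100) : ℝ) * H) := by
              rw [Real.rpow_add hT0, Real.rpow_add hT0, show (3 : ℝ) = (3 : ℕ) by norm_num,
                Real.rpow_natCast]; ring
          _ ≤ _ := by
              gcongr
              exact hRT _ (by norm_num)
      rw [mul_add]
      linarith
    have t3 : |singularSeries h| * (C₄ * ((W - V) * (x ^ 3 / (V * h ^ 2) + x ^ (1001 / 1000 : ℝ) +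
        W * x ^ (1 / 1000 : ℝ)))) ≤ 6 * (C₄ * C₅) * (((W - V) * x ^ 2 + R) * H) := by
      have hWV' : 0 ≤ W - V := by linarith
      have a1 : (h : ℝ) ^ (1 / 10 : ℝ) * ((W - V) * (x ^ 3 / (V * h ^ 2))) ≤
          2 * ((W - V) * x ^ 2 * H) := by
        calc _ = (W - V) * x ^ 2 * (x / V) * (h : ℝ) ^ (-(19 / 10) : ℝ) := by
              rw [show (-(19 / 10) : ℝ) = 1 / 10 - 2 by norm_num, Real.rpow_sub hh0, Real.rpow_two]
              field_simp
          _ ≤ (W - V) * x ^ 2 * 2 * H := by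
              rw [hH]
              gcongr
              · rw [div_le_iff₀ hV]; linarith
              norm_num
          _ = _ := by ring
      have a2 : (h : ℝ) ^ (1 / 10 : ℝ) * ((W - V) * (x ^ (1001 / 1000 : ℝ) +
          W * x ^ (1 / 1000 : ℝ))) ≤ 6 * (R * H) := by
        have b1 : x ^ (1001 / 1000 : ℝ) ≤ T ^ (1001 / 1000 : ℝ) := hxp _ (by norm_num)
        have b2 : x ^ (1 / 1000 : ℝ) ≤ T ^ (1 / 1000 : ℝ) := hxp _ (by norm_num)
        calc _ ≤ (T ^ (1 / 5 : ℝ) * H) * ((2 * T) * (T ^ (1001 / 1000 : ℝ) +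
              (2 * T) * T ^ (1 / 1000 : ℝ))) := by
              gcongr
              · exact hhp _ (by norm_num) (by norm_num)
              · linarith
          _ = 6 * (T ^ (1 / 5 + 2 + 1 / 1000 : ℝ) * H) := by
              rw [Real.rpow_add hT0, Real.rpow_add hT0, Real.rpow_two,
                show (1001 / 1000 : ℝ) = 1 + 1 / 1000 by norm_num, Real.rpow_add hT0, Real.rpow_one]
              ring
          _ ≤ _ := by
              gcongr
              exact hRT _ (by norm_num)
      calc _ ≤ (C₅ * (h : ℝ) ^ (1 / 10 : ℝ)) * (C₄ * ((W - V) * (x ^ 3 / (V * h ^ 2) +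
            x ^ (1001 / 1000 : ℝ) + W * x ^ (1 / 1000 : ℝ)))) := by
            gcongr
            exact (hS h hh).1
        _ = C₄ * C₅ * ((h : ℝ) ^ (1 / 10 : ℝ) * ((W - V) * (x ^ 3 / (V * h ^ 2))) +
            (h : ℝ) ^ (1 / 10 : ℝ) * ((W - V) * (x ^ (1001 / 1000 : ℝ) +
              W * x ^ (1 / 1000 : ℝ)))) := by ring
        _ ≤ C₄ * C₅ * (2 * ((W - V) * x ^ 2 * H) + 6 * (R * H)) := by gcongr
        _ ≤ C₄ * C₅ * (6 * ((W - V) * x ^ 2 * H) + 6 * (R * H)) := by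
            have : 0 ≤ (W - V) * x ^ 2 * H := by positivity
            gcongr
            norm_num
        _ = _ := by ring
    have step : ∀ U, 0 < U → U ≤ 2 * T →
        |∑ n ∈ Finset.range (N + 1), coef x n * coef x (n + h) *
          fejerKer U (Real.log (n + h : ℕ) - Real.log n) -
        singularSeries h * ∑ n ∈ Finset.range (N + 1), wt x n ^ 2 * fejerKer U (h / n)| ≤
          (12 * C₂ + 16 * C₃) * (R * H) := by
      intro U hU hUT
      have p1 := (hB x U h (N + 1) hx hU.le hh).trans (mul_le_mul_of_nonneg_left (t1 U hU hUT) hC₂.le)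
      have p2 := (hP x U h N hx hU.le hh).trans (mul_le_mul_of_nonneg_left (t2 U hU hUT) hC₃.le)
      have p3 := (Finset.abs_sum_le_sum_abs _ _).trans p1
      rw [Finset.sum_sub_distrib] at p3
      have e : ∑ n ∈ Finset.range (N + 1), wt x n ^ 2 * fejerKer U (h / n) *
          (ArithmeticFunction.vonMangoldt n * ArithmeticFunction.vonMangoldt (n + h)) =
          ∑ n ∈ Finset.range (N + 1), ArithmeticFunction.vonMangoldt n *
            ArithmeticFunction.vonMangoldt (n + h) * (wt x n ^ 2 * fejerKer U (h / n)) :=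
        Finset.sum_congr rfl fun n _ => mul_comm _ _
      rw [e] at p2
      refine (abs_sub_le _ _ _).trans ((add_le_add p3 p2).trans (le_of_eq (by ring)))
    have p4 := mul_le_mul_of_nonneg_left (hK x V W h (N + 1) hx hV hVW hh)
      (abs_nonneg (singularSeries h))
    rw [← abs_mul, mul_sub] at p4
    have p5 := p4.trans t3
    have p6 := step V hV (by linarith)
    have p7 := step W hW hWT
    have e1 : C₁ * (((W - V) * x ^ 2 + R) * H) ≥ 0 := by positivity
    have e2 : (12 * C₂ + 16 * C₃) * (R * H) ≤ (12 * C₂ + 16 * C₃) * (((W - V) * x ^ 2 + R) * H) := by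
      gcongr
      linarith
    rw [mul_assoc]
    rw [abs_le] at p5 p6 p7 ⊢
    constructor <;> linarith [p5.1, p5.2, p6.1, p6.2, p7.1, p7.2]
  · have t1 : ∀ U, 0 < U → U ≤ 2 * T →
        |∑ n ∈ Finset.range (N + 1), coef x n * coef x (n + h) *
          fejerKer U (Real.log (n + h : ℕ) - Real.log n)| ≤ 2 * C₁ * (R * H) := by
      intro U hU hUT
      refine (Finset.abs_sum_le_sum_abs _ _).trans ((hA x U h (N + 1) hx hU.le hh).trans ?_)
      have a1 : U ^ (1 / 2 : ℝ) ≤ 2 * T ^ (1 / 2 : ℝ) := by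
        calc _ ≤ (2 * T) ^ (1 / 2 : ℝ) := by gcongr
          _ = 2 ^ (1 / 2 : ℝ) * T ^ (1 / 2 : ℝ) := Real.mul_rpow (by norm_num) hT0.le
          _ ≤ 2 ^ (1 : ℝ) * T ^ (1 / 2 : ℝ) := by gcongr <;> norm_num
          _ = _ := by rw [Real.rpow_one]
      have a2 : x ^ (2503 / 1000 : ℝ) ≤ x * T ^ (1503 / 1000 : ℝ) := by
        rw [show (2503 / 1000 : ℝ) = 1 + 1503 / 1000 by norm_num, Real.rpow_add hx, Real.rpow_one]
        gcongr
      have a3 : (h : ℝ) ^ (-(1499 / 1000) : ℝ) ≤ T ^ (-(399 / 20000) : ℝ) * H := by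
        rw [show (-(1499 / 1000) : ℝ) = -(399 / 1000) + -(11 / 10) by norm_num, Real.rpow_add hh0]
        gcongr
        calc _ ≤ (T ^ (1 / 20 : ℝ)) ^ (-(399 / 1000) : ℝ) :=
              Real.rpow_le_rpow_of_nonpos (by positivity) hhT.le (by norm_num)
          _ = _ := by rw [← Real.rpow_mul hT0.le]; norm_num
      calc _ ≤ C₁ * ((2 * T ^ (1 / 2 : ℝ)) * (x * T ^ (1503 / 1000 : ℝ)) *
            (T ^ (-(399 / 20000) : ℝ) * H)) := by gcongr
        _ = 2 * C₁ * (x * T ^ (1 / 2 + 1503 / 1000 + -(399 / 20000) : ℝ) * H) := by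
            rw [Real.rpow_add hT0, Real.rpow_add hT0]; ring
        _ ≤ _ := by
            rw [hR]
            gcongr
            norm_num
    have p6 := t1 V hV (by linarith)
    have p7 := t1 W hW hWT
    have e2 : 4 * C₁ * (R * H) ≤ (4 * C₁ + 24 * C₂ + 32 * C₃ + 6 * (C₄ * C₅)) *
        (((W - V) * x ^ 2 + R) * H) := by
      gcongr
      · have : 0 ≤ C₄ * C₅ := by positivity
        linarith
      · linarith
    rw [mul_assoc]
    refine (abs_sub _ _).trans (le_trans ?_ e2)
    linarith

lemma monotoneOn_meanSq {x : ℝ} (hx : 0 < x) : MonotoneOn (meanSq x) (Set.Ici 0) := by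
  intro v hv w _ hvw
  refine intervalIntegral.integral_mono_interval (by linarith) ?_ hvw
    (Filter.Eventually.of_forall fun t => by positivity)
    (((continuous_dirSum hx).norm.pow 2).intervalIntegrable _ _)
  have : (0 : ℝ) ≤ v := hv
  linarith

lemma intervalIntegrable_meanSq {x : ℝ} (hx : 0 < x) {V W : ℝ} (hV : 0 ≤ V) (hW : 0 ≤ W) :
    IntervalIntegrable (meanSq x) volume V W :=
  ((monotoneOn_meanSq hx).mono fun _ hy => (le_min hV hW).trans hy.1).intervalIntegrable

/-- The increments of the integrated mean square are governed by the diagonal. -/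
lemma exists_integral_meanSq_sub_le (hTPC : TwinPrimeConjecture) : ∃ C > 0, ∀ T x V W : ℝ,
    1 ≤ T → T ^ (999 / 1000 : ℝ) ≤ x → x ≤ T → T / 2 ≤ V → V ≤ W → W ≤ 2 * T →
    |(∫ v in V..W, meanSq x v) - (W ^ 2 - V ^ 2) * ∑' n, coef x n ^ 2| ≤
      C * ((W - V) * x ^ 2 + x * T ^ (1999 / 1000 : ℝ)) := by
  obtain ⟨C, hC, hO⟩ := exists_shift_sum_le hTPC
  have hs : Summable fun k : ℕ => ((k + 1 : ℕ) : ℝ) ^ (-(11 / 10) : ℝ) :=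
    (summable_nat_add_iff 1).mpr (Real.summable_nat_rpow.mpr (by norm_num))
  have hs0 : 0 ≤ ∑' k : ℕ, ((k + 1 : ℕ) : ℝ) ^ (-(11 / 10) : ℝ) :=
    tsum_nonneg fun _ => by positivity
  refine ⟨2 * C * (∑' k : ℕ, ((k + 1 : ℕ) : ℝ) ^ (-(11 / 10) : ℝ)) + 1, by positivity,
    fun T x V W hT hTx hxT hTV hVW hWT => ?_⟩
  have hx : 0 < x := lt_of_lt_of_le (by positivity) hTx
  have hV : 0 < V := by linarith
  have hW : 0 < W := by linarith
  set f : ℕ × ℕ → ℝ := fun p => coef x p.1 * coef x p.2 *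
    fejerKer W (Real.log p.1 - Real.log p.2) - coef x p.1 * coef x p.2 *
    fejerKer V (Real.log p.1 - Real.log p.2) with hf
  have h1 : HasSum f (∫ v in V..W, meanSq x v) := by
    rw [← intervalIntegral.integral_interval_sub_left (a := 0)
      (intervalIntegrable_meanSq hx le_rfl hW.le) (intervalIntegrable_meanSq hx le_rfl hV.le)]
    exact (hasSum_integral_meanSq hx hW.le).sub (hasSum_integral_meanSq hx hV.le)
  have hsym : ∀ m n, f (m, n) = f (n, m) := fun m n => by
    simp only [hf]
    rw [← neg_sub (Real.log n) (Real.log m), fejerKer_neg, fejerKer_neg]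
    ring
  obtain ⟨h2, h3⟩ := hasSum_diag_offDiag h1.summable hsym
  rw [h1.tsum_eq] at h3
  have h4 : ∑' n, f (n, n) = (W ^ 2 - V ^ 2) * ∑' n, coef x n ^ 2 := by
    rw [← tsum_mul_left]
    refine tsum_congr fun n => ?_
    simp only [hf, sub_self, fejerKer_zero]
    ring
  set B := C * ((W - V) * x ^ 2 + x * T ^ (1999 / 1000 : ℝ)) with hB
  have h5 : |∑' p : ℕ × ℕ, f (p.1, p.1 + p.2 + 1)| ≤
      B * ∑' k : ℕ, ((k + 1 : ℕ) : ℝ) ^ (-(11 / 10) : ℝ) := by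
    have h6 := h2.prod_symm
    have h7 := h6.tsum_prod
    have h8 := (Equiv.prodComm ℕ ℕ).tsum_eq fun p : ℕ × ℕ => f (p.1, p.1 + p.2 + 1)
    rw [← h8]
    simp only [Equiv.prodComm_apply, Prod.fst_swap, Prod.snd_swap] at h7 ⊢
    rw [h7, ← tsum_mul_left, ← Real.norm_eq_abs]
    refine tsum_of_norm_bounded (hs.mul_left B).hasSum fun k => ?_
    have h9 := ((h6.prod_factor k).hasSum.tendsto_sum_nat.comp (Filter.tendsto_add_atTop_nat 1)).norm
    refine le_of_tendsto' h9 fun N => ?_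
    rw [Real.norm_eq_abs]
    refine le_trans (le_of_eq ?_) (hO T x V W (k + 1) N hT hTx hxT hTV hVW hWT k.succ_pos)
    congr 1
    refine Finset.sum_congr rfl fun n _ => ?_
    simp only [hf, Prod.swap_prod_mk]
    rw [add_assoc, ← neg_sub (Real.log (n + (k + 1) : ℕ)) (Real.log n), fejerKer_neg, fejerKer_neg]
    ring
  have hB0 : 0 ≤ (W - V) * x ^ 2 + x * T ^ (1999 / 1000 : ℝ) :=
    add_nonneg (mul_nonneg (by linarith) (by positivity)) (by positivity)
  rw [h3, h4, add_sub_cancel_left, abs_mul, abs_two]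
  calc _ ≤ 2 * (B * ∑' k : ℕ, ((k + 1 : ℕ) : ℝ) ^ (-(11 / 10) : ℝ)) := by gcongr
    _ = 2 * C * (∑' k : ℕ, ((k + 1 : ℕ) : ℝ) ^ (-(11 / 10) : ℝ)) *
        ((W - V) * x ^ 2 + x * T ^ (1999 / 1000 : ℝ)) := by rw [hB]; ring
    _ ≤ _ := by
        gcongr
        linarith

/-- The mean square itself, with a free smoothing parameter. -/
lemma exists_meanSq_sub_le (hTPC : TwinPrimeConjecture) : ∃ C > 0, ∀ T x U : ℝ,
    1 ≤ T → T ^ (999 / 1000 : ℝ) ≤ x → x ≤ T → 0 < U → U ≤ T / 2 →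
    |meanSq x T - 2 * T * ∑' n, coef x n ^ 2| ≤
      U * ∑' n, coef x n ^ 2 + C * (x ^ 2 + x * T ^ (1999 / 1000 : ℝ) / U) := by
  obtain ⟨C, hC, hI⟩ := exists_integral_meanSq_sub_le hTPC
  refine ⟨C, hC, fun T x U hT hTx hxT hU hUT => ?_⟩
  have hx : 0 < x := lt_of_lt_of_le (by positivity) hTx
  have hmono := monotoneOn_meanSq hx
  set Q := ∑' n, coef x n ^ 2 with hQ
  have h1 := (abs_le.mp (hI T x T (T + U) hT hTx hxT (by linarith) (by linarith) (by linarith))).2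
  have h2 := (abs_le.mp (hI T x (T - U) T hT hTx hxT (by linarith) (by linarith) (by linarith))).1
  have h3 : U * meanSq x T ≤ ∫ v in T..(T + U), meanSq x v := by
    have := intervalIntegral.integral_mono_on (a := T) (b := T + U) (μ := volume)
      (f := fun _ => meanSq x T) (g := meanSq x) (by linarith) intervalIntegrable_const
      (intervalIntegrable_meanSq hx (by linarith) (by linarith))
      fun v hv => hmono (Set.mem_Ici.mpr (by linarith)) (Set.mem_Ici.mpr (by linarith [hv.1])) hv.1
    simpa using this
  have h4 : ∫ v in (T - U)..T, meanSq x v ≤ U * meanSq x T := by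
    have := intervalIntegral.integral_mono_on (a := T - U) (b := T) (μ := volume)
      (g := fun _ => meanSq x T) (f := meanSq x) (by linarith)
      (intervalIntegrable_meanSq hx (by linarith) (by linarith)) intervalIntegrable_const
      fun v hv => hmono (Set.mem_Ici.mpr (by linarith [hv.1])) (Set.mem_Ici.mpr (by linarith)) hv.2
    simpa using this
  have e : x * T ^ (1999 / 1000 : ℝ) = U * (x * T ^ (1999 / 1000 : ℝ) / U) := by field_simp
  rw [e] at h1 h2
  set R := x * T ^ (1999 / 1000 : ℝ) / U
  rw [abs_le]
  constructor <;> refine le_of_mul_le_mul_left ?_ hU <;> linarith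

/-! ### The diagonal terms -/

/-- The weight `min((n/x)^p, (x/n)^q)`, of which `wt x n ^ 2` is the case `p = 1`, `q = 3`. -/
noncomputable def powKer (p q x : ℝ) (n : ℕ) : ℝ :=
  if (n : ℝ) ≤ x then (n / x : ℝ) ^ p else (x / n : ℝ) ^ q

lemma powKer_nonneg {x : ℝ} (hx : 0 < x) (p q : ℝ) (n : ℕ) : 0 ≤ powKer p q x n := by
  unfold powKer; split_ifs <;> positivity

lemma wt_sq_eq_powKer {x : ℝ} (hx : 0 < x) (n : ℕ) : wt x n ^ 2 = powKer 1 3 x n := by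
  unfold wt powKer
  split_ifs
  all_goals
    rw [← Real.rpow_natCast, ← Real.rpow_mul (by positivity)]
    norm_num

lemma powKer_mul_rpow {x : ℝ} (hx : 0 < x) {n : ℕ} (hn : 0 < n) (p q η : ℝ) :
    powKer p q x n * (n / x : ℝ) ^ η = powKer (p + η) (q - η) x n := by
  have hn0 : (0 : ℝ) < n := by exact_mod_cast hn
  unfold powKer
  split_ifs
  · rw [Real.rpow_add (by positivity)]
  · rw [← inv_div x (n : ℝ), Real.inv_rpow (by positivity), ← div_eq_mul_inv,
      Real.rpow_sub (by positivity)]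

lemma twoKernel_eq_powKer {x : ℝ} (hx : 0 < x) {n : ℕ} (hn : n ≠ 0) (p q : ℝ) :
    twoKernel (q : ℝ) (-p : ℝ) (Real.log n) (Real.log x) = powKer p q x n := by
  have hn0 : (0 : ℝ) < n := by positivity
  unfold twoKernel powKer
  simp only [Real.log_le_log_iff hn0 hx]
  split_ifs with h
  · rw [Real.rpow_def_of_pos (by positivity), Real.log_div hn0.ne' hx.ne', Complex.ofReal_exp]
    congr 1; push_cast; ring
  · rw [Real.rpow_def_of_pos (by positivity), Real.log_div hx.ne' hn0.ne', Complex.ofReal_exp]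
    congr 1; push_cast; ring

lemma vonMangoldt_mul_twoKernel {x : ℝ} (hx : 0 < x) (p q : ℝ) (n : ℕ) :
    (ArithmeticFunction.vonMangoldt n : ℂ) *
        twoKernel (q : ℝ) (-p : ℝ) (Real.log n) (Real.log x) =
      ((ArithmeticFunction.vonMangoldt n * powKer p q x n : ℝ) : ℂ) := by
  rcases eq_or_ne n 0 with rfl | hn
  · simp
  · rw [twoKernel_eq_powKer hx hn, Complex.ofReal_mul]

lemma summable_vonMangoldt_powKer {x p q : ℝ} (hx : 0 < x) (hq : 1 < q) (hpq : -p ≤ q) :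
    Summable fun n : ℕ => ArithmeticFunction.vonMangoldt n * powKer p q x n := by
  have h := summable_vonMangoldt_twoKernel (s₁ := (q : ℝ)) (s₂ := (-p : ℝ)) (by simpa using hq)
    (by simpa using hpq) (Real.log x)
  simp only [vonMangoldt_mul_twoKernel hx] at h
  exact Complex.summable_ofReal.mp h

/-- The prime number theorem under RH, for the weights `powKer p q x`. -/
lemma exists_sum_powKer_sub_le (hRH : RiemannHypothesis) : ∃ C > 0, ∀ x p q : ℝ, 1 < x →
    1 / 2 ≤ p → p ≤ 3 / 2 → 5 / 2 ≤ q → q ≤ 7 / 2 →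
    |∑' n : ℕ, ArithmeticFunction.vonMangoldt n * powKer p q x n - x * (1 / (q - 1) + 1 / (1 + p))| ≤
      C * √x := by
  obtain ⟨C, hC, hE⟩ := exists_explicit_formula_bound hRH
  set S := ∑' ρ : {ρ : ℂ // IsNontrivialZero ρ}, (zetaZeroOrder ρ : ℝ) / (1 + (ρ : ℂ).im ^ 2) with hS
  have hS0 : 0 ≤ S := tsum_nonneg fun ρ => by positivity
  refine ⟨5 * S + C * (1 + 5 * S), by positivity, fun x p q hx hp hp' hq hq' => ?_⟩
  have hx0 : 0 < x := by linarith
  have hsx : 1 ≤ √x := Real.one_le_sqrt.mpr hx.le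
  set s₁ : ℂ := (q : ℂ) with hs₁
  set s₂ : ℂ := ((-p : ℝ) : ℂ) with hs₂
  have hd : ‖s₁ - s₂‖ ≤ 5 := by
    rw [hs₁, hs₂, ← Complex.ofReal_sub, Complex.norm_real, Real.norm_eq_abs, abs_le]
    constructor <;> linarith
  obtain ⟨hs, hb⟩ := hE s₁ s₂ (by simp [hs₁]; linarith) (by simp [hs₂]; linarith)
    (by simp [hs₂]; linarith) hd (Real.log x) (Real.log_pos hx)
  have hcoef : ∀ ρ : {ρ : ℂ // IsNontrivialZero ρ}, (zetaZeroOrder ρ : ℝ) *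
      ‖1 / (s₂ - (ρ : ℂ)) - 1 / (s₁ - ρ)‖ ≤ 5 * ((zetaZeroOrder ρ : ℝ) / (1 + (ρ : ℂ).im ^ 2)) := by
    intro ρ
    have hr := ρ.2.re_eq hRH
    have lower : ∀ c : ℝ, 1 ≤ |c - 1 / 2| → √(1 + (ρ : ℂ).im ^ 2) ≤ ‖((c : ℝ) : ℂ) - ρ‖ := by
      intro c hc
      rw [Complex.norm_def, Complex.normSq_apply]
      apply Real.sqrt_le_sqrt
      simp only [Complex.sub_re, Complex.ofReal_re, hr, Complex.sub_im, Complex.ofReal_im]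
      have : 1 ≤ (c - 1 / 2) ^ 2 := by rw [← sq_abs]; exact one_le_pow₀ hc
      linarith
    have l1 := lower q (by rw [abs_of_nonneg] <;> linarith)
    have l2 := lower (-p) (by rw [abs_of_nonpos] <;> linarith)
    have hp1 : 0 < √(1 + (ρ : ℂ).im ^ 2) := Real.sqrt_pos.mpr (by positivity)
    have n1 : s₁ - ρ ≠ 0 := norm_pos_iff.mp (hp1.trans_le l1)
    have n2 : s₂ - ρ ≠ 0 := norm_pos_iff.mp (hp1.trans_le l2)
    have e : 1 / (s₂ - (ρ : ℂ)) - 1 / (s₁ - ρ) = (s₁ - s₂) / ((s₂ - ρ) * (s₁ - ρ)) := by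
      field_simp; ring
    have hm : 1 + (ρ : ℂ).im ^ 2 ≤ ‖s₂ - ρ‖ * ‖s₁ - ρ‖ := by
      calc _ = √(1 + (ρ : ℂ).im ^ 2) * √(1 + (ρ : ℂ).im ^ 2) :=
            (Real.mul_self_sqrt (by positivity)).symm
        _ ≤ _ := mul_le_mul l2 l1 hp1.le (norm_nonneg _)
    rw [e, norm_div, norm_mul]
    calc _ ≤ (zetaZeroOrder ρ : ℝ) * (5 / (1 + (ρ : ℂ).im ^ 2)) := by gcongr
      _ = _ := by ring
  have hsum := (summable_nontrivial hRH).mul_left 5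
  have hsn : Summable fun ρ : {ρ : ℂ // IsNontrivialZero ρ} => (zetaZeroOrder ρ : ℝ) *
      ‖1 / (s₂ - (ρ : ℂ)) - 1 / (s₁ - ρ)‖ := hsum.of_nonneg_of_le (fun _ => by positivity) hcoef
  have hS5 : ∑' ρ : {ρ : ℂ // IsNontrivialZero ρ}, (zetaZeroOrder ρ : ℝ) *
      ‖1 / (s₂ - (ρ : ℂ)) - 1 / (s₁ - ρ)‖ ≤ 5 * S := by
    rw [hS, ← tsum_mul_left]
    exact hsn.tsum_le_tsum hcoef hsum
  have hZ : ‖∑' ρ : {ρ : ℂ // IsNontrivialZero ρ}, (zetaZeroOrder ρ : ℂ) *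
      (1 / (s₂ - ρ) - 1 / (s₁ - ρ)) * Complex.exp (ρ * (Real.log x : ℝ))‖ ≤ 5 * S * √x := by
    refine (tsum_of_norm_bounded (hsn.mul_right √x).hasSum fun ρ => ?_).trans ?_
    · have e : ‖Complex.exp (ρ * (Real.log x : ℝ))‖ = √x := by
        rw [Complex.norm_exp, Real.sqrt_eq_rpow, Real.rpow_def_of_pos hx0]
        simp [ρ.2.re_eq hRH, mul_comm]
      rw [norm_mul, norm_mul, e, Complex.norm_natCast]
    · rw [tsum_mul_right]; gcongr
  have hmain : (s₁ - s₂) / ((s₁ - 1) * (1 - s₂)) * Complex.exp (Real.log x : ℝ) =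
      ((x * (1 / (q - 1) + 1 / (1 + p)) : ℝ) : ℂ) := by
    rw [← Complex.ofReal_exp, Real.exp_log hx0, hs₁, hs₂]
    have h1 : q - 1 ≠ 0 := by linarith
    have h2 : 1 + p ≠ 0 := by linarith
    norm_cast
    rw [sub_neg_eq_add, sub_neg_eq_add]
    field_simp
    ring
  have hexp : Real.exp (s₂.re * Real.log x) ≤ √x := by
    refine le_trans ?_ hsx
    rw [Real.exp_le_one_iff]
    have := Real.log_pos hx
    simp only [hs₂, Complex.ofReal_re]
    nlinarith
  simp only [hs₁, hs₂, vonMangoldt_mul_twoKernel hx0] at hb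
  rw [← hs₁, ← hs₂, hmain, ← Complex.ofReal_tsum] at hb
  set Z := ∑' ρ : {ρ : ℂ // IsNontrivialZero ρ}, (zetaZeroOrder ρ : ℂ) *
      (1 / (s₂ - ρ) - 1 / (s₁ - ρ)) * Complex.exp (ρ * (Real.log x : ℝ))
  set A := ∑' n : ℕ, ArithmeticFunction.vonMangoldt n * powKer p q x n
  rw [← Real.norm_eq_abs, ← Complex.norm_real, Complex.ofReal_sub]
  calc _ ≤ ‖(A : ℂ) - ((x * (1 / (q - 1) + 1 / (1 + p)) : ℝ) : ℂ) - Z‖ + ‖Z‖ := by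
        simpa using norm_add_le ((A : ℂ) - ((x * (1 / (q - 1) + 1 / (1 + p)) : ℝ) : ℂ) - Z) Z
    _ ≤ C * (1 + 5 * S) * √x + 5 * S * √x := by
        refine add_le_add (hb.trans ?_) hZ
        have h0 : 0 ≤ ∑' ρ : {ρ : ℂ // IsNontrivialZero ρ}, (zetaZeroOrder ρ : ℝ) *
          ‖1 / (s₂ - (ρ : ℂ)) - 1 / (s₁ - ρ)‖ := tsum_nonneg fun _ => by positivity
        gcongr
    _ = _ := by ring

lemma log_le_rpow_sub_one_div {u η : ℝ} (hu : 0 < u) (hη : 0 < η) :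
    Real.log u ≤ (u ^ η - 1) / η := by
  rw [le_div_iff₀ hη, mul_comm, ← Real.log_rpow hu]
  exact Real.log_le_sub_one_of_pos (by positivity)

lemma one_sub_rpow_neg_div_le_log {u η : ℝ} (hu : 0 < u) (hη : 0 < η) :
    (1 - u ^ (-η)) / η ≤ Real.log u := by
  have h := log_le_rpow_sub_one_div (inv_pos.mpr hu) hη
  rw [Real.log_inv, Real.inv_rpow hu.le, ← Real.rpow_neg hu.le] at h
  linarith [show (1 - u ^ (-η)) / η = -((u ^ (-η) - 1) / η) by ring]

/-- The logarithm is nearly zero on average against the weight `wt x n ^ 2`. -/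
lemma exists_sum_log_div_le (hRH : RiemannHypothesis) : ∃ C > 0, ∀ x : ℝ, 16 ≤ x →
    (Summable fun n : ℕ => ArithmeticFunction.vonMangoldt n * wt x n ^ 2 * Real.log (n / x)) ∧
    |∑' n : ℕ, ArithmeticFunction.vonMangoldt n * wt x n ^ 2 * Real.log (n / x)| ≤
      C * x ^ (3 / 4 : ℝ) := by
  obtain ⟨C, hC, hP⟩ := exists_sum_powKer_sub_le hRH
  refine ⟨1 + 2 * C, by positivity, fun x hx => ?_⟩
  have hx0 : 0 < x := by linarith
  set η : ℝ := x ^ (-(1 / 4) : ℝ) with hηdef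
  have hη : 0 < η := by positivity
  have hη2 : η ≤ 1 / 2 := by
    calc η ≤ (16 : ℝ) ^ (-(1 / 4) : ℝ) :=
          Real.rpow_le_rpow_of_nonpos (by norm_num) hx (by norm_num)
      _ = 1 / 2 := by
          rw [show (16 : ℝ) = 2 ^ (4 : ℝ) by norm_num, ← Real.rpow_mul (by norm_num)]
          norm_num [Real.rpow_neg]
  have s0 := summable_vonMangoldt_powKer (p := 1) (q := 3) hx0 (by norm_num) (by norm_num)
  have sp := summable_vonMangoldt_powKer (p := 1 + η) (q := 3 - η) hx0 (by linarith) (by linarith)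
  have sm := summable_vonMangoldt_powKer (p := 1 - η) (q := 3 + η) hx0 (by linarith) (by linarith)
  have b0 := abs_le.mp (hP x 1 3 (by linarith) (by norm_num) (by norm_num) (by norm_num) (by norm_num))
  have bp := (abs_le.mp (hP x (1 + η) (3 - η) (by linarith) (by linarith) (by linarith) (by linarith)
    (by linarith))).2
  have bm := (abs_le.mp (hP x (1 - η) (3 + η) (by linarith) (by linarith) (by linarith) (by linarith)
    (by linarith))).2
  set f : ℕ → ℝ := fun n => ArithmeticFunction.vonMangoldt n * wt x n ^ 2 * Real.log (n / x) with hf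
  set S0 := ∑' n : ℕ, ArithmeticFunction.vonMangoldt n * powKer 1 3 x n
  have bounds : ∀ n : ℕ,
      (ArithmeticFunction.vonMangoldt n * powKer 1 3 x n -
        ArithmeticFunction.vonMangoldt n * powKer (1 - η) (3 + η) x n) / η ≤ f n ∧
      f n ≤ (ArithmeticFunction.vonMangoldt n * powKer (1 + η) (3 - η) x n -
        ArithmeticFunction.vonMangoldt n * powKer 1 3 x n) / η := by
    intro n
    rcases Nat.eq_zero_or_pos n with rfl | hn
    · simp [hf]
    have hn0 : (0 : ℝ) < n := by exact_mod_cast hn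
    have hu : 0 < (n / x : ℝ) := by positivity
    have e1 := powKer_mul_rpow hx0 hn 1 3 η
    have e2 := powKer_mul_rpow hx0 hn 1 3 (-η)
    rw [sub_neg_eq_add, ← sub_eq_add_neg] at e2
    have hw : 0 ≤ ArithmeticFunction.vonMangoldt n * powKer 1 3 x n :=
      mul_nonneg ArithmeticFunction.vonMangoldt_nonneg (powKer_nonneg hx0 _ _ _)
    simp only [hf, wt_sq_eq_powKer hx0]
    rw [← e1, ← e2]
    constructor
    · refine le_of_eq_of_le ?_ (mul_le_mul_of_nonneg_left (one_sub_rpow_neg_div_le_log hu hη) hw)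
      ring
    · refine (mul_le_mul_of_nonneg_left (log_le_rpow_sub_one_div hu hη) hw).trans_eq ?_
      ring
  have slo := (s0.sub sm).div_const η
  have sup := (sp.sub s0).div_const η
  have sf : Summable f := by
    have h := ((sup.sub slo).of_nonneg_of_le (fun n => sub_nonneg.mpr (bounds n).1)
      fun n => sub_le_sub_right (bounds n).2 _).add slo
    exact h.congr fun n => by ring
  have lo := slo.tsum_le_tsum (fun n => (bounds n).1) sf
  have hi := sf.tsum_le_tsum (fun n => (bounds n).2) sup
  rw [tsum_div_const, s0.tsum_sub sm, div_le_iff₀ hη] at lo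
  rw [tsum_div_const, sp.tsum_sub s0, le_div_iff₀ hη] at hi
  have hm : 1 / (2 - η) + 1 / (2 + η) ≤ 1 + η ^ 2 := by
    rw [div_add_div _ _ (by linarith) (by linarith), div_le_iff₀ (by nlinarith)]
    nlinarith [mul_nonneg (sq_nonneg η) (show 0 ≤ 3 - η ^ 2 by nlinarith)]
  have hxm := mul_le_mul_of_nonneg_left hm hx0.le
  have hxη : x * η = x ^ (3 / 4 : ℝ) := by
    rw [hηdef]
    nth_rewrite 1 [← Real.rpow_one x]
    rw [← Real.rpow_add hx0]; norm_num
  have hsη : √x = x ^ (3 / 4 : ℝ) * η := by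
    rw [hηdef, Real.sqrt_eq_rpow, ← Real.rpow_add hx0]; norm_num
  have key : (1 + 2 * C) * x ^ (3 / 4 : ℝ) * η = x * η ^ 2 + 2 * (C * √x) := by
    rw [hsη, ← hxη]; ring
  norm_num at b0
  rw [show 3 - η - 1 = 2 - η by ring, show 1 + (1 + η) = 2 + η by ring] at bp
  rw [show 3 + η - 1 = 2 + η by ring, show 1 + (1 - η) = 2 - η by ring] at bm
  refine ⟨sf, abs_le.mpr ⟨?_, ?_⟩⟩ <;> refine le_of_mul_le_mul_right ?_ hη
  · rw [neg_mul, key]; linarith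
  · rw [key]; linarith

/-- A prime power that is not prime is the product of a square and a cube. -/
lemma exists_eq_sq_mul_cube {n : ℕ}
    (h : ArithmeticFunction.vonMangoldt n * (Real.log n - ArithmeticFunction.vonMangoldt n) ≠ 0) :
    ∃ p : ℕ × ℕ, n = p.1 ^ 2 * p.2 ^ 3 := by
  have h1 : IsPrimePow n := ArithmeticFunction.vonMangoldt_ne_zero_iff.mp (left_ne_zero_of_mul h)
  obtain ⟨p, k, hp, hk, rfl⟩ := (isPrimePow_nat_iff n).mp h1
  have hk1 : k ≠ 1 := by
    rintro rfl
    exact right_ne_zero_of_mul h (by simp [ArithmeticFunction.vonMangoldt_apply_prime hp])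
  rcases Nat.even_or_odd' k with ⟨j, rfl | rfl⟩
  · exact ⟨(p ^ j, 1), by simp; ring⟩
  · obtain ⟨i, rfl⟩ : ∃ i, j = i + 1 := Nat.exists_eq_succ_of_ne_zero (by omega)
    exact ⟨(p ^ i, p), by simp; ring⟩

lemma log_sub_vonMangoldt_nonneg (n : ℕ) :
    0 ≤ ArithmeticFunction.vonMangoldt n * (Real.log n - ArithmeticFunction.vonMangoldt n) :=
  mul_nonneg ArithmeticFunction.vonMangoldt_nonneg
    (sub_nonneg.mpr ArithmeticFunction.vonMangoldt_le_log)

lemma summable_log_sub_vonMangoldt :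
    Summable fun n : ℕ => ArithmeticFunction.vonMangoldt n *
      (Real.log n - ArithmeticFunction.vonMangoldt n) * (n : ℝ) ^ (-(3 / 4) : ℝ) := by
  set S : Set ℕ := {n | ArithmeticFunction.vonMangoldt n *
    (Real.log n - ArithmeticFunction.vonMangoldt n) ≠ 0} with hS
  choose φ hφ using fun n : S => exists_eq_sq_mul_cube n.2
  have hinj : Function.Injective φ := fun m n h => Subtype.ext (by rw [hφ m, hφ n, h])
  have h1 : Summable fun b : ℕ => (b : ℝ) ^ (-(7 / 5) : ℝ) :=
    Real.summable_nat_rpow.mpr (by norm_num)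
  have h2 : Summable fun b : ℕ => (b : ℝ) ^ (-(21 / 10) : ℝ) :=
    Real.summable_nat_rpow.mpr (by norm_num)
  have h3 := ((h1.mul_of_nonneg h2 (fun _ => by positivity) fun _ => by positivity).mul_left
    1000000).comp_injective hinj
  have h4 : Summable fun n : S => ArithmeticFunction.vonMangoldt n *
      (Real.log n - ArithmeticFunction.vonMangoldt n) * ((n : ℕ) : ℝ) ^ (-(3 / 4) : ℝ) := by
    refine h3.of_nonneg_of_le
      (fun n => mul_nonneg (log_sub_vonMangoldt_nonneg n) (by positivity)) fun n => ?_
    have hn : (1 : ℝ) ≤ (n : ℕ) := by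
      have : (n : ℕ) ≠ 0 := fun h0 => n.2 (by simp [h0])
      exact_mod_cast Nat.one_le_iff_ne_zero.mpr this
    have hn0 : (0 : ℝ) < (n : ℕ) := by linarith
    have e1 := vonMangoldt_le_rpow n
    have e2 : Real.log (n : ℕ) - ArithmeticFunction.vonMangoldt n ≤
        1000 * ((n : ℕ) : ℝ) ^ (1 / 1000 : ℝ) := by
      have h5 := Real.log_le_rpow_div (x := (n : ℕ)) (ε := 1 / 1000) hn0.le (by norm_num)
      have h6 := ArithmeticFunction.vonMangoldt_nonneg (n := n)
      linarith
    have e3 : ((n : ℕ) : ℝ) ^ (-(7 / 10) : ℝ) =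
        ((φ n).1 : ℝ) ^ (-(7 / 5) : ℝ) * ((φ n).2 : ℝ) ^ (-(21 / 10) : ℝ) := by
      rw [hφ n]
      push_cast
      rw [Real.mul_rpow (by positivity) (by positivity), ← Real.rpow_natCast, ← Real.rpow_natCast,
        ← Real.rpow_mul (by positivity), ← Real.rpow_mul (by positivity)]
      norm_num
    simp only [Function.comp_apply]
    rw [← e3]
    calc _ ≤ 1000 * ((n : ℕ) : ℝ) ^ (1 / 1000 : ℝ) * (1000 * ((n : ℕ) : ℝ) ^ (1 / 1000 : ℝ)) *
          ((n : ℕ) : ℝ) ^ (-(3 / 4) : ℝ) := by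
          gcongr
          exact sub_nonneg.mpr ArithmeticFunction.vonMangoldt_le_log
      _ = 1000000 * ((n : ℕ) : ℝ) ^ (-(187 / 250) : ℝ) := by
          rw [show (-(187 / 250) : ℝ) = 1 / 1000 + 1 / 1000 + -(3 / 4) by norm_num,
            Real.rpow_add hn0, Real.rpow_add hn0]
          ring
      _ ≤ _ := by
          have := Real.rpow_le_rpow_of_exponent_le hn (show (-(187 / 250) : ℝ) ≤ -(7 / 10) by norm_num)
          linarith
  rw [← Function.comp_def (fun n : ℕ => ArithmeticFunction.vonMangoldt n *
      (Real.log n - ArithmeticFunction.vonMangoldt n) * (n : ℝ) ^ (-(3 / 4) : ℝ)) ((↑) : S → ℕ),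
    summable_subtype_iff_indicator] at h4
  refine h4.congr fun n => ?_
  by_cases h : n ∈ S
  · rw [Set.indicator_of_mem h]
  · rw [Set.indicator_of_notMem h, not_not.mp h, zero_mul]

/-- The diagonal sum: `∑ Λ(n)² wt(x, n)²` is `x log x` up to a power saving. -/
lemma exists_sum_coef_sq_sub_le (hRH : RiemannHypothesis) : ∃ C > 0, ∀ x : ℝ, 16 ≤ x →
    |∑' n, coef x n ^ 2 - x * Real.log x| ≤ C * x ^ (3 / 4 : ℝ) := by
  obtain ⟨C₁, hC₁, h1⟩ := exists_sum_powKer_sub_le hRH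
  obtain ⟨C₂, hC₂, h2⟩ := exists_sum_log_div_le hRH
  set D := ∑' n : ℕ, ArithmeticFunction.vonMangoldt n *
      (Real.log n - ArithmeticFunction.vonMangoldt n) * (n : ℝ) ^ (-(3 / 4) : ℝ) with hD
  have hD0 : 0 ≤ D := tsum_nonneg fun n => mul_nonneg (log_sub_vonMangoldt_nonneg n) (by positivity)
  refine ⟨4 * C₁ + C₂ + D, by positivity, fun x hx => ?_⟩
  have hx0 : 0 < x := by linarith
  obtain ⟨s2, b2⟩ := h2 x hx
  have b1 := h1 x 1 3 (by linarith) (by norm_num) (by norm_num) (by norm_num) (by norm_num)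
  have s1 := summable_vonMangoldt_powKer (p := 1) (q := 3) hx0 (by norm_num) (by norm_num)
  simp only [← wt_sq_eq_powKer hx0] at b1 s1
  norm_num at b1
  set A := ∑' n : ℕ, ArithmeticFunction.vonMangoldt n * wt x n ^ 2
  set L := ∑' n : ℕ, ArithmeticFunction.vonMangoldt n * wt x n ^ 2 * Real.log (n / x)
  set g : ℕ → ℝ := fun n => ArithmeticFunction.vonMangoldt n *
      (Real.log n - ArithmeticFunction.vonMangoldt n) * wt x n ^ 2 with hg
  have g0 : ∀ n, 0 ≤ g n := fun n => mul_nonneg (log_sub_vonMangoldt_nonneg n) (by positivity)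
  have gle : ∀ n, g n ≤ x ^ (3 / 4 : ℝ) * (ArithmeticFunction.vonMangoldt n *
      (Real.log n - ArithmeticFunction.vonMangoldt n) * (n : ℝ) ^ (-(3 / 4) : ℝ)) := by
    intro n
    rcases Nat.eq_zero_or_pos n with rfl | hn
    · simp [hg]
    calc g n ≤ ArithmeticFunction.vonMangoldt n *
          (Real.log n - ArithmeticFunction.vonMangoldt n) * (x / n : ℝ) ^ (3 / 4 : ℝ) :=
          mul_le_mul_of_nonneg_left (wt_sq_le_rpow hx0 hn (by norm_num) (by norm_num))
            (log_sub_vonMangoldt_nonneg n)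
      _ = _ := by
          rw [Real.div_rpow hx0.le (Nat.cast_nonneg n), Real.rpow_neg (Nat.cast_nonneg n)]
          ring
  have sg : Summable g := (summable_log_sub_vonMangoldt.mul_left _).of_nonneg_of_le g0 gle
  have bg : ∑' n, g n ≤ x ^ (3 / 4 : ℝ) * D := by
    rw [hD, ← tsum_mul_left]
    exact sg.tsum_le_tsum gle (summable_log_sub_vonMangoldt.mul_left _)
  have hQ : ∑' n, coef x n ^ 2 = Real.log x * A + L - ∑' n, g n := by
    rw [← tsum_mul_left, ← (s1.mul_left _).tsum_add s2, ← ((s1.mul_left _).add s2).tsum_sub sg]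
    refine tsum_congr fun n => ?_
    rcases Nat.eq_zero_or_pos n with rfl | hn
    · simp [hg, coef]
    rw [Real.log_div (by positivity) hx0.ne']
    simp only [hg, coef]
    ring
  have hlog : √x * Real.log x ≤ 4 * x ^ (3 / 4 : ℝ) := by
    have h3 := Real.log_le_rpow_div (x := x) (ε := 1 / 4) hx0.le (by norm_num)
    calc √x * Real.log x ≤ x ^ (1 / 2 : ℝ) * (x ^ (1 / 4 : ℝ) / (1 / 4)) := by
          rw [Real.sqrt_eq_rpow]; gcongr
      _ = 4 * (x ^ (1 / 2 : ℝ) * x ^ (1 / 4 : ℝ)) := by ring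
      _ = _ := by rw [← Real.rpow_add hx0]; norm_num
  have hl0 : 0 ≤ Real.log x := Real.log_nonneg (by linarith)
  have b3 : |Real.log x * (A - x)| ≤ 4 * C₁ * x ^ (3 / 4 : ℝ) := by
    rw [abs_mul, abs_of_nonneg hl0]
    calc _ ≤ Real.log x * (C₁ * √x) := by gcongr
      _ = C₁ * (√x * Real.log x) := by ring
      _ ≤ C₁ * (4 * x ^ (3 / 4 : ℝ)) := by gcongr
      _ = _ := by ring
  have g1 : 0 ≤ ∑' n, g n := tsum_nonneg g0
  rw [abs_le] at b2 b3 ⊢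
  rw [hQ]
  constructor <;> nlinarith

/-! ### The pair correlation function -/

lemma eventually_log_pow_le (k : ℕ) :
    ∀ᶠ T in Filter.atTop, Real.log T ^ k ≤ T ^ (1 / 1000 : ℝ) := by
  have h := (isLittleO_log_rpow_rpow_atTop (k : ℝ) (show (0 : ℝ) < 1 / 1000 by norm_num)).bound
    one_pos
  filter_upwards [h, Filter.eventually_ge_atTop 1] with T hT h1
  rw [one_mul, Real.rpow_natCast, Real.norm_of_nonneg (by positivity : 0 ≤ T ^ (1 / 1000 : ℝ))] at hT
  exact (le_abs_self _).trans hT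

/-- The Dirichlet polynomial mean square, with the smoothing parameter chosen as
`T / (log T)^(M-1)`. -/
lemma exists_meanSq_div_sub_le (hRH : RiemannHypothesis) (hTPC : TwinPrimeConjecture) :
    ∃ C > 0, ∀ T x L : ℝ, 2 ≤ Real.log T → 0 < L → L * Real.log T ≤ T ^ (1 / 1000 : ℝ) →
      L * (L * Real.log T) ≤ T ^ (1 / 1000 : ℝ) → 1 ≤ L → 16 ≤ x → 0 < T →
      T ^ (999 / 1000 : ℝ) ≤ x → x ≤ T →
      |meanSq x T / x - 2 * T * Real.log x| ≤ C * (x + T / L) := by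
  obtain ⟨C₁, hC₁, h1⟩ := exists_meanSq_sub_le hTPC
  obtain ⟨C₂, hC₂, h2⟩ := exists_sum_coef_sq_sub_le hRH
  refine ⟨C₁ + 3 * C₂ + 1, by positivity, fun T x L hl hL hL1 hL2 hL3 hx hT hTx hxT => ?_⟩
  have hx0 : 0 < x := by linarith
  have hT1 : 1 ≤ T := by linarith
  set U := T / (L * Real.log T) with hU
  have hl0 : 0 < Real.log T := by linarith
  have hU0 : 0 < U := by positivity
  have hUT : U ≤ T / 2 := by
    rw [hU]; gcongr; nlinarith
  have b1 := h1 T x U hT1 hTx hxT hU0 hUT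
  have b2 := h2 x hx
  set Q := ∑' n, coef x n ^ 2
  have hlog : Real.log x ≤ Real.log T := Real.log_le_log hx0 hxT
  have hUl : U * Real.log x ≤ T / L := by
    calc U * Real.log x ≤ U * Real.log T := by gcongr
      _ = T / L := by rw [hU]; field_simp
  have hx4 : x ^ (3 / 4 : ℝ) * T ≤ x * (T / L) := by
    have h3 : L ≤ x ^ (1 / 4 : ℝ) := by
      calc L ≤ L * Real.log T := by nlinarith
        _ ≤ T ^ (1 / 1000 : ℝ) := hL1
        _ ≤ T ^ ((999 / 1000 : ℝ) * (1 / 4)) :=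
          Real.rpow_le_rpow_of_exponent_le hT1 (by norm_num)
        _ = (T ^ (999 / 1000 : ℝ)) ^ (1 / 4 : ℝ) := Real.rpow_mul hT.le _ _
        _ ≤ x ^ (1 / 4 : ℝ) := by gcongr
    rw [mul_div_assoc', le_div_iff₀ hL]
    calc x ^ (3 / 4 : ℝ) * T * L ≤ x ^ (3 / 4 : ℝ) * T * x ^ (1 / 4 : ℝ) := by gcongr
      _ = (x ^ (3 / 4 : ℝ) * x ^ (1 / 4 : ℝ)) * T := by ring
      _ = x * T := by rw [← Real.rpow_add hx0]; norm_num
  have hTU : T ^ (1999 / 1000 : ℝ) / U ≤ T / L := by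
    rw [hU, div_div_eq_mul_div, div_le_div_iff₀ hT hL]
    calc T ^ (1999 / 1000 : ℝ) * (L * Real.log T) * L =
          T ^ (1999 / 1000 : ℝ) * (L * (L * Real.log T)) := by ring
      _ ≤ T ^ (1999 / 1000 : ℝ) * T ^ (1 / 1000 : ℝ) := by gcongr
      _ = T * T := by
          rw [← Real.rpow_add hT, ← sq, ← Real.rpow_natCast]; norm_num
  have e : meanSq x T / x - 2 * T * Real.log x =
      (meanSq x T - 2 * T * Q + 2 * T * (Q - x * Real.log x)) / x := by
    field_simp; ring
  rw [e, abs_div, abs_of_pos hx0, div_le_iff₀ hx0]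
  have b3 : |2 * T * (Q - x * Real.log x)| ≤ 2 * C₂ * (x * (T / L)) := by
    rw [abs_mul, abs_of_pos (by positivity : 0 < 2 * T)]
    calc _ ≤ 2 * T * (C₂ * x ^ (3 / 4 : ℝ)) := by gcongr
      _ = 2 * C₂ * (x ^ (3 / 4 : ℝ) * T) := by ring
      _ ≤ _ := by gcongr
  have b4 : U * Q ≤ x * (T / L) + C₂ * (x * (T / L)) := by
    have h5 := (abs_le.mp b2).2
    calc U * Q ≤ U * (x * Real.log x + C₂ * x ^ (3 / 4 : ℝ)) := by gcongr; linarith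
      _ = x * (U * Real.log x) + C₂ * (x ^ (3 / 4 : ℝ) * U) := by ring
      _ ≤ x * (T / L) + C₂ * (x ^ (3 / 4 : ℝ) * T) := by gcongr; linarith
      _ ≤ _ := by gcongr
  have b5 : C₁ * (x ^ 2 + x * T ^ (1999 / 1000 : ℝ) / U) ≤ C₁ * (x ^ 2 + x * (T / L)) := by
    rw [mul_div_assoc]; gcongr
  refine (abs_add_le _ _).trans ((add_le_add b1 b3).trans ?_)
  have h6 : 0 ≤ x * (T / L) := by positivity
  nlinarith [mul_nonneg (by positivity : 0 ≤ 3 * C₂ + 1) (sq_nonneg x)]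

/-- Corollary 1: assuming RH and the quantitative Twin Prime Conjecture, for any integer
`M > 2`, `F(x,T) = (T/2π) log x + O(x) + O_M(T/(log T)^(M-2))` uniformly for
`T/(log T)^M ≤ x ≤ T`. -/
theorem pair_correlation_below_T
    (hRH : RiemannHypothesis) (hTPC : TwinPrimeConjecture) (M : ℕ) (hM : 2 < M) :
    ∃ C : ℝ, 0 < C ∧ ∃ T₀ : ℝ, ∀ T : ℝ, T₀ ≤ T → ∀ x : ℝ,
      T / (Real.log T) ^ M ≤ x → x ≤ T →
      ‖Fpair x T - ((T / (2 * π) * Real.log x : ℝ) : ℂ)‖ ≤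
        C * (x + T / (Real.log T) ^ (M - 2)) := by
  obtain ⟨C₁, hC₁, h1⟩ := exists_Fpair_sub_meanSq hRH
  obtain ⟨C₂, hC₂, h2⟩ := exists_meanSq_div_sub_le hRH hTPC
  refine ⟨3 * C₁ + C₂, by positivity, ?_⟩
  have hev : ∀ᶠ T in Filter.atTop, Real.log T ^ (2 * M) ≤ T ^ (1 / 1000 : ℝ) ∧
      2 ≤ Real.log T ∧ 32 ≤ T :=
    (eventually_log_pow_le (2 * M)).and ((Real.tendsto_log_atTop.eventually_ge_atTop 2).and
      (Filter.eventually_ge_atTop 32))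
  obtain ⟨T₀, hT₀⟩ := Filter.eventually_atTop.mp hev
  refine ⟨T₀, fun T hT x hTx hxT => ?_⟩
  obtain ⟨hp, hl, hT32⟩ := hT₀ T hT
  have hT1 : 1 ≤ T := by linarith
  have hT0 : 0 < T := by linarith
  have hl1 : 1 ≤ Real.log T := by linarith
  have hl0 : 0 < Real.log T := by linarith
  have hpow : ∀ k ≤ 2 * M, Real.log T ^ k ≤ T ^ (1 / 1000 : ℝ) :=
    fun k hk => (pow_le_pow_right₀ hl1 hk).trans hp
  have hx999 : T ^ (999 / 1000 : ℝ) ≤ x := by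
    refine le_trans ?_ hTx
    rw [le_div_iff₀ (by positivity)]
    calc _ ≤ T ^ (999 / 1000 : ℝ) * T ^ (1 / 1000 : ℝ) := by gcongr; exact hpow M (by omega)
      _ = T := by rw [← Real.rpow_add hT0]; norm_num
  have hx16 : 16 ≤ x := by
    refine le_trans ?_ hx999
    calc (16 : ℝ) = 32 ^ (4 / 5 : ℝ) := by
          rw [show (32 : ℝ) = 2 ^ (5 : ℝ) by norm_num, ← Real.rpow_mul (by norm_num)]; norm_num
      _ ≤ T ^ (4 / 5 : ℝ) := by gcongr
      _ ≤ _ := Real.rpow_le_rpow_of_exponent_le hT1 (by norm_num)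
  have hx0 : 0 < x := by linarith
  set L := Real.log T ^ (M - 2) with hL
  have hL0 : 0 < L := by positivity
  have e1 : L * Real.log T = Real.log T ^ (M - 1) := by
    rw [hL, ← pow_succ]; congr 1; omega
  have e2 : L * (L * Real.log T) = Real.log T ^ (2 * M - 3) := by
    rw [e1, hL, ← pow_add]; congr 1; omega
  have b2 := h2 T x L hl hL0 (e1 ▸ hpow _ (by omega)) (e2 ▸ hpow _ (by omega))
    (one_le_pow₀ hl1) hx16 hT0 hx999 hxT
  have hq : (2 + T) ^ (1 / 10 : ℝ) ≤ T ^ (1 / 5 : ℝ) := by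
    calc (2 + T) ^ (1 / 10 : ℝ) ≤ (T ^ (2 : ℝ)) ^ (1 / 10 : ℝ) := by
          gcongr; rw [Real.rpow_two]; nlinarith
      _ = T ^ (1 / 5 : ℝ) := by rw [← Real.rpow_mul hT0.le]; norm_num
  have hq3 : ((2 + T) ^ (1 / 10 : ℝ)) ^ 3 ≤ x := by
    calc _ ≤ (T ^ (1 / 5 : ℝ)) ^ 3 := by gcongr
      _ = T ^ (3 / 5 : ℝ) := by rw [← Real.rpow_natCast, ← Real.rpow_mul hT0.le]; norm_num
      _ ≤ T ^ (999 / 1000 : ℝ) := Real.rpow_le_rpow_of_exponent_le hT1 (by norm_num)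
      _ ≤ x := hx999
  have hq2 : ((2 + T) ^ (1 / 10 : ℝ)) ^ 2 * T / x ≤ x := by
    rw [div_le_iff₀ hx0]
    calc _ ≤ (T ^ (1 / 5 : ℝ)) ^ 2 * T := by gcongr
      _ = T ^ (7 / 5 : ℝ) := by
          rw [← Real.rpow_natCast, ← Real.rpow_mul hT0.le, ← Real.rpow_add_one hT0.ne']; norm_num
      _ ≤ T ^ (999 / 1000 + 999 / 1000 : ℝ) := Real.rpow_le_rpow_of_exponent_le hT1 (by norm_num)
      _ = T ^ (999 / 1000 : ℝ) * T ^ (999 / 1000 : ℝ) := Real.rpow_add hT0 _ _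
      _ ≤ x * x := by gcongr
  have b1 : ‖Fpair x T - ((1 / (4 * π) * (meanSq x T / x) : ℝ) : ℂ)‖ ≤ 3 * C₁ * x := by
    refine (h1 x T (by linarith) hT0.le).trans ?_
    calc _ ≤ C₁ * (x + x + x) := by gcongr
      _ = _ := by ring
  have b3 : ‖((1 / (4 * π) * (meanSq x T / x) : ℝ) : ℂ) - ((T / (2 * π) * Real.log x : ℝ) : ℂ)‖ ≤
      C₂ * (x + T / L) := by
    rw [← Complex.ofReal_sub, Complex.norm_real, Real.norm_eq_abs,
      show 1 / (4 * π) * (meanSq x T / x) - T / (2 * π) * Real.log x =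
        1 / (4 * π) * (meanSq x T / x - 2 * T * Real.log x) by field_simp; ring,
      abs_mul, abs_of_pos (by positivity)]
    refine le_trans (mul_le_of_le_one_left (abs_nonneg _) ?_) b2
    rw [div_le_one (by positivity)]
    linarith [Real.pi_gt_three]
  calc _ ≤ ‖Fpair x T - ((1 / (4 * π) * (meanSq x T / x) : ℝ) : ℂ)‖ + _ :=
        norm_sub_le_norm_sub_add_norm_sub _ _ _
    _ ≤ 3 * C₁ * x + C₂ * (x + T / L) := add_le_add b1 b3
    _ ≤ _ := by
        have : 0 ≤ T / L := by positivity
        nlinarith [mul_nonneg hC₁.le this]
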